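/- arXiv:2005.03105 — 3 statements merged into one kernel-verified Lean document; each statement's English description precedes it below -/
import Mathlib

section
/- For every integer n ≥ 10 there is no irreducible complex representation of the braid group B_n of dimension n+1. Concretely: for any invertible complex (n+1)×(n+1) matrices C_1, …, C_{n−1} ∈ GL_{n+1}(ℂ) satisfying the braid relations, there exists a subspace of ℂ^{n+1} invariant under every C_i that is neither {0} nor all of ℂ^{n+1}. -/
namespace BraidRep

/-- Braid relations for `s 1, …, s (n-1)` in a group. -/
structure Br {G : Type*} [Group G] (n : ℕ) (s : ℕ → G) : Prop where
  comm : ∀ i j, 1 ≤ i → i + 2 ≤ j → j < n → s i * s j = s j * s i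
  braid : ∀ i, 1 ≤ i → i + 1 < n → s i * s (i + 1) * s i = s (i + 1) * s i * s (i + 1)

section group
variable {G : Type*} [Group G] {n : ℕ} {s : ℕ → G}

theorem Br.comm' (h : Br n s) {i j : ℕ} (hi : 1 ≤ i) (hj : 1 ≤ j) (hin : i < n) (hjn : j < n)
    (hij : i + 2 ≤ j ∨ j + 2 ≤ i ∨ i = j) : Commute (s i) (s j) := by
  rcases hij with h1 | h1 | h1
  · exact h.comm i j hi h1 hjn
  · exact (h.comm j i hj h1 hin).symm
  · subst h1; exact Commute.refl _

theorem Br.slide (h : Br n s) {a b : ℕ} (ha : 1 ≤ a) (hab : a ≤ b) (hb : b < n) :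
    ∃ g : G, g * s a = s b * g ∧
      ∀ l, 1 ≤ l → l < n → (l + 2 ≤ a ∨ b + 2 ≤ l) → g * s l = s l * g := by
  induction b, hab using Nat.le_induction with
  | base => exact ⟨1, by simp, fun l _ _ _ => by simp⟩
  | succ b hab ih =>
    obtain ⟨g, hg, hc⟩ := ih (by omega)
    refine ⟨s b * s (b + 1) * g, ?_, ?_⟩
    · rw [mul_assoc, hg, ← mul_assoc, ← mul_assoc, h.braid b (by omega) hb]; simp only [mul_assoc]
    · intro l hl hln hlab
      have c1 := h.comm' (i := b) (j := l) (by omega) hl (by omega) hln (by omega)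
      have c2 := h.comm' (i := b + 1) (j := l) (by omega) hl (by omega) hln (by omega)
      have c3 : Commute g (s l) := hc l hl hln (by omega)
      exact (c1.mul_left c2).mul_left c3

theorem Br.swap (h : Br n s) {i : ℕ} (hi : 1 ≤ i) (hin : i + 2 < n) :
    ∃ g : G, g * s i = s (i + 2) * g ∧ g * s (i + 2) = s i * g ∧
      ∀ l, 1 ≤ l → l < n → (l + 2 ≤ i ∨ i + 4 ≤ l) → g * s l = s l * g := by
  have c13 := h.comm i (i + 2) hi le_rfl hin
  have b1 := h.braid i hi (by omega)
  have b2 := h.braid (i + 1) (by omega) (by omega)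
  refine ⟨s (i + 1) * s i * s (i + 2) * s (i + 1), ?_, ?_, ?_⟩
  · calc s (i + 1) * s i * s (i + 2) * s (i + 1) * s i
        = s (i + 1) * (s i * s (i + 2)) * s (i + 1) * s i := by simp only [mul_assoc]
      _ = s (i + 1) * s (i + 2) * (s i * s (i + 1) * s i) := by rw [c13]; simp only [mul_assoc]
      _ = (s (i + 1) * s (i + 1 + 1) * s (i + 1)) * s i * s (i + 1) := by
          rw [b1]; simp only [mul_assoc]
      _ = s (i + 2) * s (i + 1) * (s (i + 2) * s i) * s (i + 1) := by
          rw [b2]; simp only [mul_assoc]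
      _ = _ := by rw [← c13]; simp only [mul_assoc]
  · calc s (i + 1) * s i * s (i + 2) * s (i + 1) * s (i + 2)
        = s (i + 1) * s i * (s (i + 1 + 1) * s (i + 1) * s (i + 1 + 1)) := by
          simp only [mul_assoc]
      _ = (s (i + 1) * s i * s (i + 1)) * s (i + 2) * s (i + 1) := by
          rw [← b2]; simp only [mul_assoc]
      _ = _ := by rw [← b1]; simp only [mul_assoc]
  · intro l hl hln hlab
    have c1 := h.comm' (i := i) (j := l) (by omega) hl (by omega) hln (by omega)
    have c2 := h.comm' (i := i + 1) (j := l) (by omega) hl (by omega) hln (by omega)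
    have c3 := h.comm' (i := i + 2) (j := l) (by omega) hl (by omega) hln (by omega)
    exact ((c2.mul_left c1).mul_left c3).mul_left c2

theorem Br.shift (h : Br n s) {i : ℕ} (hi : 1 ≤ i) (hin : i + 2 < n) :
    ∃ g : G, g * s i = s (i + 1) * g ∧ g * s (i + 1) = s (i + 2) * g ∧
      ∀ l, 1 ≤ l → l < n → (l + 2 ≤ i ∨ i + 4 ≤ l) → g * s l = s l * g := by
  have c13 := h.comm i (i + 2) hi le_rfl hin
  have b1 := h.braid i hi (by omega)
  have b2 := h.braid (i + 1) (by omega) (by omega)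
  refine ⟨s i * s (i + 1) * s (i + 2), ?_, ?_, ?_⟩
  · calc s i * s (i + 1) * s (i + 2) * s i = s i * s (i + 1) * (s (i + 2) * s i) := by
          simp only [mul_assoc]
      _ = (s i * s (i + 1) * s i) * s (i + 2) := by rw [← c13]; simp only [mul_assoc]
      _ = _ := by rw [b1]; simp only [mul_assoc]
  · calc s i * s (i + 1) * s (i + 2) * s (i + 1)
        = s i * (s (i + 1) * s (i + 1 + 1) * s (i + 1)) := by simp only [mul_assoc]
      _ = (s i * s (i + 2)) * s (i + 1) * s (i + 2) := by rw [b2]; simp only [mul_assoc]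
      _ = _ := by rw [c13]; simp only [mul_assoc]
  · intro l hl hln hlab
    have c1 := h.comm' (i := i) (j := l) (by omega) hl (by omega) hln (by omega)
    have c2 := h.comm' (i := i + 1) (j := l) (by omega) hl (by omega) hln (by omega)
    have c3 := h.comm' (i := i + 2) (j := l) (by omega) hl (by omega) hln (by omega)
    exact (c1.mul_left c2).mul_left c3

/-- Every permutation of the odd generators is realized by conjugation. -/
theorem Br.sym (h : Br n s) {k : ℕ} (hk : 2 * k ≤ n) (π : Equiv.Perm (Fin k)) :
    ∃ g : G, ∀ i : Fin k, g * s (2 * i.1 + 1) = s (2 * (π i).1 + 1) * g := by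
  cases k with
  | zero => exact ⟨1, fun i => i.elim0⟩
  | succ k =>
    have hπ : π ∈ Submonoid.closure
        (Set.range fun i : Fin k => Equiv.swap i.castSucc i.succ) := by
      rw [Equiv.Perm.mclosure_swap_castSucc_succ]; trivial
    induction hπ using Submonoid.closure_induction with
    | one => exact ⟨1, fun i => by simp⟩
    | mul x y _ _ hx hy =>
      obtain ⟨g, hg⟩ := hx
      obtain ⟨g', hg'⟩ := hy
      refine ⟨g * g', fun i => ?_⟩
      rw [mul_assoc, hg', ← mul_assoc, hg, mul_assoc, Equiv.Perm.mul_apply]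
    | mem x hx =>
      obtain ⟨j, rfl⟩ := hx
      have hj := j.2
      obtain ⟨g, h1, h2, h3⟩ := h.swap (i := 2 * j.1 + 1) (by omega) (by omega)
      refine ⟨g, fun i => ?_⟩
      by_cases e1 : i = j.castSucc
      · subst e1
        simp only [Equiv.swap_apply_left, Fin.val_castSucc, Fin.val_succ]
        rw [h1]; congr 2
      · by_cases e2 : i = j.succ
        · subst e2
          simp only [Equiv.swap_apply_right, Fin.val_castSucc, Fin.val_succ]
          have : 2 * (j.1 + 1) + 1 = 2 * j.1 + 1 + 2 := by ring
          rw [this, h2]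
        · simp only [Equiv.swap_apply_of_ne_of_ne e1 e2]
          have e1' : i.1 ≠ j.1 := fun e => e1 (Fin.ext e)
          have e2' : i.1 ≠ j.1 + 1 := fun e => e2 (Fin.ext e)
          exact h3 _ (by omega) (by omega) (by omega)

/-- Token positions: odd positions for `i < l`, shifted by one afterwards. -/
def pos (l i : ℕ) : ℕ := if i < l then 2 * i + 1 else 2 * i + 2

theorem Br.cfgpos (h : Br n s) {q : ℕ} (hq : 2 * q < n) {l : ℕ} (hl : l ≤ q) :
    ∃ g : G, ∀ i, i < q → g * s (pos q i) = s (pos l i) * g := by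
  induction hl using Nat.decreasingInduction with
  | self => exact ⟨1, fun i _ => by simp⟩
  | of_succ l hl ih =>
    obtain ⟨g, hg⟩ := ih
    obtain ⟨g', h1, h2⟩ := h.slide (a := 2 * l + 1) (b := 2 * l + 2) (by omega) (by omega) (by omega)
    refine ⟨g' * g, fun i hi => ?_⟩
    rw [mul_assoc, hg i hi, ← mul_assoc, ← mul_assoc]
    congr 1
    rcases lt_trichotomy i l with e | e | e
    · simp only [pos, if_pos e, if_pos (show i < l + 1 by omega)]
      exact h2 _ (by omega) (by omega) (by omega)
    · subst e
      simpa [pos] using h1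
    · simp only [pos, if_neg (show ¬ i < l by omega), if_neg (show ¬ i < l + 1 by omega)]
      exact h2 _ (by omega) (by omega) (by omega)

end group
end BraidRep

namespace BraidRep
open Module

section linear
variable {V : Type*} [AddCommGroup V] [Module ℂ V]

/-- The operator `s i - c`. -/
def A (s : ℕ → V ≃ₗ[ℂ] V) (c : ℂ) (i : ℕ) : V →ₗ[ℂ] V := (s i : V →ₗ[ℂ] V) - c • LinearMap.id

/-- The image of `s i - c`. -/
def I (s : ℕ → V ≃ₗ[ℂ] V) (c : ℂ) (i : ℕ) : Submodule ℂ V := LinearMap.range (A s c i)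

/-- The sum of the images at the positions `p i`, `i ∈ S`. -/
def W (s : ℕ → V ≃ₗ[ℂ] V) (c : ℂ) (p : ℕ → ℕ) (S : Finset ℕ) : Submodule ℂ V :=
  S.sup fun i => I s c (p i)

/-- Irreducibility. -/
def Irr (n : ℕ) (s : ℕ → V ≃ₗ[ℂ] V) : Prop :=
  ∀ p : Submodule ℂ V, (∀ i, 1 ≤ i → i < n → ∀ v ∈ p, s i v ∈ p) → p = ⊥ ∨ p = ⊤

/-- Invariance under `s i`. -/
def Stab (s : ℕ → V ≃ₗ[ℂ] V) (i : ℕ) (p : Submodule ℂ V) : Prop := ∀ v ∈ p, s i v ∈ p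

variable {n : ℕ} {s : ℕ → V ≃ₗ[ℂ] V} {c : ℂ}

theorem A_apply (i : ℕ) (v : V) : A s c i v = s i v - c • v := by simp [A]

theorem s_apply (i : ℕ) (v : V) : s i v = A s c i v + c • v := by simp [A]

theorem A_mem (i : ℕ) (v : V) : A s c i v ∈ I s c i := ⟨v, rfl⟩

theorem conj_s {g : V ≃ₗ[ℂ] V} {i j : ℕ} (h : g * s i = s j * g) (v : V) :
    g (s i v) = s j (g v) := by
  have := congrArg (fun e : V ≃ₗ[ℂ] V => e v) h
  simpa using this

theorem conj_A {g : V ≃ₗ[ℂ] V} {i j : ℕ} (h : g * s i = s j * g) (v : V) :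
    g (A s c i v) = A s c j (g v) := by
  simp [A_apply, conj_s h]

theorem conj_mem {g : V ≃ₗ[ℂ] V} {i j : ℕ} (h : g * s i = s j * g) {v : V} :
    g v ∈ I s c j ↔ v ∈ I s c i := by
  constructor
  · rintro ⟨u, hu⟩
    refine ⟨g.symm u, ?_⟩
    apply g.injective
    rw [conj_A h]; simpa using hu
  · rintro ⟨u, rfl⟩
    exact ⟨g u, (conj_A h u).symm⟩

theorem conj_I {g : V ≃ₗ[ℂ] V} {i j : ℕ} (h : g * s i = s j * g) :
    (I s c i).map (g : V →ₗ[ℂ] V) = I s c j := by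
  ext v
  constructor
  · rintro ⟨u, hu, rfl⟩
    exact (conj_mem h).2 hu
  · intro hv
    refine ⟨g.symm v, ?_, by simp⟩
    exact (conj_mem h).1 (by simpa using hv)

theorem stab_I {i j : ℕ} (h : Commute (s i) (s j)) : Stab s i (I s c j) := fun _ hv =>
  (conj_mem (g := s i) h).2 hv

theorem Stab.A {i : ℕ} {p : Submodule ℂ V} (h : Stab s i p) {v : V} (hv : v ∈ p) :
    A s c i v ∈ p := by
  rw [A_apply]; exact p.sub_mem (h v hv) (p.smul_mem _ hv)

theorem Stab.sup {i : ℕ} {p q : Submodule ℂ V} (hp : Stab s i p) (hq : Stab s i q) :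
    Stab s i (p ⊔ q) := by
  intro v hv
  obtain ⟨x, hx, y, hy, rfl⟩ := Submodule.mem_sup.1 hv
  rw [map_add]
  exact Submodule.add_mem_sup (hp x hx) (hq y hy)

theorem Stab.inf {i : ℕ} {p q : Submodule ℂ V} (hp : Stab s i p) (hq : Stab s i q) :
    Stab s i (p ⊓ q) := fun v hv => ⟨hp v hv.1, hq v hv.2⟩

theorem Stab.finset_sup {i : ℕ} {S : Finset ℕ} {P : ℕ → Submodule ℂ V}
    (h : ∀ j ∈ S, Stab s i (P j)) : Stab s i (S.sup P) := by
  classical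
  induction S using Finset.induction_on with
  | empty => intro v hv; simp at hv; simp [hv]
  | insert a S _ ih =>
    rw [Finset.sup_insert]
    exact (h a (by simp)).sup (ih fun j hj => h j (by simp [hj]))

theorem Stab.finset_inf {i : ℕ} {S : Finset ℕ} {P : ℕ → Submodule ℂ V}
    (h : ∀ j ∈ S, Stab s i (P j)) : Stab s i (S.inf P) := by
  classical
  induction S using Finset.induction_on with
  | empty => intro v hv; simp
  | insert a S _ ih =>
    rw [Finset.inf_insert]
    exact (h a (by simp)).inf (ih fun j hj => h j (by simp [hj]))

theorem stab_W (h : Br n s) {i : ℕ} {p : ℕ → ℕ} {S : Finset ℕ} (hi : 1 ≤ i) (hin : i < n)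
    (hp : ∀ t ∈ S, 1 ≤ p t ∧ p t < n ∧ (i = p t ∨ p t + 2 ≤ i ∨ i + 2 ≤ p t)) :
    Stab s i (W s c p S) := by
  apply Stab.finset_sup
  intro t ht
  obtain ⟨h1, h2, h3⟩ := hp t ht
  exact stab_I (h.comm' hi h1 hin h2 (by omega))

/-- A subspace attached to token configurations which does not change when one token slides
is invariant. -/
theorem chain (irr : Irr n s) {m : ℕ} (hm : 2 * m < n) (Φ : ℕ → Submodule ℂ V)
    (hstab : ∀ l ≤ m, ∀ i, 1 ≤ i → i < n →
      (∀ t < m, i = pos l t ∨ pos l t + 2 ≤ i ∨ i + 2 ≤ pos l t) → Stab s i (Φ l))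
    (hchain : ∀ l < m, Φ l = Φ (l + 1)) : Φ m = ⊥ ∨ Φ m = ⊤ := by
  have h0 : ∀ l ≤ m, Φ l = Φ 0 := by
    intro l
    induction l with
    | zero => simp
    | succ l ih => intro hl; rw [← hchain l (by omega), ih (by omega)]
  apply irr
  intro i hi hin
  by_cases hodd : i % 2 = 1 ∨ 2 * m < i
  · refine hstab m le_rfl i hi hin fun t ht => ?_
    simp only [pos, if_pos ht]; omega
  · rw [h0 m le_rfl]
    refine hstab 0 (by omega) i hi hin fun t ht => ?_
    simp only [pos, not_lt_zero, if_false]; omega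

theorem pos_bound {q l t : ℕ} (hq : 2 * q < n) (ht : t < q) : 1 ≤ pos l t ∧ pos l t < n := by
  unfold pos; split_ifs <;> omega

theorem pos_succ {l t : ℕ} (h : t ≠ l) : pos (l + 1) t = pos l t := by
  unfold pos
  by_cases h1 : t < l
  · rw [if_pos h1, if_pos (by omega)]
  · rw [if_neg h1, if_neg (by omega)]

theorem W_congr {p p' : ℕ → ℕ} {S : Finset ℕ} (h : ∀ t ∈ S, p t = p' t) :
    W s c p S = W s c p' S := by
  unfold W
  exact Finset.sup_congr rfl fun t ht => by rw [h t ht]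

theorem W_mono {p : ℕ → ℕ} {S T : Finset ℕ} (h : S ⊆ T) : W s c p S ≤ W s c p T :=
  Finset.sup_mono h

theorem W_union {p : ℕ → ℕ} {S T : Finset ℕ} : W s c p (S ∪ T) = W s c p S ⊔ W s c p T :=
  Finset.sup_union

theorem exists_sym (h : Br n s) {k : ℕ} (hk : 2 * k ≤ n) {S T : Finset ℕ}
    (hS : S ⊆ Finset.range k) (hT : T ⊆ Finset.range k) (hc : S.card = T.card) :
    ∃ g : V ≃ₗ[ℂ] V, ∀ i ∈ S, ∃ j ∈ T, g * s (2 * i + 1) = s (2 * j + 1) * g := by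
  classical
  let e : {x : Fin k // x.1 ∈ S} ≃ {x : Fin k // x.1 ∈ T} := by
    have e0 : ∀ S : Finset ℕ, S ⊆ Finset.range k → ({x : Fin k // x.1 ∈ S} ≃ {x // x ∈ S}) :=
      fun S hS =>
      { toFun := fun x => ⟨x.1.1, x.2⟩
        invFun := fun x => ⟨⟨x.1, Finset.mem_range.1 (hS x.2)⟩, x.2⟩
        left_inv := fun x => by simp
        right_inv := fun x => by simp }
    exact (e0 S hS).trans ((Finset.equivOfCardEq hc).trans (e0 T hT).symm)
  obtain ⟨g, hg⟩ := h.sym hk e.extendSubtype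
  refine ⟨g, fun i hi => ?_⟩
  let i' : Fin k := ⟨i, Finset.mem_range.1 (hS hi)⟩
  exact ⟨(e.extendSubtype i').1, e.extendSubtype_mem i' hi, hg i'⟩

variable [FiniteDimensional ℂ V]

/-- Dimension of the sum of `m` commuting images. -/
noncomputable def F (s : ℕ → V ≃ₗ[ℂ] V) (c : ℂ) (m : ℕ) : ℕ :=
  finrank ℂ (W s c (fun t => 2 * t + 1) (Finset.range m))

theorem W_le_of_card (h : Br n s) {k : ℕ} (hk : 2 * k ≤ n) {S T : Finset ℕ}
    (hS : S ⊆ Finset.range k) (hT : T ⊆ Finset.range k) (hc : S.card = T.card) :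
    finrank ℂ (W s c (fun t => 2 * t + 1) S) ≤ finrank ℂ (W s c (fun t => 2 * t + 1) T) := by
  obtain ⟨g, hg⟩ := exists_sym h hk hS hT hc
  rw [← LinearEquiv.finrank_map_eq g]
  apply Submodule.finrank_mono
  rw [Submodule.map_le_iff_le_comap]
  refine Finset.sup_le fun i hi => ?_
  obtain ⟨j, hj, e⟩ := hg i hi
  rw [← Submodule.map_le_iff_le_comap]
  exact (conj_I e).le.trans (Finset.le_sup (f := fun t => I s c (2 * t + 1)) hj)

theorem finrank_W0 (h : Br n s) {k : ℕ} (hk : 2 * k ≤ n) {S : Finset ℕ}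
    (hS : S ⊆ Finset.range k) :
    finrank ℂ (W s c (fun t => 2 * t + 1) S) = F s c S.card := by
  have hle : Finset.range S.card ⊆ Finset.range k := by
    have := Finset.card_le_card hS
    simpa using this
  exact le_antisymm (W_le_of_card h hk hS hle (by simp)) (W_le_of_card h hk hle hS (by simp))

theorem finrank_W (h : Br n s) {q : ℕ} (hq : 2 * q < n) {l : ℕ} (hl : l ≤ q) {S : Finset ℕ}
    (hS : S ⊆ Finset.range q) :
    finrank ℂ (W s c (pos l) S) = F s c S.card := by
  obtain ⟨g, hg⟩ := h.cfgpos hq hl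
  rw [← finrank_W0 h hq.le hS]
  have hmap : (W s c (fun t => 2 * t + 1) S).map (g : V →ₗ[ℂ] V) = W s c (pos l) S := by
    unfold W
    have : ∀ (f : ℕ → Submodule ℂ V), (S.sup f).map (g : V →ₗ[ℂ] V) =
        S.sup fun i => (f i).map (g : V →ₗ[ℂ] V) := by
      intro f
      rw [Finset.sup_eq_iSup, Finset.sup_eq_iSup]
      simp only [Submodule.map_iSup]
    rw [this]
    refine Finset.sup_congr rfl fun i hi => ?_
    have hi' := Finset.mem_range.1 (hS hi)
    have := hg i hi'
    rw [show pos q i = 2 * i + 1 by simp [pos, hi']] at this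
    exact conj_I this
  rw [← hmap]
  exact (LinearEquiv.finrank_map_eq g _)

end linear
end BraidRep

namespace BraidRep
open Module

set_option linter.unusedSectionVars false
section seq
variable {V : Type*} [AddCommGroup V] [Module ℂ V] [FiniteDimensional ℂ V]
variable {n : ℕ} {s : ℕ → V ≃ₗ[ℂ] V} {c : ℂ}

theorem F_zero : F s c 0 = 0 := by
  have : W s c (fun t => 2 * t + 1) (Finset.range 0) = ⊥ := Finset.sup_empty
  rw [F, this, finrank_bot]

theorem F_mono {a b : ℕ} (h : a ≤ b) : F s c a ≤ F s c b :=
  Submodule.finrank_mono (W_mono (Finset.range_mono h))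

/-- Inclusion–exclusion for two one-element deletions. -/
theorem del_two (h : Br n s) {q : ℕ} (hq : 2 * q < n) {l m : ℕ} (hl : l ≤ q) (hm : m + 2 ≤ q)
    {i j : ℕ} (hi : i ∈ Finset.range (m + 2)) (hj : j ∈ Finset.range (m + 2)) (hij : i ≠ j) :
    finrank ℂ ↥(W s c (pos l) ((Finset.range (m + 2)).erase i) ⊓
      W s c (pos l) ((Finset.range (m + 2)).erase j)) + F s c (m + 2) = 2 * F s c (m + 1) ∧
    W s c (pos l) (((Finset.range (m + 2)).erase j).erase i) ≤
      W s c (pos l) ((Finset.range (m + 2)).erase i) ⊓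
      W s c (pos l) ((Finset.range (m + 2)).erase j) ∧
    finrank ℂ ↥(W s c (pos l) (((Finset.range (m + 2)).erase j).erase i)) = F s c m := by
  have hsub : Finset.range (m + 2) ⊆ Finset.range q := Finset.range_mono hm
  have hU : (Finset.range (m + 2)).erase i ∪ (Finset.range (m + 2)).erase j
      = Finset.range (m + 2) := by
    ext x; simp only [Finset.mem_union, Finset.mem_erase]
    constructor
    · rintro (h | h) <;> exact h.2
    · intro hx
      by_cases e : x = i
      · right; exact ⟨fun e' => hij (e.symm.trans e'), hx⟩
      · left; exact ⟨e, hx⟩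
  have e1 := finrank_W (c := c) h hq hl ((Finset.erase_subset i _).trans hsub)
  have e2 := finrank_W (c := c) h hq hl ((Finset.erase_subset j _).trans hsub)
  have e3 := finrank_W (c := c) h hq hl hsub
  rw [Finset.card_erase_of_mem hi, Finset.card_range] at e1
  rw [Finset.card_erase_of_mem hj, Finset.card_range] at e2
  rw [Finset.card_range] at e3
  have e4 := Submodule.finrank_sup_add_finrank_inf_eq
    (W s c (pos l) ((Finset.range (m + 2)).erase i))
    (W s c (pos l) ((Finset.range (m + 2)).erase j))
  rw [← W_union, hU, e1, e2, e3] at e4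
  simp only [Nat.add_succ_sub_one] at e4
  refine ⟨by omega, le_inf (W_mono ?_) (W_mono ?_), ?_⟩
  · exact Finset.erase_subset_erase _ (Finset.erase_subset _ _)
  · exact Finset.erase_subset _ _
  · rw [finrank_W h hq hl (((Finset.erase_subset _ _).trans (Finset.erase_subset _ _)).trans hsub)]
    rw [Finset.card_erase_of_mem (by simp [hij] at hi ⊢; omega), Finset.card_erase_of_mem hj,
      Finset.card_range]
    rfl

theorem F_concave (h : Br n s) {q : ℕ} (hq : 2 * q < n) {m : ℕ} (hm : m + 2 ≤ q) :
    F s c (m + 2) + F s c m ≤ 2 * F s c (m + 1) := by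
  obtain ⟨h1, h2, h3⟩ := del_two (c := c) h hq (le_refl q) hm (i := 0) (j := 1) (by simp) (by simp)
    (by simp)
  have := Submodule.finrank_mono h2
  omega

theorem stab_W' (h : Br n s) {m : ℕ} (hm : 2 * m < n) {l i : ℕ} {S : Finset ℕ}
    (hS : S ⊆ Finset.range m) (hi : 1 ≤ i) (hin : i < n)
    (hp : ∀ t < m, i = pos l t ∨ pos l t + 2 ≤ i ∨ i + 2 ≤ pos l t) :
    Stab s i (W s c (pos l) S) := by
  refine stab_W h hi hin fun t ht => ?_
  have ht' := Finset.mem_range.1 (hS ht)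
  exact ⟨(pos_bound hm ht').1, (pos_bound hm ht').2, hp t ht'⟩

/-- Strict growth. -/
theorem F_strict (h : Br n s) (irr : Irr n s) {m : ℕ} (hm : 2 * (m + 1) < n)
    (hlt : F s c m < finrank ℂ V) (h0 : F s c 1 ≠ 0) : F s c m < F s c (m + 1) := by
  by_contra hcon
  have heq : F s c (m + 1) = F s c m := le_antisymm (not_lt.1 hcon) (F_mono (by omega))
  have key : ∀ l ≤ m + 1, ∀ j < m + 1, W s c (pos l) (Finset.range (m + 1)) =
      W s c (pos l) ((Finset.range (m + 1)).erase j) := by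
    intro l hl j hj
    symm
    apply Submodule.eq_of_le_of_finrank_eq (W_mono (Finset.erase_subset _ _))
    rw [finrank_W h hm hl subset_rfl, finrank_W h hm hl (Finset.erase_subset _ _),
      Finset.card_erase_of_mem (Finset.mem_range.2 hj), Finset.card_range, heq]
    rfl
  have := chain irr hm (fun l => W s c (pos l) (Finset.range (m + 1)))
    (fun l _ i hi hin hp => stab_W' h hm subset_rfl hi hin hp)
    (fun l hl => by
      show W s c (pos l) _ = W s c (pos (l + 1)) _
      rw [key l (by omega) l hl, key (l + 1) (by omega) l hl]
      exact W_congr fun t ht => (pos_succ (Finset.ne_of_mem_erase ht)).symm)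
  have e := finrank_W (c := c) h hm le_rfl (subset_refl (Finset.range (m + 1)))
  rw [Finset.card_range] at e
  rcases this with h1 | h1
  · rw [h1, finrank_bot] at e
    have := F_mono (s := s) (c := c) (show 1 ≤ m + 1 by omega)
    omega
  · rw [h1, finrank_top] at e
    omega

theorem finrank_finset_inf {S : Finset ℕ} {P : ℕ → Submodule ℂ V} {U : Submodule ℂ V} {a : ℕ}
    (h1 : ∀ i ∈ S, P i ≤ U) (h2 : ∀ i ∈ S, finrank ℂ U ≤ finrank ℂ (P i) + a) :
    finrank ℂ U ≤ finrank ℂ ↥(U ⊓ S.inf P) + S.card * a := by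
  classical
  induction S using Finset.induction_on with
  | empty => rw [Finset.inf_empty, inf_top_eq]; simp
  | insert x S hx ih =>
    have ih' := ih (fun i hi => h1 i (by simp [hi])) (fun i hi => h2 i (by simp [hi]))
    have e := Submodule.finrank_sup_add_finrank_inf_eq (P x) (U ⊓ S.inf P)
    have hle : finrank ℂ ↥(P x ⊔ U ⊓ S.inf P) ≤ finrank ℂ U :=
      Submodule.finrank_mono (sup_le (h1 x (by simp)) inf_le_left)
    have hx2 := h2 x (by simp)
    rw [Finset.inf_insert, Finset.card_insert_of_notMem hx]
    rw [inf_left_comm] at e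
    have : (S.card + 1) * a = S.card * a + a := by ring
    omega

/-- Equality of consecutive increments forces all increments to agree. -/
theorem F_equal (h : Br n s) (irr : Irr n s) {m : ℕ} (hm : 2 * (m + 2) < n)
    (hlt : F s c (m + 1) < finrank ℂ V)
    (heq : F s c (m + 2) + F s c m = 2 * F s c (m + 1)) :
    F s c (m + 2) ≤ (m + 2) * (F s c (m + 2) - F s c (m + 1)) := by
  set M := Finset.range (m + 2) with hM
  have key : ∀ l ≤ m + 2, ∀ j ∈ M, M.inf (fun i => W s c (pos l) (M.erase i)) =
      (M.erase j).inf fun i => W s c (pos l) ((M.erase j).erase i) := by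
    intro l hl j hj
    have h2 : ∀ i ∈ M.erase j, W s c (pos l) (M.erase i) ⊓ W s c (pos l) (M.erase j)
        = W s c (pos l) ((M.erase j).erase i) := by
      intro i hi
      obtain ⟨hij, hi⟩ := Finset.mem_erase.1 hi
      obtain ⟨d1, d2, d3⟩ := del_two (c := c) h hm hl le_rfl hi hj hij
      symm
      apply Submodule.eq_of_le_of_finrank_eq d2
      omega
    have h4 : ((M.erase j).inf fun i => W s c (pos l) (M.erase i) ⊓ W s c (pos l) (M.erase j)) =
        ((M.erase j).inf fun i => W s c (pos l) (M.erase i)) ⊓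
          ((M.erase j).inf fun _ => W s c (pos l) (M.erase j)) := Finset.inf_inf
    rw [← Finset.inf_congr rfl h2, h4]
    have h3 : (M.erase j).inf (fun _ => W s c (pos l) (M.erase j)) = W s c (pos l) (M.erase j) := by
      apply Finset.inf_const
      rw [← Finset.card_pos, Finset.card_erase_of_mem hj, hM, Finset.card_range]
      omega
    rw [h3]
    conv_lhs => rw [← Finset.insert_erase hj]
    rw [Finset.inf_insert, Finset.insert_erase hj, inf_comm]
  have := chain irr hm (fun l => M.inf (fun i => W s c (pos l) (M.erase i)))
    (fun l _ i hi hin hp => Stab.finset_inf fun j _ =>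
      stab_W' h hm (Finset.erase_subset _ _) hi hin hp)
    (fun l hl => by
      show M.inf (fun i => W s c (pos l) (M.erase i)) =
        M.inf (fun i => W s c (pos (l + 1)) (M.erase i))
      have hlM : l ∈ M := Finset.mem_range.2 hl
      rw [key l (by omega) l hlM, key (l + 1) (by omega) l hlM]
      refine Finset.inf_congr rfl fun i hi => W_congr fun t ht => ?_
      exact (pos_succ (Finset.ne_of_mem_erase (Finset.mem_of_mem_erase ht))).symm)
  have hd : ∀ i ∈ M, finrank ℂ (W s c (pos (m + 2)) (M.erase i)) = F s c (m + 1) := by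
    intro i hi
    rw [finrank_W h hm le_rfl (Finset.erase_subset _ _), Finset.card_erase_of_mem hi,
      hM, Finset.card_range]
    rfl
  have hdM : finrank ℂ (W s c (pos (m + 2)) M) = F s c (m + 2) := by
    rw [finrank_W h hm le_rfl (subset_refl _), Finset.card_range]
  have h0M : 0 ∈ M := by simp [hM]
  rcases this with h1 | h1
  · have := finrank_finset_inf (S := M) (P := fun i => W s c (pos (m + 2)) (M.erase i))
      (U := W s c (pos (m + 2)) M) (a := F s c (m + 2) - F s c (m + 1))
      (fun i _ => W_mono (Finset.erase_subset _ _))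
      (fun i hi => by rw [hd i hi, hdM]; omega)
    rw [h1, inf_bot_eq, finrank_bot, hdM, hM, Finset.card_range] at this
    simpa using this
  · exfalso
    have h2 : (⊤ : Submodule ℂ V) ≤ W s c (pos (m + 2)) (M.erase 0) := by
      rw [← h1]
      exact Finset.inf_le (f := fun i => W s c (pos (m + 2)) (M.erase i)) h0M
    have h3 := hd 0 h0M
    rw [top_le_iff.1 h2, finrank_top] at h3
    omega

end seq

/-- The numerical heart: the possible increment sequences. -/
theorem numerics (f : ℕ → ℕ) (q : ℕ) (hq : 4 ≤ q) (f0 : f 0 = 0)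
    (hconc : ∀ m, m + 2 ≤ q → f (m + 2) + f m ≤ 2 * f (m + 1))
    (hstrict : ∀ m, m + 1 ≤ q → f m < f (m + 1))
    (heq : ∀ m, m + 2 ≤ q → f (m + 2) + f m = 2 * f (m + 1) →
      f (m + 2) ≤ (m + 2) * (f (m + 2) - f (m + 1)))
    (hsum : f q ≤ 2 * q + 2) :
    (f 1 ≤ 3 ∧ f 2 = 2 * f 1) ∨ (q = 4 ∧ f 1 = 4 ∧ f 2 = 7) := by
  -- increments
  have hdec : ∀ m, m + 2 ≤ q → f (m + 2) - f (m + 1) ≤ f (m + 1) - f m := by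
    intro m hm
    have := hconc m hm
    have := hstrict m (by omega)
    have := hstrict (m + 1) (by omega)
    simp only [add_assoc, Nat.reduceAdd] at *
    omega
  have hmono : ∀ j i, i ≤ j → j + 1 ≤ q → f (j + 1) - f j ≤ f (i + 1) - f i := by
    intro j
    induction j with
    | zero => intro i hi _; rw [Nat.le_zero.1 hi]
    | succ j ih =>
      intro i hi hj
      rcases Nat.lt_or_ge i (j + 1) with h | h
      · exact (hdec j (by omega)).trans (ih i (by omega) (by omega))
      · rw [show i = j + 1 by omega]
  -- lower bound for partial sums from a lower bound of an increment
  have hlow : ∀ m a, m + 1 ≤ q → a ≤ f (m + 1) - f m → ∀ j, j ≤ m + 1 → j * a ≤ f j := by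
    intro m a hm ha j
    induction j with
    | zero => simp
    | succ j ih =>
      intro hj
      have h1 := ih (by omega)
      have h2 := hmono m j (by omega) hm
      have h3 := hstrict j (by omega)
      have : (j + 1) * a = j * a + a := by ring
      omega
  -- upper bound: f j - f i ≤ (j - i) * (increment at i); equality lemma
  have heq' : ∀ m, m + 2 ≤ q → f (m + 2) - f (m + 1) = f (m + 1) - f m →
      f 1 = f (m + 2) - f (m + 1) := by
    intro m hm h
    have h1 := hstrict m (by omega)
    have h2 := hstrict (m + 1) (by omega)
    simp only [add_assoc, Nat.reduceAdd] at h2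
    have h3 := heq m hm (by omega)
    set a := f (m + 2) - f (m + 1) with ha
    have h4 : ∀ j, j + 1 ≤ m + 2 → f 1 + j * a ≤ f (j + 1) := by
      intro j
      induction j with
      | zero => simp
      | succ j ih =>
        intro hj
        have i1 := ih (by omega)
        have i2 := hmono (m + 1) (j + 1) (by omega) (by omega)
        have i3 := hstrict (j + 1) (by omega)
        simp only [add_assoc, Nat.reduceAdd] at i2 i3 ⊢
        have : (j + 1) * a = j * a + a := by ring
        omega
    have h5 := h4 (m + 1) (by omega)
    have h6 := hmono (m + 1) 0 (by omega) (by omega)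
    simp only [add_assoc, Nat.reduceAdd, f0, zero_add] at h5 h6
    have : (m + 2) * a = (m + 1) * a + a := by ring
    omega
  obtain ⟨p, rfl⟩ : ∃ p, q = p + 4 := ⟨q - 4, by omega⟩
  have d1 := hdec (p + 2) (by omega)
  have d2 := hdec (p + 1) (by omega)
  have d3 := hdec p (by omega)
  have e1 := heq' (p + 2) (by omega)
  have e2 := heq' (p + 1) (by omega)
  have e3 := heq' p (by omega)
  have s1 := hstrict (p + 3) (by omega)
  have s2 := hstrict (p + 2) (by omega)
  have s3 := hstrict (p + 1) (by omega)
  have s4 := hstrict p (by omega)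
  have m1 := hmono (p + 3) 1 (by omega) (by omega)
  have m2 := hmono (p + 2) 1 (by omega) (by omega)
  have m3 := hmono (p + 1) 1 (by omega) (by omega)
  have m0 := hmono 1 0 (by omega) (by omega)
  have t2 := hstrict 1 (by omega)
  have t1 := hstrict 0 (by omega)
  simp only [add_assoc, Nat.reduceAdd, zero_add] at *
  by_cases hr : f 1 ≤ 3
  · left; omega
  · right
    have b1 : 2 ≤ f (p + 3) - f (p + 2) := by omega
    have b2 : 3 ≤ f (p + 2) - f (p + 1) := by omega
    have b3 : 4 ≤ f (p + 1) - f p := by omega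
    have b4 := hlow p 4 (by omega) b3 (p + 1) le_rfl
    have hp : p = 0 := by omega
    subst hp
    simp only [zero_add] at d1 d2 d3 e1 e2 e3 s1 s2 s3 s4 m1 m2 m3 b1 b2 b3 b4 hsum
    refine ⟨by omega, by omega, by omega⟩

end BraidRep

namespace BraidRep
open Module

theorem choose_two_le {k s : ℕ} (h2 : 2 ≤ s) (hs : s + 2 ≤ k) : k.choose 2 ≤ k.choose s := by
  have main : ∀ t, 2 ≤ t → t ≤ k / 2 → k.choose 2 ≤ k.choose t := by
    intro t ht
    induction t, ht using Nat.le_induction with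
    | base => simp
    | succ t ht ih =>
      intro h
      exact (ih (by omega)).trans (Nat.choose_le_succ_of_lt_half_left (by omega))
  by_cases h : s ≤ k / 2
  · exact main s h2 h
  · rw [← Nat.choose_symm (show s ≤ k by omega)]
    exact main _ (by omega) (by omega)

theorem card_bound {k : ℕ} (Ω : Finset (Fin k → ℂ))
    (hΩ : ∀ χ ∈ Ω, ∀ π : Equiv.Perm (Fin k), χ ∘ π ∈ Ω)
    (χ : Fin k → ℂ) (hχ : χ ∈ Ω) (B : Finset ℂ) :
    k.choose (Finset.univ.filter fun i => χ i ∈ B).card ≤ Ω.card := by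
  classical
  set T := Finset.univ.filter fun i => χ i ∈ B with hT
  have h1 : (Finset.powersetCard T.card (Finset.univ : Finset (Fin k))).card = k.choose T.card := by
    simp
  rw [← h1]
  have hsub : Finset.powersetCard T.card (Finset.univ : Finset (Fin k)) ⊆
      Ω.image fun ψ => Finset.univ.filter fun i => ψ i ∈ B := by
    intro S hS
    have hc : S.card = T.card := (Finset.mem_powersetCard.1 hS).2
    let e : {x // x ∈ S} ≃ {x // x ∈ T} := Finset.equivOfCardEq hc
    rw [Finset.mem_image]
    refine ⟨χ ∘ e.extendSubtype, hΩ χ hχ _, ?_⟩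
    ext i
    simp only [Finset.mem_filter, Finset.mem_univ, true_and, Function.comp]
    have hiff : ∀ j, χ j ∈ B ↔ j ∈ T := fun j => by simp [hT]
    rw [hiff]
    constructor
    · intro h
      by_contra hi
      exact e.extendSubtype_not_mem i hi h
    · exact fun h => e.extendSubtype_mem i h
  exact (Finset.card_le_card hsub).trans Finset.card_image_le

theorem combin {n k : ℕ} (hn : 10 ≤ n) (hk : k = n / 2) (Ω : Finset (Fin k → ℂ))
    (D : (Fin k → ℂ) → ℕ) (hD : ∀ χ ∈ Ω, 0 < D χ)
    (hΩ : ∀ χ ∈ Ω, ∀ π : Equiv.Perm (Fin k), χ ∘ π ∈ Ω)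
    (hDs : ∀ χ ∈ Ω, ∀ π : Equiv.Perm (Fin k), D (χ ∘ π) = D χ)
    (hsum : ∑ χ ∈ Ω, D χ = n + 1) :
    ∃ χ ∈ Ω, ∃ i c, ∀ j, j ≠ i → χ j = c := by
  classical
  by_contra hcon
  push Not at hcon
  have hcard : Ω.card ≤ n + 1 := by
    rw [← hsum, Finset.card_eq_sum_ones]
    exact Finset.sum_le_sum fun χ hχ => hD χ hχ
  by_cases h6 : 6 ≤ k
  · have hne : Ω.Nonempty := by
      by_contra h
      rw [Finset.not_nonempty_iff_eq_empty] at h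
      simp [h] at hsum
    obtain ⟨χ, hχ⟩ := hne
    have hB : ∃ B : Finset ℂ, 2 ≤ (Finset.univ.filter fun i => χ i ∈ B).card ∧
        (Finset.univ.filter fun i => χ i ∈ B).card + 2 ≤ k := by
      by_cases hinj : Function.Injective χ
      · refine ⟨{χ ⟨0, by omega⟩, χ ⟨1, by omega⟩}, ?_⟩
        have : (Finset.univ.filter fun i => χ i ∈
            ({χ ⟨0, by omega⟩, χ ⟨1, by omega⟩} : Finset ℂ)) = {⟨0, by omega⟩, ⟨1, by omega⟩} := by
          ext i
          simp [hinj.eq_iff]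
        rw [this, Finset.card_pair (by simp)]
        omega
      · simp only [Function.Injective, not_forall] at hinj
        obtain ⟨a, b, hab, hne⟩ := hinj
        refine ⟨{χ a}, ?_, ?_⟩
        · have : ({a, b} : Finset (Fin k)) ⊆ Finset.univ.filter fun i => χ i ∈ ({χ a} : Finset ℂ) := by
            intro i hi
            simp only [Finset.mem_insert, Finset.mem_singleton] at hi
            rcases hi with rfl | rfl <;> simp [hab]
          have := Finset.card_le_card this
          rwa [Finset.card_pair hne] at this
        · by_contra hlt
          have hc := Finset.card_filter_add_card_filter_not (s := (Finset.univ : Finset (Fin k))) (fun i => χ i ∈ ({χ a} : Finset ℂ))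
          rw [Finset.card_univ, Fintype.card_fin] at hc
          have h1 : (Finset.univ.filter fun i => ¬ χ i ∈ ({χ a} : Finset ℂ)).card ≤ 1 := by omega
          rw [Finset.card_le_one] at h1
          obtain ⟨i, hi, hi'⟩ := hcon χ hχ a (χ a)
          obtain ⟨j, hj, hj'⟩ := hcon χ hχ i (χ a)
          exact hj (h1 j (by simpa using hj') i (by simpa using hi'))
    obtain ⟨B, h1, h2⟩ := hB
    have h3 := card_bound Ω hΩ χ hχ B
    have h4 := choose_two_le h1 h2
    have h5 : 2 * k + 3 ≤ k.choose 2 := by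
      rw [Nat.choose_two_right, Nat.le_div_iff_mul_le (by norm_num)]
      obtain ⟨m, rfl⟩ : ∃ m, k = m + 6 := ⟨k - 6, by omega⟩
      rw [show m + 6 - 1 = m + 5 by omega]
      nlinarith
    omega
  · obtain rfl : k = 5 := by omega
    let σ : Equiv.Perm (Fin 5) := finRotate 5
    let α := {p : (Fin 5 → ℂ) × ℕ // p ∈ (Ω.sigma fun χ => Finset.range (D χ)).image
      (fun x : (_ : Fin 5 → ℂ) × ℕ => (x.1, x.2))}
    have hα : Fintype.card α = n + 1 := by
      rw [Fintype.card_coe, Finset.card_image_of_injective, Finset.card_sigma]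
      · simpa using hsum
      · rintro ⟨a, b⟩ ⟨c, d⟩ h
        simpa using h
    have hmem : ∀ p : (Fin 5 → ℂ) × ℕ, p ∈ (Ω.sigma fun χ => Finset.range (D χ)).image
      (fun x : (_ : Fin 5 → ℂ) × ℕ => (x.1, x.2)) ↔ p.1 ∈ Ω ∧ p.2 < D p.1 := by
      rintro ⟨a, b⟩
      simp
    let f : Function.End α := fun p => ⟨(p.1.1 ∘ σ, p.1.2), by
      have := (hmem p.1).1 p.2
      exact (hmem _).2 ⟨hΩ _ this.1 _, by simpa [hDs _ this.1 σ] using this.2⟩⟩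
    have hf : f ^ 5 ^ 1 = 1 := by
      funext p
      apply Subtype.ext
      show (((((p.1.1 ∘ σ) ∘ σ) ∘ σ) ∘ σ) ∘ σ, p.1.2) = p.1
      refine Prod.ext ?_ rfl
      funext i
      show p.1.1 (σ (σ (σ (σ (σ i))))) = p.1.1 i
      have h5 : ∀ i : Fin 5, σ (σ (σ (σ (σ i)))) = i := by decide
      rw [h5]
    have : Fact (Nat.Prime 5) := ⟨by norm_num⟩
    have h := Equiv.Perm.card_fixedPoints_modEq hf
    have h0 : Fintype.card (Function.fixedPoints f) = 0 := by
      rw [Fintype.card_eq_zero_iff]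
      refine ⟨?_⟩
      rintro ⟨p, hp⟩
      have h1 : p.1.1 ∘ σ = p.1.1 := congrArg (fun x : α => x.1.1) hp
      obtain ⟨i, hi, hi'⟩ := hcon p.1.1 ((hmem p.1).1 p.2).1 0 (p.1.1 0)
      have h2 : ∀ j, p.1.1 (σ j) = p.1.1 j := fun j => congrFun h1 j
      have e1 := h2 0
      have e2 := h2 1
      have e3 := h2 2
      have e4 := h2 3
      rw [show σ 0 = 1 by decide] at e1
      rw [show σ 1 = 2 by decide] at e2
      rw [show σ 2 = 3 by decide] at e3
      rw [show σ 3 = 4 by decide] at e4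
      apply hi'
      fin_cases i
      · rfl
      · exact e1
      · exact e2.trans e1
      · exact e3.trans (e2.trans e1)
      · exact e4.trans (e3.trans (e2.trans e1))
    rw [hα, h0] at h
    have := (Nat.modEq_zero_iff_dvd).1 h
    omega

section weights
variable {V : Type*} [AddCommGroup V] [Module ℂ V] [FiniteDimensional ℂ V]

/-- Simultaneous generalized eigenspaces. -/
def G {k : ℕ} (f : Fin k → End ℂ V) (χ : Fin k → ℂ) : Submodule ℂ V :=
  ⨅ i, (f i).maxGenEigenspace (χ i)

theorem mem_G {k : ℕ} {f : Fin k → End ℂ V} {χ : Fin k → ℂ} {v : V} :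
    v ∈ G f χ ↔ ∀ j, ∃ m : ℕ, ((f j - χ j • (1 : End ℂ V)) ^ m) v = 0 :=
  End.mem_iInf_maxGenEigenspace_iff f χ v

/-- A nonzero common generalized eigenspace contains a common eigenvector for any subfamily. -/
theorem common_eigen {k : ℕ} {f : Fin k → End ℂ V} (hf : ∀ i j, Commute (f i) (f j))
    {χ : Fin k → ℂ} (hne : G f χ ≠ ⊥) (S : Finset (Fin k)) :
    ∃ v ∈ G f χ, v ≠ 0 ∧ ∀ i ∈ S, f i v = χ i • v := by
  classical
  have hc : ∀ i j, Commute (f i - χ i • (1 : End ℂ V)) (f j - χ j • (1 : End ℂ V)) := by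
    intro i j
    exact ((hf i j).sub_right (Commute.smul_right (Commute.one_right _) _)).sub_left
      (Commute.smul_left (Commute.one_left _) _)
  induction S using Finset.induction_on with
  | empty =>
    obtain ⟨v, hv, h0⟩ := Submodule.exists_mem_ne_zero_of_ne_bot hne
    exact ⟨v, hv, h0, by simp⟩
  | insert a S ha ih =>
    obtain ⟨v, hv, h0, hS⟩ := ih
    have hex := mem_G.1 hv a
    set m := Nat.find hex with hm
    have h1 : ((f a - χ a • (1 : End ℂ V)) ^ m) v = 0 := Nat.find_spec hex
    have hm0 : m ≠ 0 := by
      intro h; rw [h] at h1; exact h0 (by simpa using h1)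
    obtain ⟨l, hl⟩ : ∃ l, m = l + 1 := ⟨m - 1, by omega⟩
    have h2 : ((f a - χ a • (1 : End ℂ V)) ^ l) v ≠ 0 := Nat.find_min hex (by omega)
    refine ⟨((f a - χ a • (1 : End ℂ V)) ^ l) v, ?_, h2, ?_⟩
    · rw [mem_G]
      intro j
      obtain ⟨p, hp⟩ := mem_G.1 hv j
      refine ⟨p, ?_⟩
      rw [← Module.End.mul_apply, ((hc j a).pow_pow p l).eq, Module.End.mul_apply, hp, map_zero]
    · intro i hi
      have key : (f i - χ i • (1 : End ℂ V)) (((f a - χ a • (1 : End ℂ V)) ^ l) v) = 0 := by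
        rcases Finset.mem_insert.1 hi with rfl | hi
        · rw [← Module.End.mul_apply, ← pow_succ', ← hl, h1]
        · rw [← Module.End.mul_apply, ((hc i a).pow_right l).eq, Module.End.mul_apply]
          have : (f i - χ i • (1 : End ℂ V)) v = 0 := by simp [hS i hi]
          rw [this, map_zero]
      have := key
      simp only [LinearMap.sub_apply, LinearMap.smul_apply, Module.End.one_apply] at this
      exact sub_eq_zero.1 this

theorem G_conj {k : ℕ} {f : Fin k → End ℂ V} {χ : Fin k → ℂ} (π : Equiv.Perm (Fin k))
    (g : V ≃ₗ[ℂ] V) (hg : ∀ i v, g (f i v) = f (π i) (g v)) :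
    (G f (χ ∘ π)).map (g : V →ₗ[ℂ] V) ≤ G f χ := by
  rw [Submodule.map_le_iff_le_comap]
  intro v hv
  rw [Submodule.mem_comap, mem_G]
  intro j
  obtain ⟨i, rfl⟩ := π.surjective j
  obtain ⟨m, hm⟩ := mem_G.1 hv i
  refine ⟨m, ?_⟩
  have : ∀ m v, ((f (π i) - χ (π i) • (1 : End ℂ V)) ^ m) (g v) =
      g (((f i - χ (π i) • (1 : End ℂ V)) ^ m) v) := by
    intro m
    induction m with
    | zero => simp
    | succ m ih =>
      intro v
      rw [pow_succ, Module.End.mul_apply, pow_succ, Module.End.mul_apply, ← ih]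
      congr 1
      simp [hg]
  have h2 := this m v
  rw [show ((f i - χ (π i) • (1 : End ℂ V)) ^ m) v = 0 from hm, map_zero] at h2
  exact h2

theorem weights {n : ℕ} (hn : 10 ≤ n) {s : ℕ → V ≃ₗ[ℂ] V} (h : Br n s)
    (hV : finrank ℂ V = n + 1) :
    ∃ (c : ℂ) (v : V), v ≠ 0 ∧ ∀ i, i + 1 < n / 2 → s (2 * i + 1) v = c • v := by
  classical
  set k := n / 2 with hk
  let f : Fin k → End ℂ V := fun i => (s (2 * i.1 + 1) : V →ₗ[ℂ] V)
  have hf : ∀ i j, Commute (f i) (f j) := by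
    intro i j
    have hc : Commute (s (2 * i.1 + 1)) (s (2 * j.1 + 1)) :=
      h.comm' (by omega) (by omega) (by omega) (by omega) (by omega)
    ext v
    exact congrArg (fun e : V ≃ₗ[ℂ] V => e v) hc.eq
  have hmaps : ∀ i j φ, Set.MapsTo (f i) ((f j).maxGenEigenspace φ) ((f j).maxGenEigenspace φ) :=
    fun i j φ => End.mapsTo_maxGenEigenspace_of_comm (hf j i) φ
  have hind : iSupIndep (G f) := End.independent_iInf_maxGenEigenspace_of_forall_mapsTo f hmaps
  have htop : ⨆ χ, G f χ = ⊤ := End.iSup_iInf_maxGenEigenspace_eq_top_of_forall_mapsTo f hmaps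
    (fun i => End.iSup_maxGenEigenspace_eq_top (f i))
  have hfin : {χ | G f χ ≠ ⊥}.Finite := WellFoundedGT.finite_ne_bot_of_iSupIndep hind
  let Ω := hfin.toFinset
  have hΩ : ∀ χ, χ ∈ Ω ↔ G f χ ≠ ⊥ := fun χ => by simp [Ω]
  have hDle : ∀ χ (π : Equiv.Perm (Fin k)), finrank ℂ (G f (χ ∘ π)) ≤ finrank ℂ (G f χ) := by
    intro χ π
    obtain ⟨g, hg⟩ := h.sym (k := k) (by omega) π
    rw [← LinearEquiv.finrank_map_eq g]
    exact Submodule.finrank_mono (G_conj π g fun i v => conj_s (hg i) v)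
  have hDeq : ∀ χ (π : Equiv.Perm (Fin k)), finrank ℂ (G f (χ ∘ π)) = finrank ℂ (G f χ) := by
    intro χ π
    apply le_antisymm (hDle χ π)
    have := hDle (χ ∘ π) π.symm
    rwa [Function.comp_assoc, Equiv.self_comp_symm, Function.comp_id] at this
  have hpos : ∀ χ, χ ∈ Ω ↔ 0 < finrank ℂ (G f χ) := by
    intro χ
    rw [hΩ, pos_iff_ne_zero, ne_eq, ne_eq, Submodule.finrank_eq_zero]
  have hsum : ∑ χ ∈ Ω, finrank ℂ (G f χ) = n + 1 := by
    rw [← hV]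
    have hind' : iSupIndep fun χ : {χ // χ ∈ Ω} => G f χ.1 := hind.comp Subtype.val_injective
    have htop' : ⨆ χ : {χ // χ ∈ Ω}, G f χ.1 = ⊤ := by
      rw [eq_top_iff, ← htop]
      refine iSup_le fun χ => ?_
      by_cases hχ : G f χ = ⊥
      · rw [hχ]; exact bot_le
      · exact le_iSup (fun χ : {χ // χ ∈ Ω} => G f χ.1) ⟨χ, (hΩ χ).2 hχ⟩
    have hinternal := DirectSum.isInternal_submodule_of_iSupIndep_of_iSup_eq_top hind' htop'
    have e := LinearEquiv.finrank_eq (LinearEquiv.ofBijective (DirectSum.coeLinearMap _) hinternal)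
    rw [← e, finrank_directSum, ← Finset.sum_coe_sort]
  obtain ⟨χ, hχ, i, c, hc⟩ := combin hn hk Ω (fun χ => finrank ℂ (G f χ))
    (fun χ hχ => (hpos χ).1 hχ)
    (fun χ hχ π => (hpos _).2 (by rw [hDeq]; exact (hpos χ).1 hχ))
    (fun χ _ π => hDeq χ π) hsum
  let π : Equiv.Perm (Fin k) := Equiv.swap i ⟨k - 1, by omega⟩
  have hχ' : G f (χ ∘ π) ≠ ⊥ := (hΩ _).1 ((hpos _).2 (by rw [hDeq]; exact (hpos χ).1 hχ))
  obtain ⟨v, _, hv0, hv⟩ := common_eigen hf hχ' Finset.univ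
  refine ⟨c, v, hv0, fun j hj => ?_⟩
  have h1 := hv ⟨j, by omega⟩ (Finset.mem_univ _)
  rw [Function.comp, hc] at h1
  · exact h1
  · intro h2
    have : π i = ⟨k - 1, by omega⟩ := Equiv.swap_apply_left _ _
    rw [← h2] at this
    rw [Equiv.swap_apply_self] at this
    simp [Fin.ext_iff] at this
    omega

end weights
end BraidRep

namespace BraidRep
open Module
set_option linter.unusedSectionVars false

section setup
variable {V : Type*} [AddCommGroup V] [Module ℂ V] [FiniteDimensional ℂ V]
variable {n : ℕ} {s : ℕ → V ≃ₗ[ℂ] V} {c : ℂ}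

theorem exists_c (hn : 10 ≤ n) (h : Br n s) (hV : finrank ℂ V = n + 1) :
    ∃ c : ℂ, c ≠ 0 ∧ F s c (n / 2 - 1) < n + 1 := by
  have hd : Br n (fun i => (s i).dualMap) := by
    constructor
    · intro i j hi hij hj
      have e := h.comm i j hi hij hj
      ext φ v
      have := congrArg (fun e : V ≃ₗ[ℂ] V => φ (e v)) e
      simpa using this.symm
    · intro i hi hin
      have e := h.braid i hi hin
      ext φ v
      have := congrArg (fun e : V ≃ₗ[ℂ] V => φ (e v)) e
      simpa using this
  obtain ⟨c, φ, h0, hφ⟩ := weights hn hd (by rw [Subspace.dual_finrank_eq, hV])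
  have hφ' : ∀ i, i + 1 < n / 2 → ∀ v, φ (s (2 * i + 1) v) = c * φ v := by
    intro i hi v
    have := congrArg (fun ψ : Dual ℂ V => ψ v) (hφ i hi)
    simpa using this
  refine ⟨c, ?_, ?_⟩
  · rintro rfl
    apply h0
    ext v
    have := hφ' 0 (by omega) ((s (2 * 0 + 1)).symm v)
    simpa using this
  · rw [← hV, F]
    apply Submodule.finrank_lt
    have hle : W s c (fun t => 2 * t + 1) (Finset.range (n / 2 - 1)) ≤ LinearMap.ker φ := by
      refine Finset.sup_le fun i hi => ?_
      rintro _ ⟨v, rfl⟩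
      have hi' := Finset.mem_range.1 hi
      rw [LinearMap.mem_ker, A_apply, map_sub, hφ' i (by omega)]
      simp
    intro htop
    apply h0
    rw [htop, top_le_iff, LinearMap.ker_eq_top] at hle
    exact hle

theorem F_one : F s c 1 = finrank ℂ (I s c 1) := by
  have : W s c (fun t => 2 * t + 1) (Finset.range 1) = I s c 1 := by
    simp [W]
  rw [F, this]

/-- Irreducible representations of dimension at least two have no scalar generators. -/
theorem F_one_ne (h : Br n s) (irr : Irr n s) (hn : 10 ≤ n) (hV : finrank ℂ V = n + 1) :
    F s c 1 ≠ 0 := by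
  intro h0
  rw [F_one, Submodule.finrank_eq_zero] at h0
  have hA : ∀ i, 1 ≤ i → i < n → ∀ v, s i v = c • v := by
    intro i hi hin v
    obtain ⟨g, hg, _⟩ := h.slide (le_refl 1) hi hin
    have h1 := conj_I (c := c) hg
    rw [h0, Submodule.map_bot] at h1
    have h2 := A_mem (s := s) (c := c) i v
    rw [← h1, Submodule.mem_bot, A_apply] at h2
    exact sub_eq_zero.1 h2
  have : Nontrivial V := Module.nontrivial_of_finrank_pos (R := ℂ) (by omega)
  obtain ⟨v, hv⟩ := exists_ne (0 : V)
  rcases irr (Submodule.span ℂ {v}) (fun i hi hin w hw => by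
    rw [hA i hi hin]; exact Submodule.smul_mem _ _ hw) with h1 | h1
  · exact hv (Submodule.span_singleton_eq_bot.1 h1)
  · have := finrank_span_singleton (K := ℂ) hv
    rw [h1, finrank_top] at this
    omega

theorem cases_c (hn : 10 ≤ n) (h : Br n s) (irr : Irr n s) (hV : finrank ℂ V = n + 1) :
    ∃ c : ℂ, c ≠ 0 ∧ F s c 1 ≠ 0 ∧
      ((F s c 1 ≤ 3 ∧ F s c 2 = 2 * F s c 1) ∨ (n = 10 ∧ F s c 1 = 4 ∧ F s c 2 = 7)) := by
  obtain ⟨c, hc, hF⟩ := exists_c hn h hV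
  have h0 : F s c 1 ≠ 0 := F_one_ne h irr hn hV
  refine ⟨c, hc, h0, ?_⟩
  have hlt : ∀ m, m + 1 ≤ (n - 1) / 2 → F s c m < finrank ℂ V := by
    intro m hm
    rw [hV]
    exact (F_mono (by omega)).trans_lt hF
  have := numerics (F s c) ((n - 1) / 2) (by omega) F_zero
    (fun m hm => F_concave h (q := (n - 1) / 2) (by omega) hm)
    (fun m hm => F_strict h irr (by omega) (hlt m hm) h0)
    (fun m hm e => F_equal h irr (by omega) (hlt (m + 1) hm) e)
    (by
      have h1 : F s c ((n - 1) / 2) ≤ n + 1 := by rw [← hV]; exact Submodule.finrank_le _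
      rcases Nat.even_or_odd' n with ⟨a, rfl | rfl⟩
      · rw [show (2 * a - 1) / 2 = 2 * a / 2 - 1 by omega]
        omega
      · omega)
  rcases this with h1 | ⟨h1, h2, h3⟩
  · exact Or.inl h1
  · right
    refine ⟨?_, h2, h3⟩
    by_contra hne
    have : n ≥ 11 := by omega
    omega

theorem finrank_I (h : Br n s) {i : ℕ} (hi : 1 ≤ i) (hin : i < n) :
    finrank ℂ (I s c i) = F s c 1 := by
  obtain ⟨g, hg, _⟩ := h.slide (le_refl 1) hi hin
  rw [F_one, ← conj_I (c := c) hg]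
  exact LinearEquiv.finrank_map_eq g _

/-- Non-adjacent pairs are conjugate, by an element commuting with everything to the right. -/
theorem Br.pair {G : Type*} [Group G] {s : ℕ → G} (h : Br n s) {i j : ℕ} (hi : 1 ≤ i)
    (hij : i + 2 ≤ j) (hj : j < n) :
    ∃ g : G, g * s 1 = s i * g ∧ g * s 3 = s j * g ∧
      ∀ l, l < n → j + 2 ≤ l → g * s l = s l * g := by
  obtain ⟨g1, a1, b1⟩ := h.slide (a := 3) (b := j) (by omega) (by omega) hj
  obtain ⟨g2, a2, b2⟩ := h.slide (a := 1) (b := i) (by omega) (by omega) (by omega)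
  refine ⟨g2 * g1, ?_, ?_, fun l hl hjl => ?_⟩
  · rw [mul_assoc, b1 1 le_rfl (by omega) (by omega), ← mul_assoc, a2, mul_assoc]
  · rw [mul_assoc, a1, ← mul_assoc, b2 j (by omega) hj (by omega), mul_assoc]
  · rw [mul_assoc, b1 l (by omega) hl (by omega), ← mul_assoc, b2 l (by omega) hl (by omega),
      mul_assoc]

theorem conj_inf {g : V ≃ₗ[ℂ] V} {i j i' j' : ℕ} (h : g * s i = s i' * g)
    (h' : g * s j = s j' * g) :
    (I s c i ⊓ I s c j).map (g : V →ₗ[ℂ] V) = I s c i' ⊓ I s c j' := by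
  rw [Submodule.map_inf _ g.injective, conj_I h, conj_I h']

theorem finrank_conj_inf {g : V ≃ₗ[ℂ] V} {i j i' j' : ℕ} (h : g * s i = s i' * g)
    (h' : g * s j = s j' * g) :
    finrank ℂ ↥(I s c i ⊓ I s c j) = finrank ℂ ↥(I s c i' ⊓ I s c j') := by
  rw [← conj_inf h h']
  exact (LinearEquiv.finrank_map_eq g _).symm

theorem finrank_pair (h : Br n s) {i j : ℕ} (hi : 1 ≤ i)
    (hij : i + 2 ≤ j) (hj : j < n) :
    finrank ℂ ↥(I s c i ⊓ I s c j) + F s c 2 = 2 * F s c 1 := by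
  obtain ⟨g, h1, h2, _⟩ := h.pair hi hij hj
  rw [← finrank_conj_inf h1 h2]
  have e := Submodule.finrank_sup_add_finrank_inf_eq (I s c 1) (I s c 3)
  rw [finrank_I h le_rfl (by omega), finrank_I h (by omega) (by omega)] at e
  have : W s c (fun t => 2 * t + 1) (Finset.range 2) = I s c 1 ⊔ I s c 3 := by
    simp [W, Finset.range_add_one, sup_comm]
  rw [F, this]
  omega

/-- The braid relation in terms of `A`. -/
theorem braid_A (h : Br n s) {i : ℕ} (hi : 1 ≤ i) (hin : i + 1 < n) (v : V) :
    A s c i (A s c (i + 1) (A s c i v)) + c • A s c i (A s c i v) + c ^ 2 • A s c i v =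
    A s c (i + 1) (A s c i (A s c (i + 1) v)) + c • A s c (i + 1) (A s c (i + 1) v) +
      c ^ 2 • A s c (i + 1) v := by
  have e := congrArg (fun e : V ≃ₗ[ℂ] V => e v) (h.braid i hi hin)
  simp only [LinearEquiv.mul_apply] at e
  simp only [A_apply, map_sub, map_smul]
  rw [e]
  module

theorem comm_A (h : Br n s) {i j : ℕ} (hi : 1 ≤ i) (hj : 1 ≤ j) (hin : i < n) (hjn : j < n)
    (hij : i + 2 ≤ j ∨ j + 2 ≤ i ∨ i = j) (v : V) :
    A s c i (A s c j v) = A s c j (A s c i v) := by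
  have e := congrArg (fun e : V ≃ₗ[ℂ] V => e v) (h.comm' hi hj hin hjn hij).eq
  simp only [LinearEquiv.mul_apply] at e
  simp only [A_apply, map_sub, map_smul]
  rw [e]
  module

/-- `A j` maps `I i` into `I i ⊓ I j` when `i` and `j` are not adjacent. -/
theorem A_mem_inf (h : Br n s) {i j : ℕ} (hi : 1 ≤ i) (hj : 1 ≤ j) (hin : i < n) (hjn : j < n)
    (hij : i + 2 ≤ j ∨ j + 2 ≤ i ∨ i = j) {v : V} (hv : v ∈ I s c i) :
    A s c j v ∈ I s c i ⊓ I s c j :=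
  ⟨(stab_I (h.comm' hj hi hjn hin (by omega))).A hv, A_mem _ _⟩

end setup
end BraidRep

namespace BraidRep
open Module
set_option linter.unusedSectionVars false

section case1
variable {V : Type*} [AddCommGroup V] [Module ℂ V] [FiniteDimensional ℂ V]
variable {n : ℕ} {s : ℕ → V ≃ₗ[ℂ] V} {c : ℂ}

theorem Br.adj {G : Type*} [Group G] {s : ℕ → G} (h : Br n s) {i : ℕ} (hi : 1 ≤ i)
    (hin : i + 1 < n) : ∃ g : G, g * s 1 = s i * g ∧ g * s 2 = s (i + 1) * g := by
  induction i, hi using Nat.le_induction with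
  | base => exact ⟨1, by simp, by simp⟩
  | succ i hi ih =>
    obtain ⟨g, h1, h2⟩ := ih (by omega)
    obtain ⟨g', h3, h4, _⟩ := h.shift hi (by omega)
    exact ⟨g' * g, by rw [mul_assoc, h1, ← mul_assoc, h3, mul_assoc],
      by rw [mul_assoc, h2, ← mul_assoc, h4, mul_assoc]⟩

theorem kill (h : Br n s)
    (hdis : ∀ i j, 1 ≤ i → i + 2 ≤ j → j < n → I s c i ⊓ I s c j = ⊥)
    {i j : ℕ} (hi : 1 ≤ i) (hj : 1 ≤ j) (hin : i < n) (hjn : j < n)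
    (hij : i + 2 ≤ j ∨ j + 2 ≤ i) {v : V} (hv : v ∈ I s c i) : A s c j v = 0 := by
  have h1 := A_mem_inf h hi hj hin hjn (by omega) hv
  rcases hij with h2 | h2
  · rwa [hdis i j hi h2 hjn] at h1
  · rwa [inf_comm, hdis j i hj h2 hin] at h1

theorem case1_zero (hn : 10 ≤ n) (h : Br n s) (irr : Irr n s) (hV : finrank ℂ V = n + 1)
    (hc : c ≠ 0) (h0 : F s c 1 ≠ 0)
    (hdis : ∀ i j, 1 ≤ i → i + 2 ≤ j → j < n → I s c i ⊓ I s c j = ⊥)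
    (hadj : ∀ i, 1 ≤ i → i + 1 < n → I s c i ⊓ I s c (i + 1) = ⊥) : False := by
  classical
  have hz : ∀ i, 1 ≤ i → i + 1 < n → ∀ v,
      A s c i (A s c (i + 1) (A s c i v)) + c • A s c i (A s c i v) + c ^ 2 • A s c i v = 0 := by
    intro i hi hin v
    have : A s c i (A s c (i + 1) (A s c i v)) + c • A s c i (A s c i v) + c ^ 2 • A s c i v ∈
        I s c i ⊓ I s c (i + 1) := by
      constructor
      · exact add_mem (add_mem (A_mem _ _) (Submodule.smul_mem _ _ (A_mem _ _)))
          (Submodule.smul_mem _ _ (A_mem _ _))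
      · rw [braid_A h hi hin]
        exact add_mem (add_mem (A_mem _ _) (Submodule.smul_mem _ _ (A_mem _ _)))
          (Submodule.smul_mem _ _ (A_mem _ _))
    rwa [hadj i hi hin] at this
  have hz' : ∀ i, 1 ≤ i → i + 1 < n → ∀ v,
      A s c (i + 1) (A s c i (A s c (i + 1) v)) + c • A s c (i + 1) (A s c (i + 1) v) +
      c ^ 2 • A s c (i + 1) v = 0 := by
    intro i hi hin v
    rw [← braid_A h hi hin, hz i hi hin]
  -- an eigenvector in `I 1`
  obtain ⟨w, hw0, hwI, β, hwβ⟩ : ∃ w : V, w ≠ 0 ∧ w ∈ I s c 1 ∧ ∃ β : ℂ, A s c 1 w = β • w := by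
    have hmap : ∀ v ∈ I s c 1, A s c 1 v ∈ I s c 1 := fun v _ => A_mem _ _
    have : Nontrivial (I s c 1) := Module.nontrivial_of_finrank_pos (R := ℂ) (by
      rw [← F_one]; omega)
    obtain ⟨β, hβ⟩ := Module.End.exists_eigenvalue ((A s c 1).restrict hmap)
    obtain ⟨w, hw⟩ := hβ.exists_hasEigenvector
    refine ⟨w.1, ?_, w.2, β, ?_⟩
    · exact fun e => hw.2 (Subtype.ext e)
    · exact congrArg Subtype.val hw.apply_eq_smul
  let u : ℕ → V := fun k => Nat.rec w (fun k x => A s c (k + 2) x) k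
  have u0 : u 0 = w := rfl
  have us : ∀ k, u (k + 1) = A s c (k + 2) (u k) := fun k => rfl
  have uI : ∀ k, u k ∈ I s c (k + 1) := by
    intro k
    cases k with
    | zero => exact hwI
    | succ k => exact A_mem _ _
  have down : ∀ k, k + 2 < n → A s c (k + 1) (u k) = β • u k →
      A s c (k + 1) (u (k + 1)) = (-(c * (c + β))) • u k := by
    intro k hk hβ
    obtain ⟨x, hx⟩ := uI k
    have e := hz (k + 1) (by omega) (by omega) x
    rw [hx, hβ] at e
    rw [us]
    have : A s c (k + 1) (A s c (k + 2) (u k)) = -(c • β • u k + c ^ 2 • u k) := by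
      rw [← sub_eq_zero, sub_neg_eq_add, ← add_assoc]; exact e
    rw [this]
    module
  have diag : ∀ k, k + 1 < n → A s c (k + 1) (u k) = β • u k := by
    intro k
    induction k with
    | zero => intro _; exact hwβ
    | succ k ih =>
      intro hk
      have h1 := ih (by omega)
      have h2 := down k (by omega) h1
      have e := hz' (k + 1) (by omega) (by omega) (u k)
      simp only [add_assoc, Nat.reduceAdd] at e ⊢
      rw [← us, h2, map_smul, ← us] at e
      have e2 : c • (A s c (k + 2) (u (k + 1)) - β • u (k + 1)) = 0 := by
        rw [← e]; module
      rcases smul_eq_zero.1 e2 with h3 | h3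
      · exact absurd h3 hc
      · exact sub_eq_zero.1 h3
  let B := (Finset.range (n - 1)).image u
  have hB : ∀ k, k + 1 < n → u k ∈ Submodule.span ℂ (B : Set V) := by
    intro k hk
    apply Submodule.subset_span
    simp only [B, Finset.coe_image, Set.mem_image, Finset.mem_coe, Finset.mem_range]
    exact ⟨k, by omega, rfl⟩
  have hdim : finrank ℂ (Submodule.span ℂ (B : Set V)) ≤ n - 1 :=
    (finrank_span_finset_le_card B).trans (Finset.card_image_le.trans (by simp))
  rcases irr (Submodule.span ℂ (B : Set V)) (by
    intro i hi hin v hv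
    have : Submodule.span ℂ (B : Set V) ≤
        (Submodule.span ℂ (B : Set V)).comap (s i : V →ₗ[ℂ] V) := by
      rw [Submodule.span_le]
      intro x hx
      simp only [B, Finset.coe_image, Set.mem_image, Finset.mem_coe, Finset.mem_range] at hx
      obtain ⟨k, hk, rfl⟩ := hx
      simp only [Submodule.comap_coe, Set.mem_preimage, SetLike.mem_coe, LinearEquiv.coe_coe]
      rw [s_apply (c := c)]
      refine add_mem ?_ (Submodule.smul_mem _ _ (hB k (by omega)))
      by_cases e1 : i = k + 1
      · rw [e1, diag k (by omega)]; exact Submodule.smul_mem _ _ (hB k (by omega))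
      by_cases e2 : i = k + 2
      · rw [e2, ← us]; exact hB (k + 1) (by omega)
      by_cases e3 : i = k
      · subst e3
        obtain ⟨l, rfl⟩ : ∃ l, i = l + 1 := ⟨i - 1, by omega⟩
        rw [down l (by omega) (diag l (by omega))]
        exact Submodule.smul_mem _ _ (hB l (by omega))
      rw [kill h hdis (i := k + 1) (by omega) hi (by omega) hin (by omega) (uI k)]
      exact zero_mem _
    exact this hv) with h1 | h1
  · have := hB 0 (by omega)
    rw [h1] at this
    exact hw0 this
  · rw [h1, finrank_top] at hdim
    omega

theorem finrank_finset_sup_le {S : Finset ℕ} {P : ℕ → Submodule ℂ V}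
    (h1 : ∀ i ∈ S, finrank ℂ (P i) ≤ 1) : finrank ℂ ↥(S.sup P) ≤ S.card := by
  classical
  induction S using Finset.induction_on with
  | empty => rw [Finset.sup_empty, finrank_bot]; simp
  | insert x S hx ih =>
    rw [Finset.sup_insert, Finset.card_insert_of_notMem hx]
    have := Submodule.finrank_add_le_finrank_add_finrank (P x) (S.sup P)
    have := ih fun i hi => h1 i (by simp [hi])
    have := h1 x (by simp)
    omega

theorem case1_one (hn : 10 ≤ n) (h : Br n s) (irr : Irr n s) (hV : finrank ℂ V = n + 1)
    (hc : c ≠ 0)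
    (hdis : ∀ i j, 1 ≤ i → i + 2 ≤ j → j < n → I s c i ⊓ I s c j = ⊥)
    (hadj : ∀ i, 1 ≤ i → i + 1 < n → finrank ℂ ↥(I s c i ⊓ I s c (i + 1)) = 1) : False := by
  classical
  have kA : ∀ {i j : ℕ}, 1 ≤ i → 1 ≤ j → i < n → j < n → (i + 2 ≤ j ∨ j + 2 ≤ i) →
      ∀ {v : V}, v ∈ I s c i → s j v = c • v := by
    intro i j hi hj hin hjn hij v hv
    rw [s_apply (c := c), kill h hdis hi hj hin hjn hij hv, zero_add]
  set L : ℕ → Submodule ℂ V := fun i => I s c i ⊓ I s c (i + 1) with hL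
  have up : ∀ i, 1 ≤ i → i + 2 < n → ∀ y ∈ L i, s (i + 1) y ∈ L (i + 1) := by
    intro i hi hin y hy
    have e1 : s (i + 2) y = c • y := kA hi (by omega) (by omega) hin (by omega) hy.1
    refine ⟨stab_I (Commute.refl _) y hy.2, ?_⟩
    have e2 : (s (i + 1) * s (i + 2)) y ∈ I s c (i + 2) :=
      (conj_mem (by rw [h.braid (i + 1) (by omega) (by omega), mul_assoc])).2 hy.2
    rw [LinearEquiv.mul_apply, e1, map_smul] at e2
    exact (Submodule.smul_mem_iff _ hc).1 e2
  have down : ∀ i, 1 ≤ i → i + 2 < n → ∀ y ∈ L (i + 1), s (i + 1) y ∈ L i := by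
    intro i hi hin y hy
    have e1 : s i y = c • y := kA (i := i + 2) (by omega) hi (by omega) (by omega) (by omega) hy.2
    refine ⟨?_, stab_I (Commute.refl _) y hy.1⟩
    have e2 : (s (i + 1) * s i) y ∈ I s c i :=
      (conj_mem (by rw [← h.braid i (by omega) (by omega), mul_assoc])).2 hy.1
    rw [LinearEquiv.mul_apply, e1, map_smul] at e2
    exact (Submodule.smul_mem_iff _ hc).1 e2
  have kL : ∀ i j, 1 ≤ i → i + 1 < n → 1 ≤ j → j < n → j ≠ i → j ≠ i + 1 → ∀ y ∈ L i,
      s j y = c • y := by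
    intro i j hi hin hj hjn h1 h2 y hy
    by_cases h3 : j < i
    · exact kA (i := i + 1) (by omega) hj hin hjn (by omega) hy.2
    · exact kA (i := i) hi hj (by omega) hjn (by omega) hy.1
  obtain ⟨N, rfl⟩ : ∃ N, n = N + 3 := ⟨n - 3, by omega⟩
  -- left end
  have left1 : ∀ y ∈ L 1, s 1 (s 1 y) ∈ L 1 := by
    intro y hy
    obtain ⟨g, g1, g2, _⟩ := h.shift (i := 1) le_rfl (by omega)
    have hm : ∀ z, g z ∈ L 2 ↔ z ∈ L 1 := fun z =>
      and_congr (conj_mem g1) (conj_mem g2)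
    rw [← hm, conj_s g1, conj_s g1]
    exact up 1 le_rfl (by omega) _ (down 1 le_rfl (by omega) _ ((hm y).2 hy))
  have left2 : ∀ y ∈ L 1, s 2 (s 1 y) = c • s 1 y := by
    intro y hy
    obtain ⟨g, g1, g2, _⟩ := h.shift (i := 1) le_rfl (by omega)
    have hm : ∀ z, g z ∈ L 2 ↔ z ∈ L 1 := fun z =>
      and_congr (conj_mem g1) (conj_mem g2)
    apply g.injective
    rw [conj_s g2, map_smul, conj_s g1]
    exact kL 1 3 (by omega) (by omega) (by omega) (by omega) (by omega) (by omega) _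
      (down 1 le_rfl (by omega) _ ((hm y).2 hy))
  -- right end
  have right1 : ∀ y ∈ L (N + 1), s (N + 2) (s (N + 2) y) ∈ L (N + 1) := by
    intro y hy
    obtain ⟨g, g1, g2, _⟩ := h.shift (i := N) (by omega) (by omega)
    have hm : ∀ z, g z ∈ L (N + 1) ↔ z ∈ L N := fun z =>
      and_congr (conj_mem g1) (conj_mem g2)
    obtain ⟨x, rfl⟩ := g.surjective y
    rw [← conj_s g2, ← conj_s g2, hm]
    exact down N (by omega) (by omega) _ (up N (by omega) (by omega) _ ((hm x).1 hy))
  have right2 : ∀ y ∈ L (N + 1), s (N + 1) (s (N + 2) y) = c • s (N + 2) y := by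
    intro y hy
    obtain ⟨g, g1, g2, _⟩ := h.shift (i := N) (by omega) (by omega)
    have hm : ∀ z, g z ∈ L (N + 1) ↔ z ∈ L N := fun z =>
      and_congr (conj_mem g1) (conj_mem g2)
    obtain ⟨x, rfl⟩ := g.surjective y
    rw [← conj_s g2, ← conj_s g1, ← map_smul]
    congr 1
    exact kL (N + 1) N (by omega) (by omega) (by omega) (by omega) (by omega) (by omega) _
      (up N (by omega) (by omega) _ ((hm x).1 hy))
  set P : ℕ → Submodule ℂ V := fun i => if i = 0 then (L 1).map (s 1 : V →ₗ[ℂ] V) else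
    if i = N + 2 then (L (N + 1)).map (s (N + 2) : V →ₗ[ℂ] V) else L i with hP
  have hP0 : P 0 = (L 1).map (s 1 : V →ₗ[ℂ] V) := by simp [hP]
  have hPN : P (N + 2) = (L (N + 1)).map (s (N + 2) : V →ₗ[ℂ] V) := by simp [hP]
  have hPi : ∀ i, 1 ≤ i → i ≤ N + 1 → P i = L i := by
    intro i hi hi'
    simp only [hP]
    rw [if_neg (by omega), if_neg (by omega)]
  have hdim : finrank ℂ ↥((Finset.range (N + 3)).sup P) ≤ N + 3 := by
    refine (finrank_finset_sup_le ?_).trans (by simp)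
    intro i hi
    have hi' := Finset.mem_range.1 hi
    by_cases e1 : i = 0
    · rw [e1, hP0]
      exact ((LinearEquiv.finrank_map_eq (s 1) (L 1)).trans (hadj 1 le_rfl (by omega))).le
    by_cases e2 : i = N + 2
    · rw [e2, hPN]
      exact ((LinearEquiv.finrank_map_eq (s (N + 2)) (L (N + 1))).trans
        (hadj (N + 1) (by omega) (by omega))).le
    rw [hPi i (by omega) (by omega)]
    exact (hadj i (by omega) (by omega)).le
  have hle : ∀ i, i < N + 3 → P i ≤ (Finset.range (N + 3)).sup P := fun i hi =>
    Finset.le_sup (f := P) (Finset.mem_range.2 hi)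
  have hLle : ∀ i, 1 ≤ i → i ≤ N + 1 → L i ≤ (Finset.range (N + 3)).sup P := fun i hi hi' => by
    rw [← hPi i hi hi']; exact hle i (by omega)
  have hstab : ∀ j, 1 ≤ j → j < N + 3 → ∀ i, i < N + 3 → ∀ v ∈ P i,
      s j v ∈ (Finset.range (N + 3)).sup P := by
    intro j hj hjn i hi v hv
    by_cases e1 : i = 0
    · subst e1
      have hv' := hv
      rw [hP0] at hv
      obtain ⟨y, hy, rfl⟩ := hv
      simp only [LinearEquiv.coe_coe] at *
      by_cases j1 : j = 1
      · subst j1; exact hLle 1 le_rfl (by omega) (left1 y hy)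
      by_cases j2 : j = 2
      · subst j2; rw [left2 y hy]; exact Submodule.smul_mem _ _ (hle 0 hi hv')
      have hcm := congrArg (fun e : V ≃ₗ[ℂ] V => e y) (h.comm 1 j le_rfl (by omega) hjn)
      simp only [LinearEquiv.mul_apply] at hcm
      rw [← hcm, kL 1 j le_rfl (by omega) hj hjn (by omega) (by omega) y hy, map_smul]
      exact Submodule.smul_mem _ _ (hle 0 hi hv')
    by_cases e2 : i = N + 2
    · subst e2
      have hv' := hv
      rw [hPN] at hv
      obtain ⟨y, hy, rfl⟩ := hv
      simp only [LinearEquiv.coe_coe] at *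
      by_cases j1 : j = N + 2
      · subst j1; exact hLle (N + 1) (by omega) (by omega) (right1 y hy)
      by_cases j2 : j = N + 1
      · subst j2; rw [right2 y hy]; exact Submodule.smul_mem _ _ (hle _ hi hv')
      have hcm := congrArg (fun e : V ≃ₗ[ℂ] V => e y) (h.comm j (N + 2) hj (by omega) (by omega))
      simp only [LinearEquiv.mul_apply] at hcm
      rw [hcm, kL (N + 1) j (by omega) (by omega) hj hjn (by omega) (by omega) y hy, map_smul]
      exact Submodule.smul_mem _ _ (hle _ hi hv')
    rw [hPi i (by omega) (by omega)] at hv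
    by_cases j1 : j = i
    · subst j1
      by_cases i1 : j = 1
      · subst i1
        apply hle 0 (by omega)
        rw [hP0]; exact ⟨v, hv, rfl⟩
      · obtain ⟨l, rfl⟩ : ∃ l, j = l + 1 := ⟨j - 1, by omega⟩
        exact hLle l (by omega) (by omega) (down l (by omega) (by omega) v hv)
    by_cases j2 : j = i + 1
    · subst j2
      by_cases i1 : i = N + 1
      · subst i1
        apply hle (N + 2) (by omega)
        rw [hPN]; exact ⟨v, hv, rfl⟩
      · exact hLle (i + 1) (by omega) (by omega) (up i (by omega) (by omega) v hv)
    rw [kL i j (by omega) (by omega) hj hjn j1 j2 v hv]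
    exact Submodule.smul_mem _ _ (hLle i (by omega) (by omega) hv)
  rcases irr ((Finset.range (N + 3)).sup P) (by
    intro j hj hjn v hv
    have : (Finset.range (N + 3)).sup P ≤
        ((Finset.range (N + 3)).sup P).comap (s j : V →ₗ[ℂ] V) :=
      Finset.sup_le fun i hi v hv => hstab j hj hjn i (Finset.mem_range.1 hi) v hv
    exact this hv) with h1 | h1
  · have h2 := hLle 1 le_rfl (by omega)
    rw [h1, le_bot_iff] at h2
    have h3 := hadj 1 le_rfl (by omega)
    rw [show I s c 1 ⊓ I s c (1 + 1) = ⊥ from h2, finrank_bot] at h3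
    omega
  · rw [h1, finrank_top] at hdim
    omega

theorem case1 (hn : 10 ≤ n) (h : Br n s) (irr : Irr n s) (hV : finrank ℂ V = n + 1)
    (hc : c ≠ 0) (h0 : F s c 1 ≠ 0) (h3 : F s c 1 ≤ 3) (h2 : F s c 2 = 2 * F s c 1) : False := by
  have hdis : ∀ i j, 1 ≤ i → i + 2 ≤ j → j < n → I s c i ⊓ I s c j = ⊥ := by
    intro i j hi hij hj
    have := finrank_pair (c := c) h hi hij hj
    rw [← Submodule.finrank_eq_zero (R := ℂ)]
    omega
  have hadj : ∀ i, 1 ≤ i → i + 1 < n → finrank ℂ ↥(I s c i ⊓ I s c (i + 1)) =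
      finrank ℂ ↥(I s c 1 ⊓ I s c 2) := by
    intro i hi hin
    obtain ⟨g, g1, g2⟩ := h.adj hi hin
    exact (finrank_conj_inf g1 g2).symm
  have hle : 2 * finrank ℂ ↥(I s c 1 ⊓ I s c 2) ≤ 3 := by
    have e := Submodule.finrank_sup_add_finrank_inf_eq (I s c 1 ⊓ I s c 2) (I s c 2 ⊓ I s c 3)
    have e1 : (I s c 1 ⊓ I s c 2) ⊓ (I s c 2 ⊓ I s c 3) = ⊥ := by
      rw [eq_bot_iff, ← hdis 1 3 le_rfl le_rfl (by omega)]
      exact fun v hv => ⟨hv.1.1, hv.2.2⟩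
    have e2 : finrank ℂ ↥((I s c 1 ⊓ I s c 2) ⊔ (I s c 2 ⊓ I s c 3)) ≤ F s c 1 := by
      rw [← finrank_I (c := c) h (i := 2) (by omega) (by omega)]
      exact Submodule.finrank_mono (sup_le inf_le_right inf_le_left)
    rw [e1, finrank_bot, hadj 2 (by omega) (by omega)] at e
    omega
  by_cases hd : finrank ℂ ↥(I s c 1 ⊓ I s c 2) = 0
  · refine case1_zero hn h irr hV hc h0 hdis fun i hi hin => ?_
    rw [← Submodule.finrank_eq_zero (R := ℂ), hadj i hi hin, hd]
  · refine case1_one hn h irr hV hc hdis fun i hi hin => ?_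
    rw [hadj i hi hin]
    omega

end case1
end BraidRep

namespace BraidRep
open Module
set_option linter.unusedSectionVars false

section case2
variable {V : Type*} [AddCommGroup V] [Module ℂ V] [FiniteDimensional ℂ V]
variable {n : ℕ} {s : ℕ → V ≃ₗ[ℂ] V} {c : ℂ}

theorem Br.triple {G : Type*} [Group G] {s : ℕ → G} (h : Br n s) {i j k : ℕ} (hi : 1 ≤ i)
    (hij : i + 2 ≤ j) (hjk : j + 2 ≤ k) (hk : k < n) :
    ∃ g : G, g * s 1 = s i * g ∧ g * s 3 = s j * g ∧ g * s 5 = s k * g := by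
  obtain ⟨g1, a1, b1⟩ := h.slide (a := 5) (b := k) (by omega) (by omega) hk
  obtain ⟨g2, a2, b2, c2⟩ := h.pair hi hij (by omega)
  refine ⟨g2 * g1, ?_, ?_, ?_⟩
  · rw [mul_assoc, b1 1 (by omega) (by omega) (by omega), ← mul_assoc, a2, mul_assoc]
  · rw [mul_assoc, b1 3 (by omega) (by omega) (by omega), ← mul_assoc, b2, mul_assoc]
  · rw [mul_assoc, a1, ← mul_assoc, c2 k hk hjk, mul_assoc]

/-- Triple intersections. -/
def T (s : ℕ → V ≃ₗ[ℂ] V) (c : ℂ) (i j k : ℕ) : Submodule ℂ V := I s c i ⊓ I s c j ⊓ I s c k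

theorem triple_zero (h : Br 10 s) (irr : Irr 10 s) (hV : finrank ℂ V = 11)
    (h1 : F s c 1 = 4) (h2 : F s c 2 = 7) {i j k : ℕ} (hi : 1 ≤ i)
    (hij : i + 2 ≤ j) (hjk : j + 2 ≤ k) (hk : k < 10) : T s c i j k = ⊥ := by
  have hconj : ∀ {i j k : ℕ}, 1 ≤ i → i + 2 ≤ j → j + 2 ≤ k → k < 10 →
      finrank ℂ (T s c i j k) = finrank ℂ (T s c 1 3 5) := by
    intro i j k hi hij hjk hk
    obtain ⟨g, g1, g2, g3⟩ := h.triple hi hij hjk hk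
    have : (T s c 1 3 5).map (g : V →ₗ[ℂ] V) = T s c i j k := by
      unfold T
      rw [Submodule.map_inf _ g.injective, conj_inf g1 g2, conj_I g3]
    rw [← this]
    exact LinearEquiv.finrank_map_eq g _
  rw [← Submodule.finrank_eq_zero (R := ℂ), hconj hi hij hjk hk]
  by_contra hne
  have hone : ∀ {i j : ℕ}, 1 ≤ i → i + 2 ≤ j → j < 10 → finrank ℂ ↥(I s c i ⊓ I s c j) = 1 := by
    intro i j hi hij hj
    have := finrank_pair (c := c) h hi hij hj
    omega
  have heq : ∀ {i j k a b : ℕ}, 1 ≤ i → i + 2 ≤ j → j + 2 ≤ k → k < 10 → 1 ≤ a → a + 2 ≤ b →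
      b < 10 → T s c i j k ≤ I s c a ⊓ I s c b → T s c i j k = I s c a ⊓ I s c b := by
    intro i j k a b hi hij hjk hk ha hab hb hle
    apply Submodule.eq_of_le_of_finrank_le hle
    rw [hone ha hab hb, hconj hi hij hjk hk]
    omega
  have e1 : T s c 1 3 5 = T s c 1 3 6 :=
    (heq (a := 1) (b := 3) (by omega) (by omega) (by omega) (by omega) (by omega) (by omega)
      (by omega) (fun v hv => hv.1)).trans
    (heq (a := 1) (b := 3) (by omega) (by omega) (by omega) (by omega) (by omega) (by omega)
      (by omega) (fun v hv => hv.1)).symm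
  have e2 : T s c 1 3 6 = T s c 1 4 6 :=
    (heq (a := 1) (b := 6) (by omega) (by omega) (by omega) (by omega) (by omega) (by omega)
      (by omega) (fun v hv => ⟨hv.1.1, hv.2⟩)).trans
    (heq (a := 1) (b := 6) (by omega) (by omega) (by omega) (by omega) (by omega) (by omega)
      (by omega) (fun v hv => ⟨hv.1.1, hv.2⟩)).symm
  have e3 : T s c 1 4 6 = T s c 2 4 6 :=
    (heq (a := 4) (b := 6) (by omega) (by omega) (by omega) (by omega) (by omega) (by omega)
      (by omega) (fun v hv => ⟨hv.1.2, hv.2⟩)).trans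
    (heq (a := 4) (b := 6) (by omega) (by omega) (by omega) (by omega) (by omega) (by omega)
      (by omega) (fun v hv => ⟨hv.1.2, hv.2⟩)).symm
  have hst : ∀ {i j k l : ℕ}, 1 ≤ i → i + 2 ≤ j → j + 2 ≤ k → k < 10 → 1 ≤ l → l < 10 →
      (l + 2 ≤ i ∨ i + 2 ≤ l ∨ l = i) → (l + 2 ≤ j ∨ j + 2 ≤ l ∨ l = j) →
      (l + 2 ≤ k ∨ k + 2 ≤ l ∨ l = k) → Stab s l (T s c i j k) := by
    intro i j k l hi hij hjk hk hl hl' a1 a2 a3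
    exact ((stab_I (h.comm' hl hi hl' (by omega) a1)).inf
      (stab_I (h.comm' hl (by omega) hl' (by omega) a2))).inf
      (stab_I (h.comm' hl (by omega) hl' (by omega) a3))
  rcases irr (T s c 1 3 5) (by
    intro l hl hl'
    by_cases ho : l % 2 = 1 ∨ 7 ≤ l
    · exact hst (by omega) (by omega) (by omega) (by omega) hl hl' (by omega) (by omega) (by omega)
    · rw [e1, e2, e3]
      exact hst (by omega) (by omega) (by omega) (by omega) hl hl' (by omega) (by omega)
        (by omega)) with h3 | h3
  · rw [h3, finrank_bot] at hne; exact hne rfl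
  · have h4 : T s c 1 3 5 ≤ I s c 1 := fun v hv => hv.1.1
    rw [h3, top_le_iff] at h4
    have h5 := finrank_I (c := c) h (i := 1) le_rfl (by omega)
    rw [h4, finrank_top] at h5
    omega

/-- Adjacent pairs `(i, i+1)`, `i ≤ 6`, are conjugate by an element commuting with `s 9`. -/
theorem Br.adj9 {G : Type*} [Group G] {s : ℕ → G} (h : Br 10 s) {i : ℕ} (hi : 1 ≤ i)
    (hin : i ≤ 6) : ∃ g : G, g * s 1 = s i * g ∧ g * s 2 = s (i + 1) * g ∧ g * s 9 = s 9 * g := by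
  induction i, hi using Nat.le_induction with
  | base => exact ⟨1, by simp, by simp, by simp⟩
  | succ i hi ih =>
    obtain ⟨g, h1, h2, h5⟩ := ih (by omega)
    obtain ⟨g', h3, h4, h6⟩ := h.shift hi (by omega)
    exact ⟨g' * g, by rw [mul_assoc, h1, ← mul_assoc, h3, mul_assoc],
      by rw [mul_assoc, h2, ← mul_assoc, h4, mul_assoc],
      by rw [mul_assoc, h5, ← mul_assoc, h6 9 (by omega) (by omega) (by omega), mul_assoc]⟩

theorem lemmaX (h : Br 10 s)
    (hX : ∀ i, 1 ≤ i → i ≤ 7 → finrank ℂ ↥(I s c i ⊓ I s c 9) = 1)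
    (hT : ∀ i j, 1 ≤ i → i + 2 ≤ j → j ≤ 7 → T s c i j 9 = ⊥)
    (h9 : finrank ℂ (I s c 9) = 4) :
    ∀ x ∈ I s c 1 ⊓ I s c 9, A s c 1 x = 0 ∧ A s c 2 x = 0 := by
  have hxex : ∀ i, ∃ x : V, 1 ≤ i → i ≤ 7 → x ≠ 0 ∧ x ∈ I s c i ∧ x ∈ I s c 9 ∧
      ∀ y, y ∈ I s c i → y ∈ I s c 9 → ∃ a : ℂ, y = a • x := by
    intro i
    by_cases hi : 1 ≤ i ∧ i ≤ 7
    · obtain ⟨x, hx0, hx⟩ := finrank_eq_one_iff'.1 (hX i hi.1 hi.2)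
      refine ⟨x.1, fun _ _ => ⟨fun e => hx0 (Subtype.ext e), x.2.1, x.2.2, fun y h1 h2 => ?_⟩⟩
      obtain ⟨a, ha⟩ := hx ⟨y, h1, h2⟩
      exact ⟨a, (congrArg Subtype.val ha).symm⟩
    · exact ⟨0, fun h1 h2 => absurd ⟨h1, h2⟩ hi⟩
  choose x hx using hxex
  -- triple intersections involving adjacent indices
  have hadj : ∀ i, 1 ≤ i → i ≤ 6 → T s c i (i + 1) 9 = ⊥ := by
    intro i hi hi6
    obtain ⟨g, g1, g2, g9⟩ := h.adj9 hi hi6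
    rw [eq_bot_iff]
    intro v hv
    obtain ⟨w, rfl⟩ := g.surjective v
    have w1 := (conj_mem g1).1 hv.1.1
    have w2 := (conj_mem g2).1 hv.1.2
    have w9 := (conj_mem g9).1 hv.2
    obtain ⟨g', f1, f2, f3⟩ := h.shift (i := 1) le_rfl (by omega)
    have f9 := f3 9 (by omega) (by omega) (by omega)
    obtain ⟨x0, xi, x9, xs⟩ := hx 2 (by omega) (by omega)
    obtain ⟨a, ha⟩ := xs w w2 w9
    obtain ⟨b, hb⟩ := xs (g' w) ((conj_mem f1).2 w1) ((conj_mem f9).2 w9)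
    have hw3 : g' w ∈ I s c 3 := (conj_mem f2).2 w2
    by_contra hne
    have hw0 : w ≠ 0 := by rintro rfl; exact hne (by simp)
    have hb0 : b ≠ 0 := by
      rintro rfl
      rw [zero_smul] at hb
      exact hw0 (g'.map_eq_zero_iff.1 hb)
    rw [hb, Submodule.smul_mem_iff _ hb0] at hw3
    have : w ∈ T s c 1 3 9 := ⟨⟨w1, by rw [ha]; exact Submodule.smul_mem _ _ hw3⟩, w9⟩
    rw [hT 1 3 (by omega) (by omega) (by omega)] at this
    exact hw0 this
  have hA0 : ∀ i j, 1 ≤ i → i ≤ 7 → 1 ≤ j → j ≤ 7 → (i + 2 ≤ j ∨ j + 2 ≤ i) →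
      A s c j (x i) = 0 := by
    intro i j hi hi7 hj hj7 hij
    obtain ⟨x0, xi, x9, xs⟩ := hx i hi hi7
    have m1 := A_mem_inf h hi hj (by omega) (by omega) (by omega) xi
    have m2 := A_mem_inf h (i := 9) (by omega) hj (by omega) (by omega) (by omega) x9
    rcases hij with h1 | h1
    · have : A s c j (x i) ∈ T s c i j 9 := ⟨m1, m2.1⟩
      rwa [hT i j hi h1 hj7] at this
    · have : A s c j (x i) ∈ T s c j i 9 := ⟨⟨m1.2, m1.1⟩, m2.1⟩
      rwa [hT j i hj h1 hi7] at this
  -- transport of `x 1`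
  have htr : ∀ i (g : V ≃ₗ[ℂ] V), 1 ≤ i → i ≤ 7 → g * s 1 = s i * g → g * s 9 = s 9 * g →
      ∃ a : ℂ, a ≠ 0 ∧ g (x 1) = a • x i := by
    intro i g hi hi7 g1 g9
    obtain ⟨x0, xi, x9, xs⟩ := hx 1 (by omega) (by omega)
    obtain ⟨y0, yi, y9, ys⟩ := hx i hi hi7
    obtain ⟨a, ha⟩ := ys (g (x 1)) ((conj_mem g1).2 xi) ((conj_mem g9).2 x9)
    refine ⟨a, ?_, ha⟩
    rintro rfl
    rw [zero_smul] at ha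
    exact x0 (g.map_eq_zero_iff.1 ha)
  have hP : A s c 1 (x 1) = 0 := by
    by_contra hne
    have hPi : ∀ i, 1 ≤ i → i ≤ 7 → A s c i (x i) ≠ 0 := by
      intro i hi hi7 h0
      obtain ⟨g, g1, g2⟩ := h.slide (a := 1) (b := i) le_rfl hi (by omega)
      obtain ⟨a, ha0, ha⟩ := htr i g hi hi7 g1 (g2 9 (by omega) (by omega) (by omega))
      apply hne
      apply g.injective
      rw [conj_A g1, ha, map_smul, h0, smul_zero, map_zero]
    have hexp : ∀ (a1 a3 a5 a7 : ℂ) y, y = a1 • x 1 + a3 • x 3 + a5 • x 5 + a7 • x 7 →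
        (A s c 1 y = a1 • A s c 1 (x 1) ∧ A s c 3 y = a3 • A s c 3 (x 3) ∧
          A s c 5 y = a5 • A s c 5 (x 5) ∧ A s c 7 y = a7 • A s c 7 (x 7)) := by
      rintro a1 a3 a5 a7 y rfl
      refine ⟨?_, ?_, ?_, ?_⟩
      · simp [hA0 3 1, hA0 5 1, hA0 7 1]
      · simp [hA0 1 3, hA0 5 3, hA0 7 3]
      · simp [hA0 1 5, hA0 3 5, hA0 7 5]
      · simp [hA0 1 7, hA0 3 7, hA0 5 7]
    have hli : LinearIndependent ℂ ![x 1, x 3, x 5, x 7] := by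
      rw [Fintype.linearIndependent_iff]
      intro a ha
      rw [Fin.sum_univ_four] at ha
      obtain ⟨e1, e3, e5, e7⟩ := hexp (a 0) (a 1) (a 2) (a 3) 0 (by rw [← ha]; rfl)
      rw [map_zero, eq_comm, smul_eq_zero] at e1 e3 e5 e7
      intro i
      fin_cases i
      · exact e1.resolve_right (hPi 1 (by omega) (by omega))
      · exact e3.resolve_right (hPi 3 (by omega) (by omega))
      · exact e5.resolve_right (hPi 5 (by omega) (by omega))
      · exact e7.resolve_right (hPi 7 (by omega) (by omega))
    have hspan : Submodule.span ℂ (Set.range ![x 1, x 3, x 5, x 7]) = I s c 9 := by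
      apply Submodule.eq_of_le_of_finrank_eq
      · rw [Submodule.span_le]
        rintro _ ⟨i, rfl⟩
        fin_cases i
        · exact (hx 1 (by omega) (by omega)).2.2.1
        · exact (hx 3 (by omega) (by omega)).2.2.1
        · exact (hx 5 (by omega) (by omega)).2.2.1
        · exact (hx 7 (by omega) (by omega)).2.2.1
      · rw [finrank_span_eq_card hli, h9]; simp
    have hrep : ∀ y ∈ I s c 9, ∃ a1 a3 a5 a7 : ℂ,
        y = a1 • x 1 + a3 • x 3 + a5 • x 5 + a7 • x 7 := by
      intro y hy
      rw [← hspan, Submodule.mem_span_range_iff_exists_fun] at hy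
      obtain ⟨a, ha⟩ := hy
      rw [Fin.sum_univ_four] at ha
      exact ⟨a 0, a 1, a 2, a 3, ha.symm⟩
    have h43 : A s c 4 (x 3) = 0 := by
      obtain ⟨x0, xi, x9, xs⟩ := hx 2 (by omega) (by omega)
      obtain ⟨a1, a3, a5, a7, e⟩ := hrep _ x9
      obtain ⟨_, _, e5, e7⟩ := hexp _ _ _ _ _ e
      rw [hA0 2 5 (by omega) (by omega) (by omega) (by omega) (by omega), eq_comm,
        smul_eq_zero, or_iff_left (hPi 5 (by omega) (by omega))] at e5
      rw [hA0 2 7 (by omega) (by omega) (by omega) (by omega) (by omega), eq_comm,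
        smul_eq_zero, or_iff_left (hPi 7 (by omega) (by omega))] at e7
      rw [e5, e7, zero_smul, zero_smul, add_zero, add_zero] at e
      have ha3 : a3 ≠ 0 := by
        rintro rfl
        rw [zero_smul, add_zero] at e
        have : x 2 ∈ T s c 1 (1 + 1) 9 := ⟨⟨by
          rw [e]; exact Submodule.smul_mem _ _ (hx 1 (by omega) (by omega)).2.1, xi⟩, x9⟩
        rw [hadj 1 (by omega) (by omega)] at this
        exact x0 this
      have e4 := congrArg (A s c 4) e
      rw [hA0 2 4 (by omega) (by omega) (by omega) (by omega) (by omega), map_add, map_smul,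
        map_smul, hA0 1 4 (by omega) (by omega) (by omega) (by omega) (by omega), smul_zero,
        zero_add, eq_comm, smul_eq_zero] at e4
      exact e4.resolve_left ha3
    have h45 : A s c 4 (x 5) = 0 := by
      obtain ⟨x0, xi, x9, xs⟩ := hx 6 (by omega) (by omega)
      obtain ⟨a1, a3, a5, a7, e⟩ := hrep _ x9
      obtain ⟨e1, e3, _, _⟩ := hexp _ _ _ _ _ e
      rw [hA0 6 1 (by omega) (by omega) (by omega) (by omega) (by omega), eq_comm,
        smul_eq_zero, or_iff_left (hPi 1 (by omega) (by omega))] at e1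
      rw [hA0 6 3 (by omega) (by omega) (by omega) (by omega) (by omega), eq_comm,
        smul_eq_zero, or_iff_left (hPi 3 (by omega) (by omega))] at e3
      rw [e1, e3, zero_smul, zero_smul, zero_add, zero_add] at e
      have ha5 : a5 ≠ 0 := by
        rintro rfl
        rw [zero_smul, zero_add] at e
        have : x 6 ∈ T s c 6 (6 + 1) 9 := ⟨⟨xi, by
          rw [e]; exact Submodule.smul_mem _ _ (hx 7 (by omega) (by omega)).2.1⟩, x9⟩
        rw [hadj 6 (by omega) (by omega)] at this
        exact x0 this
      have e4 := congrArg (A s c 4) e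
      rw [hA0 6 4 (by omega) (by omega) (by omega) (by omega) (by omega), map_add, map_smul,
        map_smul, hA0 7 4 (by omega) (by omega) (by omega) (by omega) (by omega), smul_zero,
        add_zero, eq_comm, smul_eq_zero] at e4
      exact e4.resolve_left ha5
    obtain ⟨a1, a3, a5, a7, e⟩ := hrep _ (hx 4 (by omega) (by omega)).2.2.1
    apply hPi 4 (by omega) (by omega)
    rw [e]
    simp [h43, h45, hA0 1 4, hA0 7 4]
  have hQ : A s c 2 (x 1) = 0 := by
    by_contra hne
    have hQi : ∀ i, 1 ≤ i → i ≤ 6 → A s c (i + 1) (x i) ≠ 0 := by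
      intro i hi hi6 h0
      obtain ⟨g, g1, g2, g9⟩ := h.adj9 hi hi6
      obtain ⟨a, ha0, ha⟩ := htr i g hi (by omega) g1 g9
      apply hne
      apply g.injective
      rw [conj_A g2, ha, map_smul, h0, smul_zero, map_zero]
    have hli : LinearIndependent ℂ ![x 1, x 2, x 3, x 4, x 5] := by
      rw [Fintype.linearIndependent_iff]
      intro a ha
      rw [Fin.sum_univ_five] at ha
      have ha' : a 0 • x 1 + a 1 • x 2 + a 2 • x 3 + a 3 • x 4 + a 4 • x 5 = 0 := ha
      have e4 := congrArg (A s c 6) ha'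
      simp only [map_add, map_smul, map_zero, hA0 1 6 (by omega) (by omega) (by omega) (by omega) (by omega), hA0 2 6 (by omega) (by omega) (by omega) (by omega) (by omega),
        hA0 3 6 (by omega) (by omega) (by omega) (by omega) (by omega), hA0 4 6 (by omega) (by omega) (by omega) (by omega) (by omega),
        smul_zero, zero_add, smul_eq_zero, hQi 5 (by omega) (by omega), or_false] at e4
      rw [e4, zero_smul, add_zero] at ha'
      have e3 := congrArg (A s c 5) ha'
      simp only [map_add, map_smul, map_zero, hA0 1 5 (by omega) (by omega) (by omega) (by omega) (by omega), hA0 2 5 (by omega) (by omega) (by omega) (by omega) (by omega),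
        hA0 3 5 (by omega) (by omega) (by omega) (by omega) (by omega),
        smul_zero, zero_add, smul_eq_zero, hQi 4 (by omega) (by omega), or_false] at e3
      rw [e3, zero_smul, add_zero] at ha'
      have e2 := congrArg (A s c 4) ha'
      simp only [map_add, map_smul, map_zero, hA0 1 4 (by omega) (by omega) (by omega) (by omega) (by omega), hA0 2 4 (by omega) (by omega) (by omega) (by omega) (by omega),
        smul_zero, zero_add, smul_eq_zero, hQi 3 (by omega) (by omega), or_false] at e2
      rw [e2, zero_smul, add_zero] at ha'
      have e1 := congrArg (A s c 3) ha'
      simp only [map_add, map_smul, map_zero, hA0 1 3 (by omega) (by omega) (by omega) (by omega) (by omega),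
        smul_zero, zero_add, smul_eq_zero, hQi 2 (by omega) (by omega), or_false] at e1
      rw [e1, zero_smul, add_zero] at ha'
      have e0 := (smul_eq_zero.1 ha').resolve_right (hx 1 (by omega) (by omega)).1
      intro i
      fin_cases i
      · exact e0
      · exact e1
      · exact e2
      · exact e3
      · exact e4
    have hle : Submodule.span ℂ (Set.range ![x 1, x 2, x 3, x 4, x 5]) ≤ I s c 9 := by
      rw [Submodule.span_le]
      rintro _ ⟨i, rfl⟩
      fin_cases i
      · exact (hx 1 (by omega) (by omega)).2.2.1
      · exact (hx 2 (by omega) (by omega)).2.2.1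
      · exact (hx 3 (by omega) (by omega)).2.2.1
      · exact (hx 4 (by omega) (by omega)).2.2.1
      · exact (hx 5 (by omega) (by omega)).2.2.1
    have := Submodule.finrank_mono hle
    rw [finrank_span_eq_card hli, h9] at this
    simp at this
  intro y hy
  obtain ⟨a, rfl⟩ := (hx 1 (by omega) (by omega)).2.2.2 y hy.1 hy.2
  rw [map_smul, map_smul, hP, hQ]
  simp

theorem case2 (h : Br 10 s) (irr : Irr 10 s) (hV : finrank ℂ V = 11)
    (h1 : F s c 1 = 4) (h2 : F s c 2 = 7) : False := by
  have hone : ∀ {i j : ℕ}, 1 ≤ i → i + 2 ≤ j → j < 10 → finrank ℂ ↥(I s c i ⊓ I s c j) = 1 := by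
    intro i j hi hij hj
    have := finrank_pair (c := c) h hi hij hj
    omega
  have hT : ∀ {i j k : ℕ}, 1 ≤ i → i + 2 ≤ j → j + 2 ≤ k → k < 10 → T s c i j k = ⊥ :=
    fun hi hij hjk hk => triple_zero h irr hV h1 h2 hi hij hjk hk
  have hX := lemmaX (c := c) h (fun i hi hi7 => hone hi (by omega) (by omega))
    (fun i j hi hij hj => hT hi hij (by omega) (by omega))
    ((finrank_I h (by omega) (by omega)).trans h1)
  have hrev : Br 10 (fun i => s (10 - i)) := by
    constructor
    · intro i j hi hij hj
      exact (h.comm (10 - j) (10 - i) (by omega) (by omega) (by omega)).symm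
    · intro i hi hin
      have := h.braid (10 - (i + 1)) (by omega) (by omega)
      rw [show 10 - (i + 1) + 1 = 10 - i by omega] at this
      exact this.symm
  have hX' := lemmaX (c := c) hrev
    (fun i hi hi7 => by
      show finrank ℂ ↥(I s c (10 - i) ⊓ I s c 1) = 1
      rw [inf_comm]; exact hone le_rfl (by omega) (by omega))
    (fun i j hi hij hj => by
      show I s c (10 - i) ⊓ I s c (10 - j) ⊓ I s c 1 = ⊥
      rw [eq_bot_iff, ← hT (i := 1) (j := 10 - j) (k := 10 - i) le_rfl (by omega) (by omega)
        (by omega)]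
      exact fun v hv => ⟨⟨hv.2, hv.1.2⟩, hv.1.1⟩)
    ((show finrank ℂ (I s c 1) = F s c 1 from finrank_I h (by omega) (by omega)).trans h1)
  obtain ⟨x, hx0, _⟩ := finrank_eq_one_iff'.1 (hone (i := 1) (j := 9) le_rfl (by omega) (by omega))
  have x0 : x.1 ≠ 0 := fun e => hx0 (Subtype.ext e)
  obtain ⟨a1, a2⟩ := hX x.1 x.2
  obtain ⟨a9, a8⟩ := hX' x.1 ⟨x.2.2, x.2.1⟩
  have hA : ∀ j, 1 ≤ j → j < 10 → A s c j x.1 = 0 := by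
    intro j hj hj10
    by_cases j1 : j = 1
    · rw [j1]; exact a1
    by_cases j2 : j = 2
    · rw [j2]; exact a2
    by_cases j8 : j = 8
    · rw [j8]; exact a8
    by_cases j9 : j = 9
    · rw [j9]; exact a9
    have m1 := A_mem_inf h (i := 1) le_rfl hj (by omega) hj10 (by omega) x.2.1
    have m2 := A_mem_inf h (i := 9) (by omega) hj (by omega) hj10 (by omega) x.2.2
    have : A s c j x.1 ∈ T s c 1 j 9 := ⟨m1, m2.1⟩
    rwa [hT (by omega) (by omega) (by omega) (by omega)] at this
  rcases irr (Submodule.span ℂ {x.1}) (fun i hi hin w hw => by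
    obtain ⟨a, rfl⟩ := Submodule.mem_span_singleton.1 hw
    rw [s_apply (c := c), map_smul, hA i hi hin, smul_zero, zero_add]
    exact Submodule.smul_mem _ _ hw) with e | e
  · exact x0 (Submodule.span_singleton_eq_bot.1 e)
  · have := finrank_span_singleton (K := ℂ) x0
    rw [e, finrank_top] at this
    omega

theorem no_irr (hn : 10 ≤ n) (h : Br n s) (irr : Irr n s) (hV : finrank ℂ V = n + 1) : False := by
  obtain ⟨c, hc, h0, ⟨h1, h2⟩ | ⟨rfl, h1, h2⟩⟩ := cases_c hn h irr hV
  · exact case1 hn h irr hV hc h0 h1 h2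
  · exact case2 h irr hV h1 h2

end case2
end BraidRep

theorem stmt_0 (n : ℕ) (hn : 10 ≤ n)
    (C : ℕ → Matrix (Fin (n + 1)) (Fin (n + 1)) ℂ)
    (hinv : ∀ i, 1 ≤ i → i ≤ n - 1 → IsUnit (C i))
    (hcomm : ∀ i j, 1 ≤ i → i ≤ n - 1 → 1 ≤ j → j ≤ n - 1 → i + 2 ≤ j →
      C i * C j = C j * C i)
    (hbraid : ∀ i, 1 ≤ i → i ≤ n - 2 →
      C i * C (i + 1) * C i = C (i + 1) * C i * C (i + 1)) :
    ∃ p : Submodule ℂ (Fin (n + 1) → ℂ),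
      (∀ i, 1 ≤ i → i ≤ n - 1 → ∀ v ∈ p, (C i).mulVec v ∈ p) ∧ p ≠ ⊥ ∧ p ≠ ⊤ := by
  by_contra hcon
  have hs : ∀ i, ∃ e : (Fin (n + 1) → ℂ) ≃ₗ[ℂ] (Fin (n + 1) → ℂ),
      1 ≤ i → i ≤ n - 1 → ∀ v, e v = (C i).mulVec v := by
    intro i
    by_cases hi : 1 ≤ i ∧ i ≤ n - 1
    · have hu := hinv i hi.1 hi.2
      refine ⟨LinearEquiv.ofBijective (C i).mulVecLin ⟨?_, ?_⟩, fun _ _ v => rfl⟩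
      · exact Matrix.mulVec_injective_of_isUnit hu
      · exact (LinearMap.injective_iff_surjective (f := (C i).mulVecLin)).1
          (Matrix.mulVec_injective_of_isUnit hu)
    · exact ⟨LinearEquiv.refl _ _, fun h1 h2 => absurd ⟨h1, h2⟩ hi⟩
  choose s hs using hs
  have hbr : BraidRep.Br n s := by
    constructor
    · intro i j hi hij hj
      apply LinearEquiv.ext
      intro v
      have e := hcomm i j hi (by omega) (by omega) (by omega) hij
      rw [LinearEquiv.mul_apply, LinearEquiv.mul_apply, hs i hi (by omega),
        hs j (by omega) (by omega), hs j (by omega) (by omega), hs i hi (by omega),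
        Matrix.mulVec_mulVec, Matrix.mulVec_mulVec, e]
    · intro i hi hin
      apply LinearEquiv.ext
      intro v
      have e := hbraid i hi (by omega)
      have h1 := hs i hi (by omega)
      have h2 := hs (i + 1) (by omega) (by omega)
      simp only [LinearEquiv.mul_apply, h1, h2, Matrix.mulVec_mulVec, ← mul_assoc, e]
  refine BraidRep.no_irr hn hbr ?_ (by simp)
  intro p hp
  by_contra hne
  rw [not_or] at hne
  refine hcon ⟨p, fun i hi hin v hv => ?_, hne.1, hne.2⟩
  rw [← hs i hi hin]
  exact hp i hi (by omega) v hv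
end

section
/- Let n ≥ 10 and let C_1, …, C_{n−1} ∈ GL_r(ℂ) be an irreducible representation of the braid group B_n of any dimension r ≥ 1. Then rank(C_i − I) ≠ 3 for every i = 1, …, n−1. -/
def BrChain {U : Type} [AddCommGroup U] [Module ℂ U] (m : ℕ) (g : ℕ → Module.End ℂ U) : Prop :=
  (∀ i, 1 ≤ i → i ≤ m → IsUnit (g i)) ∧
  (∀ i j, 1 ≤ i → i + 2 ≤ j → j ≤ m → g i * g j = g j * g i) ∧
  (∀ i, 1 ≤ i → i + 1 ≤ m → g i * g (i+1) * g i = g (i+1) * g i * g (i+1))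

section
variable {U : Type} [AddCommGroup U] [Module ℂ U]

lemma BrChain.shift {m : ℕ} {g : ℕ → Module.End ℂ U} (h : BrChain m g) (s k : ℕ) (hk : k + s ≤ m) :
    BrChain k (fun i => g (i + s)) := by
  obtain ⟨h1, h2, h3⟩ := h
  refine ⟨fun i a b => h1 _ (by omega) (by omega), fun i j a b c => h2 _ _ (by omega) (by omega) (by omega), fun i a b => ?_⟩
  have := h3 (i + s) (by omega) (by omega)
  simpa [add_right_comm] using this

lemma br_cancel {M : Type} [Monoid M] {a b : M} (ha : IsUnit a) (hb : IsUnit b) (hc : a * b = b * a)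
    (h : a * b * a = b * a * b) : a = b := by
  rw [mul_assoc, ← hc] at h
  rw [mul_assoc] at h
  have := ha.mul_left_cancel h
  exact hb.mul_right_cancel this

lemma BrChain.all_eq {m : ℕ} {g : ℕ → Module.End ℂ U} (h : BrChain m g) (k : ℕ) (hk : 1 ≤ k) (hkm : k + 1 ≤ m)
    (hc : g k * g (k+1) = g (k+1) * g k) : ∀ i j, 1 ≤ i → i ≤ m → 1 ≤ j → j ≤ m → g i = g j := by
  obtain ⟨h1, h2, h3⟩ := h
  have key : ∀ i, 1 ≤ i → i + 1 ≤ m → g i * g (i+1) = g (i+1) * g i → g i = g (i+1) := fun i a b c =>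
    br_cancel (h1 _ a (by omega)) (h1 _ (by omega) b) c (h3 i a b)
  have up : ∀ d, k + d + 1 ≤ m → g (k+d) = g (k+d+1) := by
    intro d
    induction d with
    | zero => intro _; exact key k hk hkm hc
    | succ d ih =>
      intro hd
      have e := ih (by omega)
      apply key (k + (d+1)) (by omega) hd
      have := h2 (k+d) (k+d+2) (by omega) (by omega) (by omega)
      rw [e] at this
      exact this
  have down : ∀ d, ∀ i, i + d = k → 1 ≤ i → g i = g (i+1) := by
    intro d
    induction d with
    | zero => intro i hi _; obtain rfl : i = k := by omega
              exact key i hk hkm hc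
    | succ d ih =>
      intro i hi h1i
      have e := ih (i+1) (by omega) (by omega)
      apply key i h1i (by omega)
      have := h2 i (i+2) (by omega) (by omega) (by omega)
      rw [e]
      exact this
  have step : ∀ i, 1 ≤ i → i + 1 ≤ m → g i = g (i+1) := by
    intro i a b
    by_cases hik : i ≤ k
    · exact down (k - i) i (by omega) a
    · have := up (i - k) (by omega)
      rwa [show k + (i-k) = i by omega] at this
  have one : ∀ i, i + 1 ≤ m → g (i+1) = g 1 := by
    intro i
    induction i with
    | zero => intro _; rfl
    | succ i ih => intro hi; rw [← step (i+1) (by omega) hi]; exact ih (by omega)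
  intro i j a b c d
  have e1 := one (i-1) (by omega)
  have e2 := one (j-1) (by omega)
  rw [Nat.sub_add_cancel a] at e1
  rw [Nat.sub_add_cancel c] at e2
  rw [e1, e2]

variable [FiniteDimensional ℂ U]

lemma comm_dim2 (hd : Module.finrank ℂ U ≤ 2) (a : Module.End ℂ U)
    (hns : ¬ ∃ c : ℂ, a = c • 1) : ∀ b c : Module.End ℂ U, a * b = b * a → a * c = c * a → b * c = c * b := by
  have hv : ∃ v, LinearIndependent ℂ ![v, a v] := by
    by_contra hcon
    push Not at hcon
    exact hns (LinearMap.exists_eq_smul_id_of_forall_notLinearIndependent hcon)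
  obtain ⟨v, hv⟩ := hv
  have hspan : ∀ w, ∃ x y : ℂ, x • v + y • a v = w := by
    have h2 : Fintype.card (Fin 2) = Module.finrank ℂ U := by
      have := hv.fintype_card_le_finrank
      simp at this ⊢; omega
    have := hv.span_eq_top_of_card_eq_finrank' h2
    intro w
    have hw : w ∈ Submodule.span ℂ (Set.range ![v, a v]) := by rw [this]; trivial
    simp only [Matrix.range_cons, Matrix.range_empty, Set.union_empty, Set.singleton_union] at hw
    exact Submodule.mem_span_pair.1 hw
  have poly : ∀ b : Module.End ℂ U, a * b = b * a → ∃ x y : ℂ, b = x • 1 + y • a := by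
    intro b hb
    obtain ⟨x, y, hxy⟩ := hspan (b v)
    refine ⟨x, y, LinearMap.ext fun w => ?_⟩
    obtain ⟨s, t, rfl⟩ := hspan w
    have hb' : b (a v) = a (b v) := (LinearMap.congr_fun hb v).symm
    simp [hb', ← hxy]
    module
  intro b c hb hc
  obtain ⟨x, y, rfl⟩ := poly b hb
  obtain ⟨x', y', rfl⟩ := poly c hc
  simp only [add_mul, mul_add, smul_mul_assoc, mul_smul_comm, one_mul, mul_one, smul_add, smul_smul]
  rw [mul_comm x x', mul_comm x y', mul_comm y x', mul_comm y y']
  abel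

lemma eq_dim2 (hd : Module.finrank ℂ U ≤ 2) {m : ℕ} (hm : 4 ≤ m) {g : ℕ → Module.End ℂ U} (h : BrChain m g) :
    ∀ i j, 1 ≤ i → i ≤ m → 1 ≤ j → j ≤ m → g i = g j := by
  by_cases hns : ∃ c : ℂ, g 1 = c • 1
  · obtain ⟨c, hc⟩ := hns
    exact h.all_eq 1 le_rfl (by omega) (by rw [hc]; simp)
  · exact h.all_eq 3 (by omega) (by omega) (comm_dim2 hd _ hns _ _ (h.2.1 1 3 (by omega) (by omega) (by omega)) (h.2.1 1 4 (by omega) (by omega) (by omega)))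

open Classical in
lemma BrChain.sub {m : ℕ} {g : ℕ → Module.End ℂ U} (h : BrChain m g) (W : Submodule ℂ U)
    (hW : ∀ i, 1 ≤ i → i ≤ m → ∀ x ∈ W, g i x ∈ W) :
    ∃ g' : ℕ → Module.End ℂ W, BrChain m g' ∧ ∀ i, 1 ≤ i → i ≤ m → ∀ x : W, (g' i x : U) = g i x := by
  refine ⟨fun i => if h : ∀ x ∈ W, g i x ∈ W then (g i).restrict h else 1, ?_⟩
  have key : ∀ i, 1 ≤ i → i ≤ m → ∀ x : W, ((if h : ∀ x ∈ W, g i x ∈ W then (g i).restrict h else 1 : Module.End ℂ W) x : U) = g i x := by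
    intro i a b x
    rw [dif_pos (hW i a b)]
    rfl
  refine ⟨⟨?_, ?_, ?_⟩, key⟩
  · intro i a b
    rw [LinearMap.isUnit_iff_ker_eq_bot, LinearMap.ker_eq_bot']
    intro x hx
    have := key i a b x
    rw [hx] at this
    have h1 := LinearMap.ker_eq_bot'.1 ((LinearMap.isUnit_iff_ker_eq_bot _).1 (h.1 i a b)) x (by simpa using this.symm)
    exact Subtype.ext h1
  · intro i j a b c
    ext x
    simp only [Module.End.mul_apply]
    rw [key i a (by omega), key j (by omega) c, key j (by omega) c, key i a (by omega)]
    exact LinearMap.congr_fun (h.2.1 i j a b c) x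
  · intro i a b
    ext x
    simp only [Module.End.mul_apply]
    rw [key i a (by omega), key (i+1) (by omega) b, key i a (by omega), key (i+1) (by omega) b, key i a (by omega), key (i+1) (by omega) b]
    exact LinearMap.congr_fun (h.2.2 i a b) x

open Classical in
lemma BrChain.quo {m : ℕ} {g : ℕ → Module.End ℂ U} (h : BrChain m g) (W : Submodule ℂ U)
    (hW : ∀ i, 1 ≤ i → i ≤ m → ∀ x ∈ W, g i x ∈ W) :
    ∃ g' : ℕ → Module.End ℂ (U ⧸ W), BrChain m g' ∧ ∀ i, 1 ≤ i → i ≤ m → ∀ x : U, g' i (W.mkQ x) = W.mkQ (g i x) := by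
  refine ⟨fun i => if h : W ≤ W.comap (g i) then W.mapQ W (g i) h else 1, ?_⟩
  have key : ∀ i, 1 ≤ i → i ≤ m → ∀ x : U, ((if h : W ≤ W.comap (g i) then W.mapQ W (g i) h else 1 : Module.End ℂ (U ⧸ W)) (W.mkQ x)) = W.mkQ (g i x) := by
    intro i a b x
    have : W ≤ W.comap (g i) := fun x hx => hW i a b x hx
    rw [dif_pos this]
    rfl
  refine ⟨⟨?_, ?_, ?_⟩, key⟩
  · intro i a b
    rw [LinearMap.isUnit_iff_range_eq_top, LinearMap.range_eq_top]
    intro y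
    obtain ⟨y, rfl⟩ := W.mkQ_surjective y
    obtain ⟨x, rfl⟩ := LinearMap.range_eq_top.1 ((LinearMap.isUnit_iff_range_eq_top _).1 (h.1 i a b)) y
    exact ⟨W.mkQ x, key i a b x⟩
  · intro i j a b c
    refine LinearMap.ext fun y => ?_
    obtain ⟨x, rfl⟩ := W.mkQ_surjective y
    simp only [Module.End.mul_apply]
    rw [key i a (by omega), key j (by omega) c, key j (by omega) c, key i a (by omega)]
    exact congrArg W.mkQ (LinearMap.congr_fun (h.2.1 i j a b c) x)
  · intro i a b
    refine LinearMap.ext fun y => ?_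
    obtain ⟨x, rfl⟩ := W.mkQ_surjective y
    simp only [Module.End.mul_apply]
    rw [key i a (by omega), key (i+1) (by omega) b, key i a (by omega), key (i+1) (by omega) b, key i a (by omega), key (i+1) (by omega) b]
    exact congrArg W.mkQ (LinearMap.congr_fun (h.2.2 i a b) x)

lemma eq_dim3 (hd : Module.finrank ℂ U ≤ 3) {m : ℕ} (hm : 6 ≤ m) {g : ℕ → Module.End ℂ U} (h : BrChain m g) :
    ∀ i j, 1 ≤ i → i ≤ m → 1 ≤ j → j ≤ m → g i = g j := by
  rcases subsingleton_or_nontrivial U with hU | hU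
  · intros; exact Subsingleton.elim _ _
  obtain ⟨c, hc⟩ := Module.End.exists_eigenvalue (g 1)
  set E := (g 1).eigenspace c with hE
  have hEne : E ≠ ⊥ := hc
  by_cases hT : E = ⊤
  · refine h.all_eq 1 le_rfl (by omega) ?_
    ext x
    have h1 : ∀ y, g 1 y = c • y := fun y => Module.End.mem_eigenspace_iff.1 (by rw [← hE, hT]; trivial)
    simp [h1]
  have hlt : Module.finrank ℂ E < Module.finrank ℂ U := Submodule.finrank_lt hT
  have hpos : 0 < Module.finrank ℂ E := by
    rw [Module.finrank_pos_iff]; exact Submodule.nontrivial_iff_ne_bot.2 hEne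
  have hq := E.finrank_quotient_add_finrank
  have hs := h.shift 2 (m-2) (by omega)
  have hinv : ∀ i, 1 ≤ i → i ≤ m - 2 → ∀ x ∈ E, (fun i => g (i+2)) i x ∈ E := by
    intro i a b x hx
    rw [hE, Module.End.mem_eigenspace_iff] at hx ⊢
    have := LinearMap.congr_fun (h.2.1 1 (i+2) le_rfl (by omega) (by omega)) x
    simp only [Module.End.mul_apply] at this ⊢
    rw [this, hx, map_smul]
  obtain ⟨g1, hg1, k1⟩ := hs.sub E hinv
  obtain ⟨g2, hg2, k2⟩ := hs.quo E hinv
  have e1 := eq_dim2 (by omega) (by omega) hg1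
  have e2 := eq_dim2 (by omega) (by omega) hg2
  have f1 : ∀ i, 1 ≤ i → i ≤ m - 2 → ∀ x ∈ E, g (i+2) x = g 3 x := by
    intro i a b x hx
    have := k1 i a b ⟨x, hx⟩
    rw [e1 i 1 a b le_rfl (by omega), k1 1 le_rfl (by omega)] at this
    exact this.symm
  have f2 : ∀ i, 1 ≤ i → i ≤ m - 2 → ∀ x, g (i+2) x - g 3 x ∈ E := by
    intro i a b x
    have := k2 i a b x
    rw [e2 i 1 a b le_rfl (by omega), k2 1 le_rfl (by omega)] at this
    exact (Submodule.Quotient.eq E).1 this.symm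
  refine h.all_eq 5 (by omega) (by omega) ?_
  have z : ∀ i j, 1 ≤ i → i ≤ m - 2 → 1 ≤ j → j ≤ m-2 → (g (i+2) - g 3) * (g (j+2) - g 3) = 0 := by
    intro i j a b c d
    ext x
    have := f1 i a b _ (f2 j c d x)
    simp only [Module.End.mul_apply, LinearMap.sub_apply, LinearMap.zero_apply]
    rw [this, sub_self]
  have z1 := z 3 4 (by omega) (by omega) (by omega) (by omega)
  have z2 := z 4 3 (by omega) (by omega) (by omega) (by omega)
  have c1 := h.2.1 3 5 (by omega) (by omega) (by omega)
  have c2 := h.2.1 3 6 (by omega) (by omega) (by omega)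
  simp only [sub_mul, mul_sub, Nat.reduceAdd] at z1 z2 c1 c2 ⊢
  have : g 5 * g 6 - g 6 * g 5 = 0 := by
    calc g 5 * g 6 - g 6 * g 5 = (g 5 * g 6 - g 3 * g 6 - (g 5 * g 3 - g 3 * g 3)) - (g 6 * g 5 - g 3 * g 5 - (g 6 * g 3 - g 3 * g 3)) := by
          rw [c1, c2]; abel
      _ = 0 := by rw [z1, z2]; simp
  exact sub_eq_zero.1 this

lemma eq_on_sub {m : ℕ} (hm : 6 ≤ m) {g : ℕ → Module.End ℂ U} (h : BrChain m g) (W : Submodule ℂ U)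
    (hd : Module.finrank ℂ W ≤ 3)
    (hW : ∀ i, 1 ≤ i → i ≤ m → ∀ x ∈ W, g i x ∈ W) :
    ∀ i j, 1 ≤ i → i ≤ m → 1 ≤ j → j ≤ m → ∀ x ∈ W, g i x = g j x := by
  intro i j a b c d x hx
  obtain ⟨g1, hg1, k1⟩ := h.sub W hW
  have := k1 i a b ⟨x, hx⟩
  rw [eq_dim3 hd hm hg1 i j a b c d, k1 j c d] at this
  exact this.symm

/-- final contradiction in `End U` -/
lemma final_U (hd : Module.finrank ℂ U = 3) (p t q : Module.End ℂ U)
    (h1 : p * (1 - p) = 0) (h2 : q * (1 + t + q * p) = 0)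
    (h3 : q * (1 - p) = t * (1 + t + q * p)) (h4 : t * (1 - p) = p * (1 + t + q * p))
    (h5 : (1 - p) * q = t * (1 + t) + p * q * t)
    (hirr : ∀ W : Submodule ℂ U, (∀ x ∈ W, p x ∈ W) → (∀ x ∈ W, t x ∈ W) → (∀ x ∈ W, q x ∈ W) → W = ⊥ ∨ W = ⊤) :
    False := by
  have hnt : Nontrivial U := Module.nontrivial_of_finrank_pos (R := ℂ) (by omega)
  have hpp : p * p = p := by rw [mul_sub, mul_one, sub_eq_zero] at h1; exact h1.symm
  have pair : ∀ v w : U, v ≠ 0 → Submodule.span ℂ {v, w} ≠ ⊥ ∧ Submodule.span ℂ {v, w} ≠ ⊤ := by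
    intro v w hv
    constructor
    · intro hb
      apply hv
      have : v ∈ Submodule.span ℂ {v, w} := Submodule.subset_span (by simp)
      rwa [hb, Submodule.mem_bot] at this
    · intro ht
      classical
      have := finrank_span_le_card (R := ℂ) ({v, w} : Set U)
      rw [ht, finrank_top, hd] at this
      have h2 : ({v, w} : Set U).toFinset.card ≤ 2 := by
        simp only [Set.toFinset_insert, Set.toFinset_singleton]
        exact Finset.card_le_two
      omega
  -- N
  set N := (1 + t + q) * p with hN
  have pN : p * N = 0 := by
    calc p * N = p * (1 + t + q * p) * p := by rw [hN]; simp only [mul_add, add_mul, mul_one, mul_assoc, hpp, one_mul]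
      _ = 0 := by rw [← h4, mul_assoc, sub_mul, one_mul, hpp]; simp
  have tN : t * N = 0 := by
    calc t * N = t * (1 + t + q * p) * p := by rw [hN]; simp only [mul_add, add_mul, mul_one, mul_assoc, hpp, one_mul]
      _ = 0 := by rw [← h3, mul_assoc, sub_mul, one_mul, hpp]; simp
  have qN : q * N = 0 := by
    calc q * N = q * (1 + t + q * p) * p := by rw [hN]; simp only [mul_add, add_mul, mul_one, mul_assoc, hpp, one_mul]
      _ = 0 := by rw [h2]; simp
  have N0 : N = 0 := by
    have ap : ∀ {a : Module.End ℂ U}, a * N = 0 → ∀ x ∈ LinearMap.range N, a x = 0 := by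
      rintro a ha _ ⟨y, rfl⟩
      exact LinearMap.congr_fun ha y
    rcases hirr (LinearMap.range N) (fun x hx => by rw [ap pN x hx]; simp) (fun x hx => by rw [ap tN x hx]; simp)
      (fun x hx => by rw [ap qN x hx]; simp) with h | h
    · exact LinearMap.range_eq_bot.1 h
    · exfalso
      obtain ⟨v, hv⟩ := exists_ne (0 : U)
      have := pair v v hv
      rcases hirr (Submodule.span ℂ {v, v}) (fun x _ => by rw [ap pN x (by rw [h]; trivial)]; simp) (fun x _ => by rw [ap tN x (by rw [h]; trivial)]; simp)
        (fun x _ => by rw [ap qN x (by rw [h]; trivial)]; simp) with h | h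
      · exact this.1 h
      · exact this.2 h
  have hqp : q * p = - (p + t * p) := by
    rw [hN] at N0
    rw [eq_neg_iff_add_eq_zero, ← N0]; noncomm_ring
  have hq : q = -(p + t * p) + t * (1 + t + -(p + t * p)) := by
    calc q = q * p + q * (1 - p) := by noncomm_ring
      _ = _ := by rw [h3, hqp]
  have irr2 : ∀ W : Submodule ℂ U, (∀ x ∈ W, p x ∈ W) → (∀ x ∈ W, t x ∈ W) → W = ⊥ ∨ W = ⊤ := by
    intro W hp ht
    refine hirr W hp ht fun x hx => ?_
    rw [hq]
    simp only [LinearMap.add_apply, LinearMap.neg_apply, Module.End.mul_apply, Module.End.one_apply]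
    have a := hp x hx
    have b := ht _ a
    have c := ht _ hx
    exact W.add_mem (W.neg_mem (W.add_mem a b)) (ht _ (W.add_mem (W.add_mem hx c) (W.neg_mem (W.add_mem a b))))
  have two : ∀ v w : U, v ≠ 0 → p v ∈ Submodule.span ℂ {v, w} → p w ∈ Submodule.span ℂ {v, w} →
      t v ∈ Submodule.span ℂ {v, w} → t w ∈ Submodule.span ℂ {v, w} → False := by
    intro v w hv a b c d
    have := pair v w hv
    have inv : ∀ f : Module.End ℂ U, f v ∈ Submodule.span ℂ {v, w} → f w ∈ Submodule.span ℂ {v, w} →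
        ∀ x ∈ Submodule.span ℂ {v, w}, f x ∈ Submodule.span ℂ {v, w} := by
      intro f e1 e2 x hx
      obtain ⟨s, u, rfl⟩ := Submodule.mem_span_pair.1 hx
      rw [map_add, map_smul, map_smul]
      exact Submodule.add_mem _ (Submodule.smul_mem _ _ e1) (Submodule.smul_mem _ _ e2)
    rcases irr2 _ (inv p a b) (inv t c d) with h | h
    · exact this.1 h
    · exact this.2 h
  -- (1-p) t (1-p) = 0
  have h6 : t - t * p = p * t - p * t * p := by
    have : t * (1 - p) = p * (t * (1 - p)) := by
      conv_rhs => rw [h4, ← mul_assoc, hpp, ← h4]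
    simpa [mul_sub, mul_assoc] using this
  have h7 : (1 - p) * (t * p + t * p + t * (t * p)) = 0 := by
    have := congrArg (fun x => (1 - p) * x * p) h5
    have e0 : (1 - p) * p = 0 := by rw [sub_mul, one_mul, hpp, sub_self]
    have e1 : (1 - p) * (1 - p) = 1 - p := by rw [mul_sub, e0]; simp
    have l : (1 - p) * ((1 - p) * q) * p = -((1-p) * (t * p)) := by
      rw [← mul_assoc, e1, mul_assoc, hqp, mul_neg, mul_add, e0, zero_add]
    have r : (1 - p) * (t * (1 + t) + p * q * t) * p = (1 - p) * (t * p + t * (t * p)) := by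
      rw [mul_add, show (1 - p) * (p * q * t) = ((1 - p) * p) * q * t by noncomm_ring, e0]
      noncomm_ring
    replace this := (l.symm.trans this).trans r
    rw [add_assoc, mul_add, ← this]; simp
  have h7' : ∀ x, p x = x → p (t x + t x + t (t x)) = t x + t x + t (t x) := by
    intro x hx
    have := LinearMap.congr_fun h7 x
    simp only [Module.End.mul_apply, LinearMap.sub_apply, LinearMap.add_apply, Module.End.one_apply, hx, LinearMap.zero_apply] at this
    exact (sub_eq_zero.1 this).symm
  have h6' : ∀ x, p x = 0 → p (t x) = t x := by
    intro x hx
    have := LinearMap.congr_fun h6 x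
    simpa [hx] using this.symm
  have hpp' : ∀ x, p (p x) = p x := fun x => LinearMap.congr_fun hpp x
  let X : Submodule ℂ U := LinearMap.ker (p - 1) ⊓ LinearMap.ker ((p - 1) * t)
  have hX : ∀ x, x ∈ X ↔ p x = x ∧ p (t x) = t x := by
    intro x
    simp [X, sub_eq_zero]
  rcases irr2 X (by
      intro x hx; rw [((hX x).1 hx).1]; exact hx) (by
      intro x hx
      obtain ⟨a, b⟩ := (hX x).1 hx
      refine (hX _).2 ⟨b, ?_⟩
      have := h7' x a
      rw [map_add, map_add, b] at this
      exact add_left_cancel this) with h | h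
  · -- X = 0
    have y0 : ∀ x, p x = x → p (t x) = -(x + x) := by
      intro x hx
      have hy : x + x + p (t x) ∈ X := by
        refine (hX _).2 ⟨by simp [hx, hpp'], ?_⟩
        have a := h6' (t x - p (t x)) (by simp [hpp'])
        have b := h7' x hx
        have : t (x + x + p (t x)) = (t x + t x + t (t x)) - t (t x - p (t x)) := by
          simp only [map_add, map_sub]; abel
        rw [this, map_sub, a, b]
      rw [h, Submodule.mem_bot] at hy
      rw [eq_neg_iff_add_eq_zero, add_comm]; exact hy
    by_cases hp0 : p = 0
    · obtain ⟨v, hv⟩ := exists_ne (0 : U)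
      have : ∀ x, t x = 0 := fun x => by
        have := h6' x (by simp [hp0])
        simpa [hp0] using this.symm
      exact two v v hv (by simp [hp0]) (by simp [hp0]) (by simp [this]) (by simp [this])
    · have hR : Nontrivial (LinearMap.range p) := by
        rw [Submodule.nontrivial_iff_ne_bot]
        intro hb; exact hp0 (LinearMap.range_eq_bot.1 hb)
      let f : Module.End ℂ (LinearMap.range p) := (p.rangeRestrict ∘ₗ t ∘ₗ t) ∘ₗ (LinearMap.range p).subtype
      obtain ⟨μ, hμ⟩ := Module.End.exists_eigenvalue f
      obtain ⟨⟨v, hvr⟩, hv⟩ := hμ.exists_hasEigenvector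
      have hv0 : v ≠ 0 := fun h => hv.2 (Subtype.ext h)
      have hfv : p (t (t v)) = μ • v := congrArg Subtype.val (Module.End.mem_eigenspace_iff.1 hv.1)
      have hpv : p v = v := by obtain ⟨y, rfl⟩ := hvr; exact hpp' y
      have ptv := y0 v hpv
      have mv : v ∈ Submodule.span ℂ {v, t v} := Submodule.subset_span (by simp)
      have mtv : t v ∈ Submodule.span ℂ {v, t v} := Submodule.subset_span (by simp)
      refine two v (t v) hv0 (by rw [hpv]; exact mv) ?_ mtv ?_
      · rw [ptv]; exact Submodule.neg_mem _ (Submodule.add_mem _ mv mv)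
      · have a := h6' (t v - p (t v)) (by simp [hpp'])
        rw [ptv] at a
        simp only [sub_neg_eq_add, map_add, hfv, ptv] at a
        have : t (t v) = (μ • v + (-(v+v) + -(v+v))) - (t v + t v) := by
          rw [a]; abel
        rw [this]
        have m2 := Submodule.neg_mem _ (Submodule.add_mem _ mv mv)
        exact Submodule.sub_mem _ (Submodule.add_mem _ (Submodule.smul_mem _ _ mv) (Submodule.add_mem _ m2 m2)) (Submodule.add_mem _ mtv mtv)
  · have hp1 : ∀ x, p x = x := fun x => ((hX x).1 (by rw [h]; trivial)).1
    obtain ⟨μ, hμ⟩ := Module.End.exists_eigenvalue t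
    obtain ⟨v, hv⟩ := hμ.exists_hasEigenvector
    have mv : v ∈ Submodule.span ℂ {v, v} := Submodule.subset_span (by simp)
    have tv := Module.End.mem_eigenspace_iff.1 hv.1
    exact two v v hv.2 (by rw [hp1]; exact mv) (by rw [hp1]; exact mv) (by rw [tv]; exact Submodule.smul_mem _ _ mv) (by rw [tv]; exact Submodule.smul_mem _ _ mv)


lemma conj_step {m : ℕ} {g : ℕ → Module.End ℂ U} (h : BrChain m g) (i : ℕ) (hi : 1 ≤ i) (him : i + 1 ≤ m) :
    (g i * g (i+1)) * (g i - 1) = (g (i+1) - 1) * (g i * g (i+1)) := by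
  rw [mul_sub, sub_mul, h.2.2 i hi him, mul_one, one_mul, mul_assoc]

lemma A_comm {m : ℕ} {g : ℕ → Module.End ℂ U} (h : BrChain m g) (i j : ℕ) (hi : 1 ≤ i) (him : i ≤ m)
    (hj : 1 ≤ j) (hjm : j ≤ m) (hij : i ≠ j + 1) (hji : j ≠ i + 1) :
    (g i - 1) * (g j - 1) = (g j - 1) * (g i - 1) := by
  have : g i * g j = g j * g i := by
    rcases lt_trichotomy i j with hlt | rfl | hlt
    · exact h.2.1 i j hi (by omega) hjm
    · rfl
    · exact (h.2.1 j i hj (by omega) him).symm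
  simp only [mul_sub, sub_mul, mul_one, one_mul, this]
  abel

/-- distant products vanish -/
lemma far_zero {m : ℕ} (hm : 9 ≤ m) {g : ℕ → Module.End ℂ U} (h : BrChain m g)
    (hirr : ∀ W : Submodule ℂ U, (∀ i, 1 ≤ i → i ≤ m → ∀ v ∈ W, g i v ∈ W) → W = ⊥ ∨ W = ⊤)
    (hr : ∀ i, 1 ≤ i → i ≤ m → Module.finrank ℂ (LinearMap.range (g i - 1)) = 3) :
    ∀ i j, 1 ≤ i → i + 2 ≤ j → j ≤ m → (g i - 1) * (g j - 1) = 0 := by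
  have inv : ∀ i j, 1 ≤ i → i ≤ m → 1 ≤ j → j ≤ m → i ≠ j + 1 → j ≠ i + 1 →
      ∀ x ∈ LinearMap.range (g i - 1), g j x ∈ LinearMap.range (g i - 1) := by
    rintro i j a b c d e f _ ⟨y, rfl⟩
    have := LinearMap.congr_fun (A_comm h i j a b c d e f) y
    refine ⟨g j y, ?_⟩
    simp only [Module.End.mul_apply, LinearMap.sub_apply, Module.End.one_apply, map_sub] at this ⊢
    have h5 := sub_eq_zero.2 this
    rw [← sub_eq_zero, ← h5]
    abel
  -- on range A_1
  have r1 : ∀ j, 3 ≤ j → j ≤ m → (g j - 1) * (g 1 - 1) = (g m - 1) * (g 1 - 1) := by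
    intro j a b
    have hs := h.shift 2 (m-2) (by omega)
    have := eq_on_sub (by omega) hs (LinearMap.range (g 1 - 1)) (hr 1 le_rfl (by omega)).le
      (fun i c d => inv 1 (i+2) (by omega) (by omega) (by omega) (by omega) (by omega) (by omega)) (j-2) (m-2) (by omega) (by omega) (by omega) (by omega)
    rw [Nat.sub_add_cancel (by omega : 2 ≤ j), Nat.sub_add_cancel (by omega : 2 ≤ m)] at this
    refine LinearMap.ext fun x => ?_
    have := this ((g 1 - 1) x) ⟨x, rfl⟩
    rw [Module.End.mul_apply, Module.End.mul_apply, LinearMap.sub_apply, LinearMap.sub_apply (g m), this]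
  have r2 : ∀ j, 1 ≤ j → j + 2 ≤ m → (g j - 1) * (g m - 1) = (g 1 - 1) * (g m - 1) := by
    intro j a b
    have hs := h.shift 0 (m-2) (by omega)
    have := eq_on_sub (by omega) hs (LinearMap.range (g m - 1)) (hr m (by omega) (by omega)).le
      (fun i c d => inv m (i) (by omega) (by omega) (by omega) (by omega) (by omega) (by omega)) j 1 (by omega) (by omega) (by omega) (by omega)
    refine LinearMap.ext fun x => ?_
    have := this ((g m - 1) x) ⟨x, rfl⟩
    simp only [add_zero] at this
    rw [Module.End.mul_apply, Module.End.mul_apply, LinearMap.sub_apply, LinearMap.sub_apply (g 1), this]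
  set A : ℕ → Module.End ℂ U := fun i => g i - 1 with hA
  have comm : ∀ i j, 1 ≤ i → i ≤ m → 1 ≤ j → j ≤ m → i ≠ j + 1 → j ≠ i + 1 → A i * A j = A j * A i :=
    fun i j a b c d e f => A_comm h i j a b c d e f
  change ∀ j, 3 ≤ j → j ≤ m → A j * A 1 = A m * A 1 at r1
  change ∀ j, 1 ≤ j → j + 2 ≤ m → A j * A m = A 1 * A m at r2
  have mul3 : ∀ a b c : Module.End ℂ U, c * a = a * c → c * b = b * c → c * (a * b) = (a * b) * c := by
    intro a b c h1 h2
    rw [← mul_assoc, h1, mul_assoc, h2, mul_assoc]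
  have PC : ∀ k, 1 ≤ k → k ≤ m → A k * (A m * A 1) = (A m * A 1) * A k := by
    intro k a b
    by_cases k2 : k = 2
    · subst k2
      rw [comm m 1 (by omega) le_rfl le_rfl (by omega) (by omega) (by omega), ← r2 4 (by omega) (by omega)]
      exact mul3 _ _ _ (comm _ _ (by omega) (by omega) (by omega) (by omega) (by omega) (by omega)) (comm _ _ (by omega) (by omega) (by omega) (by omega) (by omega) (by omega))
    by_cases k3 : k = m - 1
    · rw [← r1 (m-3) (by omega) (by omega)]
      exact mul3 _ _ _ (comm _ _ (by omega) (by omega) (by omega) (by omega) (by omega) (by omega)) (comm _ _ (by omega) (by omega) (by omega) (by omega) (by omega) (by omega))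
    exact mul3 _ _ _ (comm _ _ (by omega) (by omega) (by omega) (by omega) (by omega) (by omega)) (comm _ _ (by omega) (by omega) (by omega) (by omega) (by omega) (by omega))
  have P0 : A m * A 1 = 0 := by
    rcases hirr (LinearMap.range (A m * A 1)) (by
      rintro i a b _ ⟨y, rfl⟩
      have := LinearMap.congr_fun (PC i a b) y
      have e : g i ((A m * A 1) y) = A i ((A m * A 1) y) + (A m * A 1) y := by simp [hA]
      rw [e]
      refine Submodule.add_mem _ ⟨A i y, this.symm⟩ ⟨y, rfl⟩) with hb | ht
    · exact LinearMap.range_eq_bot.1 hb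
    · exfalso
      have hle : LinearMap.range (A m * A 1) ≤ LinearMap.range (A m) := by
        rintro _ ⟨y, rfl⟩; exact ⟨_, rfl⟩
      have htop : LinearMap.range (A m) = ⊤ := top_le_iff.1 (ht ▸ hle)
      have hU : Module.finrank ℂ U = 3 := by
        rw [← hr m (by omega) le_rfl]
        change _ = Module.finrank ℂ (LinearMap.range (A m))
        rw [htop, finrank_top]
      have hall := eq_dim3 hU.le (by omega) h
      have hnt : Nontrivial U := Module.nontrivial_of_finrank_pos (R := ℂ) (by omega)
      obtain ⟨c, hc⟩ := Module.End.exists_eigenvalue (g 1)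
      obtain ⟨v, hv⟩ := hc.exists_hasEigenvector
      have hgv := Module.End.mem_eigenspace_iff.1 hv.1
      rcases hirr (Submodule.span ℂ {v}) (by
        intro i a b x hx
        rw [hall i 1 a b le_rfl (by omega)]
        obtain ⟨s, rfl⟩ := Submodule.mem_span_singleton.1 hx
        rw [map_smul, hgv]
        exact Submodule.smul_mem _ _ (Submodule.smul_mem _ _ (Submodule.mem_span_singleton_self v))) with h1 | h1
      · exact hv.2 (Submodule.span_singleton_eq_bot.1 h1)
      · have := finrank_span_singleton (K := ℂ) hv.2
        rw [h1, finrank_top] at this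
        omega
  intro i j hi hij hj
  induction i, hi using Nat.le_induction with
  | base =>
    change A 1 * A j = 0
    rw [comm 1 j le_rfl (by omega) (by omega) hj (by omega) (by omega), r1 j hij hj, P0]
  | succ i hi ih =>
    have ih := ih (by omega)
    have hu : IsUnit (g i * g (i+1)) := (h.1 i hi (by omega)).mul (h.1 (i+1) (by omega) (by omega))
    apply hu.mul_right_cancel
    have c1 := h.2.1 i j hi (by omega) hj
    have c2 := h.2.1 (i+1) j (by omega) (by omega) hj
    have c3 : (g j - 1) * (g i * g (i+1)) = (g i * g (i+1)) * (g j - 1) := by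
      rw [sub_mul, mul_sub, ← mul_assoc, ← c1, mul_assoc, ← c2, mul_assoc]; simp
    rw [mul_assoc, c3, ← mul_assoc, ← conj_step h i hi (by omega), mul_assoc, ih]; simp

def GG (g : ℕ → Module.End ℂ U) : ℕ → Module.End ℂ U
  | 0 => 1
  | k+1 => g (k+1) * g (k+2) * GG g k

lemma GG_unit {m : ℕ} {g : ℕ → Module.End ℂ U} (h : BrChain m g) : ∀ k, k + 1 ≤ m → IsUnit (GG g k)
  | 0, _ => isUnit_one
  | k+1, hk => ((h.1 _ (by omega) (by omega)).mul (h.1 _ (by omega) (by omega))).mul (GG_unit h k (by omega))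

lemma GG_conj {m : ℕ} {g : ℕ → Module.End ℂ U} (h : BrChain m g) (k : ℕ) (hk : k + 1 ≤ m) :
    (g (k+1) - 1) * GG g k = GG g k * (g 1 - 1) := by
  induction k with
  | zero => simp [GG]
  | succ k ih =>
    have := conj_step h (k+1) (by omega) (by omega)
    rw [GG, ← mul_assoc, ← this, mul_assoc, ih (by omega), mul_assoc, mul_assoc, mul_assoc]

lemma main_V {m : ℕ} (hm : 9 ≤ m) {g : ℕ → Module.End ℂ U} (h : BrChain m g)
    (hirr : ∀ W : Submodule ℂ U, (∀ i, 1 ≤ i → i ≤ m → ∀ v ∈ W, g i v ∈ W) → W = ⊥ ∨ W = ⊤)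
    (hr : ∀ i, 1 ≤ i → i ≤ m → Module.finrank ℂ (LinearMap.range (g i - 1)) = 3) : False := by
  have far := far_zero hm h hirr hr
  have far' : ∀ i j, 1 ≤ i → i ≤ m → 1 ≤ j → j ≤ m → i ≠ j → i ≠ j + 1 → j ≠ i + 1 → (g i - 1) * (g j - 1) = 0 := by
    intro i j a b c d e f k
    rcases lt_or_gt_of_ne e with hlt | hlt
    · exact far i j a (by omega) d
    · rw [A_comm h i j a b c d f k]; exact far j i c (by omega) b
  set A : ℕ → Module.End ℂ U := fun i => g i - 1 with hA
  have gA : ∀ i x, g i x = x + A i x := by intro i x; simp [hA]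
  set V := LinearMap.range (A 1) with hV
  set ψ : ℕ → V →ₗ[ℂ] U := fun k => GG g k ∘ₗ V.subtype with hψ
  have ψ0 : ∀ u : V, ψ 0 u = u := fun u => rfl
  have ψs : ∀ k u, ψ (k+1) u = g (k+1) (g (k+2) (ψ k u)) := fun k u => rfl
  have ψinj : ∀ k, k + 1 ≤ m → Function.Injective (ψ k) := by
    intro k hk x y hxy
    have := LinearMap.ker_eq_bot.1 ((LinearMap.isUnit_iff_ker_eq_bot _).1 (GG_unit h k hk)) hxy
    exact Subtype.ext this
  have ψfar : ∀ k j u, k + 1 ≤ m → 1 ≤ j → j ≤ m → j ≠ k + 1 → j ≠ k + 2 → j ≠ k → A j (ψ k u) = 0 := by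
    rintro k j ⟨u, y, rfl⟩ a b c d e f
    have h1 : ψ k ⟨A 1 y, ⟨y, rfl⟩⟩ = A (k+1) (GG g k y) := (LinearMap.congr_fun (GG_conj h k a) y).symm
    rw [h1]
    exact LinearMap.congr_fun (far' j (k+1) b c (by omega) a d (by omega) (by omega)) _
  obtain ⟨hinv, hinv1⟩ := (GG_unit h 1 (by omega)).exists_right_inv
  set t : Module.End ℂ V := (A 1).rangeRestrict ∘ₗ V.subtype with ht
  set p : Module.End ℂ V := (A 1).rangeRestrict ∘ₗ hinv ∘ₗ V.subtype with hp
  set q : Module.End ℂ V := (A 1).rangeRestrict ∘ₗ GG g 1 ∘ₗ V.subtype with hq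
  have At : ∀ k u, k + 1 ≤ m → A (k+1) (ψ k u) = ψ k (t u) := by
    intro k u hk
    exact LinearMap.congr_fun (GG_conj h k hk) u
  -- three-term shift
  have conj3 : ∀ k, k + 3 ≤ m → ∀ x, A (k+3) (g (k+1) (g (k+2) (g (k+3) x))) = g (k+1) (g (k+2) (g (k+3) (A (k+2) x))) := by
    intro k hk x
    have c1 := LinearMap.congr_fun (conj_step h (k+2) (by omega) (by omega)) x
    have c2 := A_comm h (k+1) (k+3) (by omega) (by omega) (by omega) (by omega) (by omega) (by omega)
    have c3 := LinearMap.congr_fun c2 (g (k+2) (g (k+3) x))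
    change A (k+1) (A (k+3) _) = A (k+3) (A (k+1) _) at c3
    change g (k+2) (g (k+3) (A (k+2) x)) = A (k+3) (g (k+2) (g (k+3) x)) at c1
    rw [c1, gA (k+1), gA (k+1), map_add, c3]
  have conj3' : ∀ k, k + 3 ≤ m → ∀ x, A (k+2) (g (k+1) (g (k+2) (g (k+3) x))) = g (k+1) (g (k+2) (g (k+3) (A (k+1) x))) := by
    intro k hk x
    have c1 := LinearMap.congr_fun (conj_step h (k+1) (by omega) (by omega)) (g (k+3) x)
    have c2 := A_comm h (k+1) (k+3) (by omega) (by omega) (by omega) (by omega) (by omega) (by omega)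
    have c3 := LinearMap.congr_fun c2 x
    change A (k+1) (A (k+3) _) = A (k+3) (A (k+1) _) at c3
    change g (k+1) (g (k+2) (A (k+1) (g (k+3) x))) = A (k+2) (g (k+1) (g (k+2) (g (k+3) x))) at c1
    rw [← c1, gA (k+3) x, gA (k+3), map_add (A (k+1)), c3]
  have s1 : ∀ k u, k + 3 ≤ m → g (k+1) (g (k+2) (g (k+3) (ψ k u))) = ψ (k+1) u := by
    intro k u hk
    rw [ψs, gA (k+3), ψfar k (k+3) u (by omega) (by omega) hk (by omega) (by omega) (by omega), add_zero]
  have s2 : ∀ k u, k + 3 ≤ m → g (k+1) (g (k+2) (g (k+3) (ψ (k+1) u))) = ψ (k+2) u := by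
    intro k u hk
    have := ψs (k+1) u
    rw [show g (k+2) (g (k+3) (ψ (k+1) u)) = ψ (k+2) u from this.symm, gA (k+1),
      ψfar (k+2) (k+1) u (by omega) (by omega) (by omega) (by omega) (by omega) (by omega), add_zero]
  have Ap : ∀ k u, k + 2 ≤ m → A (k+2) (ψ k u) = ψ (k+1) (p u) := by
    intro k u hk
    induction k with
    | zero =>
      have e := LinearMap.congr_fun (GG_conj h 1 (by omega)) (hinv u)
      have e2 := LinearMap.congr_fun hinv1 (u : U)
      change A 2 (GG g 1 (hinv u)) = ψ 1 (p u) at e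
      change GG g 1 (hinv u) = u at e2
      rw [e2] at e
      exact e
    | succ k ih =>
      rw [← s1 k u (by omega), conj3 k (by omega), ih (by omega), s2 k _ (by omega)]
  have Aq : ∀ k u, k + 2 ≤ m → A (k+1) (ψ (k+1) u) = ψ k (q u) := by
    intro k u hk
    induction k with
    | zero => rfl
    | succ k ih =>
      rw [← s2 k u (by omega), conj3' k (by omega), ih (by omega), s1 k _ (by omega)]
  -- relation R0
  have R0 : ∀ k u, k + 2 ≤ m → ψ (k+1) (u - p u) = ψ k (u + t u + q (p u)) := by
    intro k u hk
    rw [map_sub, ψs, gA (k+2), Ap k u hk, gA (k+1), map_add, At k u (by omega), Aq k _ hk]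
    simp only [map_add]
    abel
  refine final_U (hr 1 le_rfl (by omega)) p t q ?_ ?_ ?_ ?_ ?_ ?_
  · refine LinearMap.ext fun u => ψinj 2 (by omega) ?_
    have := congrArg (A 3) (R0 0 u (by omega))
    rw [Ap 1 _ (by omega), ψfar 0 3 _ (by omega) (by omega) (by omega) (by omega) (by omega) (by omega)] at this
    simpa using this
  · refine LinearMap.ext fun u => ψinj 0 (by omega) ?_
    have := congrArg (A 1) (R0 1 u (by omega))
    rw [Aq 0 _ (by omega), ψfar 2 1 _ (by omega) (by omega) (by omega) (by omega) (by omega) (by omega)] at this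
    simpa using this.symm
  · refine LinearMap.ext fun u => ψinj 0 (by omega) ?_
    have := congrArg (A 1) (R0 0 u (by omega))
    rw [Aq 0 _ (by omega), At 0 _ (by omega)] at this
    exact this
  · refine LinearMap.ext fun u => ψinj 1 (by omega) ?_
    have := congrArg (A 2) (R0 0 u (by omega))
    rw [Ap 0 _ (by omega), At 1 _ (by omega)] at this
    exact this
  · refine LinearMap.ext fun u => ψinj 1 (by omega) ?_
    have b := h.2.2 1 le_rfl (by omega)
    have b' : A 1 + A 1 * A 1 + A 1 * (A 2 * A 1) = A 2 + A 2 * A 2 + A 2 * (A 1 * A 2) := by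
      have e : ∀ a b : Module.End ℂ U, (a - 1) + (a - 1) * (a - 1) + (a - 1) * ((b - 1) * (a - 1)) = a * b * a - a * b - b * a + a + b - 1 := by
        intro a b; noncomm_ring
      simp only [hA]
      rw [e, e, b]; noncomm_ring
    have b2 := LinearMap.congr_fun b' (ψ 1 u)
    simp only [LinearMap.add_apply, Module.End.mul_apply] at b2
    rw [Aq 0 _ (by omega), At 0 _ (by omega), Ap 0 _ (by omega), Aq 0 _ (by omega), At 1 _ (by omega), At 1 _ (by omega), Aq 0 _ (by omega), Ap 0 _ (by omega)] at b2
    have r := R0 0 (q u) (by omega)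
    simp only [map_add] at r
    rw [b2] at r
    simp only [Module.End.mul_apply, LinearMap.sub_apply, LinearMap.add_apply, Module.End.one_apply, map_add]
    exact r
  · intro W hWp hWt hWq
    set S : Submodule ℂ U := ⨆ k : Fin m, W.map (ψ k) with hS
    have mem : ∀ k, k < m → ∀ w ∈ W, ψ k w ∈ S := by
      intro k hk w hw
      exact (le_iSup (fun k : Fin m => W.map (ψ k)) ⟨k, hk⟩) ⟨w, hw, rfl⟩
    have hSinv : ∀ i, 1 ≤ i → i ≤ m → S ≤ S.comap (A i) := by
      intro i a b
      refine iSup_le fun k => ?_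
      rintro _ ⟨w, hw, rfl⟩
      obtain ⟨k, hk⟩ := k
      change A i (ψ k w) ∈ S
      by_cases e1 : i = k + 1
      · subst e1; rw [At k w (by omega)]; exact mem k hk _ (hWt w hw)
      by_cases e2 : i = k + 2
      · subst e2; rw [Ap k w (by omega)]; exact mem _ (by omega) _ (hWp w hw)
      by_cases e3 : i = k
      · obtain ⟨k, rfl⟩ : ∃ l, k = l + 1 := ⟨k - 1, by omega⟩
        subst e3; rw [Aq k w (by omega)]; exact mem _ (by omega) _ (hWq w hw)
      · rw [ψfar k i w (by omega) a b e1 e2 e3]; exact S.zero_mem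
    rcases hirr S (fun i a b v hv => by rw [gA]; exact S.add_mem hv (hSinv i a b hv)) with hb | htop
    · left
      rw [eq_bot_iff]
      intro w hw
      have := mem 0 (by omega) w hw
      rw [hb, Submodule.mem_bot, ψ0] at this
      exact Subtype.ext this
    · right
      rw [eq_top_iff]
      have hle : S ≤ (W.map V.subtype).comap (A 1) := by
        refine iSup_le fun k => ?_
        rintro _ ⟨w, hw, rfl⟩
        obtain ⟨k, hk⟩ := k
        change A 1 (ψ k w) ∈ W.map V.subtype
        rcases k with _ | _ | k
        · rw [At 0 w (by omega)]; exact ⟨_, hWt w hw, rfl⟩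
        · rw [Aq 0 w (by omega)]; exact ⟨_, hWq w hw, rfl⟩
        · rw [ψfar _ 1 w (by omega) (by omega) (by omega) (by omega) (by omega) (by omega)]; exact Submodule.zero_mem _
      rintro ⟨u, y, rfl⟩ -
      have hy : y ∈ S := by rw [htop]; trivial
      obtain ⟨w, hw, e⟩ := hle hy
      have : w = ⟨A 1 y, ⟨y, rfl⟩⟩ := Subtype.ext e
      rw [← this]; exact hw

end

/-- For `n ≥ 10`, any irreducible representation `C 1, …, C (n-1)` of the braid group
`B_n` in `GL_r(ℂ)` (dimension `r ≥ 1`) satisfies `rank (C i - I) ≠ 3` for all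
`i = 1, …, n-1`. -/
theorem stmt_1 (n r : ℕ) (hn : 10 ≤ n) (hr : 1 ≤ r)
    (C : ℕ → Matrix (Fin r) (Fin r) ℂ)
    (hinv : ∀ i, 1 ≤ i → i ≤ n - 1 → IsUnit (C i))
    (hcomm : ∀ i j, 1 ≤ i → i ≤ n - 1 → 1 ≤ j → j ≤ n - 1 → i + 2 ≤ j →
      C i * C j = C j * C i)
    (hbraid : ∀ i, 1 ≤ i → i ≤ n - 2 →
      C i * C (i + 1) * C i = C (i + 1) * C i * C (i + 1))
    (hirr : ∀ p : Submodule ℂ (Fin r → ℂ),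
      (∀ i, 1 ≤ i → i ≤ n - 1 → ∀ v ∈ p, (C i).mulVec v ∈ p) → p = ⊥ ∨ p = ⊤) :
    ∀ i, 1 ≤ i → i ≤ n - 1 → (C i - 1).rank ≠ 3 := by
  intro i0 hi0 hi0n hrk
  have conj : ∀ i, 1 ≤ i → i + 1 ≤ n - 1 → (C i - 1).rank = (C (i+1) - 1).rank := by
    intro i a b
    have hu : IsUnit (C i * C (i+1)) := (hinv i a (by omega)).mul (hinv _ (by omega) b)
    have hdet := (Matrix.isUnit_iff_isUnit_det _).1 hu
    have e : (C i * C (i+1)) * (C i - 1) = (C (i+1) - 1) * (C i * C (i+1)) := by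
      rw [mul_sub, sub_mul, hbraid i a (by omega), mul_one, one_mul, mul_assoc]
    rw [← Matrix.rank_mul_eq_right_of_isUnit_det _ (C i - 1) hdet, e, Matrix.rank_mul_eq_left_of_isUnit_det _ _ hdet]
  have one : ∀ i, 1 ≤ i → i ≤ n - 1 → (C i - 1).rank = (C 1 - 1).rank := by
    intro i a
    induction i, a using Nat.le_induction with
    | base => intro _; rfl
    | succ i hi ih => intro b; rw [← conj i hi b]; exact ih (by omega)
  have all : ∀ i, 1 ≤ i → i ≤ n - 1 → (C i - 1).rank = 3 := by
    intro i a b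
    rw [one i a b, ← one i0 hi0 hi0n, hrk]
  let f := Matrix.toLinAlgEquiv' (R := ℂ) (n := Fin r)
  have hch : BrChain (n - 1) (fun i => (f (C i) : Module.End ℂ (Fin r → ℂ))) := by
    refine ⟨fun i a b => (hinv i a b).map f, fun i j a b c => ?_, fun i a b => ?_⟩
    · have := congrArg f (hcomm i j a (by omega) (by omega) c b)
      simpa only [map_mul] using this
    · have := congrArg f (hbraid i a (by omega))
      simpa only [map_mul] using this
  refine main_V (by omega) hch (fun W hW => hirr W fun i a b v hv => hW i a b v hv) ?_
  intro i a b
  rw [← all i a b]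
  have : (f (C i) : Module.End ℂ (Fin r → ℂ)) - 1 = f (C i - 1) := by rw [map_sub, map_one]
  rw [this]
  rfl
end

section
/- Let n ≥ 9 and let C_1, …, C_{n−1} ∈ GL_r(ℂ) be an irreducible representation of B_n of dimension r ≥ n+1; set A_i = C_i − I, T = C_1 ⋯ C_{n−1}, A_0 = T C_{n−1} T^{−1} − I, indices in ℤ_n. Suppose rank(A_i) = 3 for all i ∈ ℤ_n. Then Im A_i ∩ Im A_{i+1} = {0} for all i ∈ ℤ_n (indices modulo n). -/
open scoped Pointwise
open Module

/-! ### Group theory of the braid relations -/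

/-- Partial products `c 1 * c 2 * ⋯ * c k`. -/
def braidProd {G : Type*} [Group G] (c : ℕ → G) : ℕ → G
  | 0 => 1
  | k + 1 => braidProd c k * c (k + 1)

section grp

variable {G : Type*} [Group G] (c : ℕ → G) (N : ℕ)

/-- The braid relations for `c 1, …, c N`. -/
structure BraidRel : Prop where
  comm : ∀ i j, 1 ≤ i → i ≤ N → 1 ≤ j → j ≤ N → i + 2 ≤ j → c i * c j = c j * c i
  braid : ∀ i, 1 ≤ i → i + 1 ≤ N → c i * c (i + 1) * c i = c (i + 1) * c i * c (i + 1)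

/-- Independent indices. -/
def Indep (N i j : ℕ) : Prop :=
  1 ≤ i ∧ i ≤ N ∧ 1 ≤ j ∧ j ≤ N ∧ (i + 2 ≤ j ∨ j + 2 ≤ i)

variable {c N}

theorem BraidRel.comm' (h : BraidRel c N) {i j : ℕ} (hij : Indep N i j) :
    c i * c j = c j * c i := by
  obtain ⟨h1, h2, h3, h4, h5 | h5⟩ := hij
  · exact h.comm i j h1 h2 h3 h4 h5
  · exact (h.comm j i h3 h4 h1 h2 h5).symm

theorem BraidRel.prod_comm (h : BraidRel c N) (k j : ℕ) (hj : k + 2 ≤ j) (hjN : j ≤ N) :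
    braidProd c k * c j = c j * braidProd c k := by
  induction k with
  | zero => simp [braidProd]
  | succ k ih =>
    have e := h.comm (k + 1) j (by omega) (by omega) (by omega) hjN (by omega)
    rw [braidProd, mul_assoc, e, ← mul_assoc, ih (by omega), mul_assoc]

theorem BraidRel.prod_shift (h : BraidRel c N) (k j : ℕ) (hj : 1 ≤ j) (hjk : j + 1 ≤ k)
    (hk : k ≤ N) : braidProd c k * c j = c (j + 1) * braidProd c k := by
  induction k with
  | zero => omega
  | succ k ih =>
    by_cases hk' : j + 1 ≤ k
    · have e := h.comm j (k + 1) hj (by omega) (by omega) hk (by omega)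
      rw [braidProd, mul_assoc, ← e, ← mul_assoc, ih hk' (by omega), mul_assoc]
    · obtain rfl : j = k := by omega
      obtain ⟨m, rfl⟩ : ∃ m, j = m + 1 := ⟨j - 1, by omega⟩
      have e := h.braid (m + 1) hj (by omega)
      have e2 := h.prod_comm m (m + 1 + 1) (by omega) hk
      calc braidProd c m * c (m + 1) * c (m + 1 + 1) * c (m + 1)
          = braidProd c m * (c (m + 1) * c (m + 1 + 1) * c (m + 1)) := by group
        _ = (braidProd c m * c (m + 1 + 1)) * c (m + 1) * c (m + 1 + 1) := by rw [e]; group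
        _ = c (m + 1 + 1) * (braidProd c m * c (m + 1) * c (m + 1 + 1)) := by rw [e2]; group

theorem BraidRel.prod_prod (h : BraidRel c N) (m : ℕ) (hm : m + 1 ≤ N) :
    c 1 * braidProd c N * braidProd c m = braidProd c (m + 1) * braidProd c N := by
  induction m with
  | zero => simp [braidProd]
  | succ m ih =>
    have e := h.prod_shift N (m + 1) (by omega) (by omega) le_rfl
    calc c 1 * braidProd c N * (braidProd c m * c (m + 1))
        = (c 1 * braidProd c N * braidProd c m) * c (m + 1) := by group
      _ = braidProd c (m + 1) * (braidProd c N * c (m + 1)) := by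
          rw [ih (by omega), mul_assoc]
      _ = braidProd c (m + 1) * c (m + 1 + 1) * braidProd c N := by rw [e, mul_assoc]

theorem BraidRel.prod_sq (h : BraidRel c N) (hN : 1 ≤ N) :
    braidProd c N * braidProd c N * c N = c 1 * (braidProd c N * braidProd c N) := by
  obtain ⟨m, rfl⟩ : ∃ m, N = m + 1 := ⟨N - 1, by omega⟩
  have e := h.prod_prod m le_rfl
  calc braidProd c (m + 1) * braidProd c (m + 1) * c (m + 1)
      = c 1 * (braidProd c (m + 1) * (braidProd c m * c (m + 1))) := by
        rw [← e]; group
    _ = c 1 * (braidProd c (m + 1) * braidProd c (m + 1)) := rfl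

end grp

/-! ### Images of `g - 1` -/

section lin

variable {K V : Type*} [Field K] [AddCommGroup V] [Module K V]

/-- The image of `g - 1`. -/
def ImSub (g : V ≃ₗ[K] V) : Submodule K V := LinearMap.range ((g : V →ₗ[K] V) - LinearMap.id)

theorem mem_ImSub {g : V ≃ₗ[K] V} {v : V} : v ∈ ImSub g ↔ ∃ w, g w - w = v := by
  simp [ImSub, LinearMap.mem_range]

theorem smul_inf_sub (g : V ≃ₗ[K] V) (p q : Submodule K V) : g • (p ⊓ q) = g • p ⊓ g • q :=
  Submodule.map_inf _ g.injective

theorem finrank_smul_sub (g : V ≃ₗ[K] V) (p : Submodule K V) :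
    finrank K (g • p : Submodule K V) = finrank K p :=
  LinearEquiv.finrank_map_eq g p

theorem ImSub_conj {g g' h : V ≃ₗ[K] V} (e : h * g = g' * h) : h • ImSub g = ImSub g' := by
  ext v
  rw [Submodule.mem_smul_pointwise_iff_exists]
  constructor
  · rintro ⟨w, hw, rfl⟩
    obtain ⟨x, rfl⟩ := mem_ImSub.1 hw
    refine mem_ImSub.2 ⟨h x, ?_⟩
    have := LinearEquiv.congr_fun e x
    simp at this
    simp [this]
  · intro hv
    obtain ⟨x, rfl⟩ := mem_ImSub.1 hv
    refine ⟨g (h.symm x) - h.symm x, mem_ImSub.2 ⟨_, rfl⟩, ?_⟩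
    have := LinearEquiv.congr_fun e (h.symm x)
    simp at this
    simp [this]

/-- If `g` commutes with `h` and `Im (g-1)`, `Im (h-1)` are disjoint then `g` fixes
`Im (h-1)` pointwise. -/
theorem fix_of_disj {g h : V ≃ₗ[K] V} (e : g * h = h * g) (hd : ImSub g ⊓ ImSub h = ⊥)
    {p : Submodule K V} (hp : p ≤ ImSub h) : g • p = p := by
  have key : ∀ v ∈ ImSub h, g v = v := by
    intro v hv
    have h1 : g v - v ∈ ImSub g := mem_ImSub.2 ⟨v, rfl⟩
    have h2 : g v ∈ ImSub h := by
      have := Submodule.smul_mem_pointwise_smul v g _ hv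
      rwa [ImSub_conj e] at this
    have h3 : g v - v ∈ ImSub g ⊓ ImSub h := ⟨h1, sub_mem h2 hv⟩
    rw [hd] at h3
    exact sub_eq_zero.1 ((Submodule.mem_bot K).1 h3)
  ext v
  rw [Submodule.mem_smul_pointwise_iff_exists]
  constructor
  · rintro ⟨w, hw, rfl⟩
    change g w ∈ p
    rwa [key w (hp hw)]
  · intro hv
    exact ⟨v, hv, key v (hp hv)⟩

theorem smul_eq_of_ImSub_le [FiniteDimensional K V] {g : V ≃ₗ[K] V} {p : Submodule K V}
    (hp : ImSub g ≤ p) : g • p = p := by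
  apply Submodule.eq_of_le_of_finrank_eq
  · intro v hv
    obtain ⟨w, hw, rfl⟩ := (Submodule.mem_smul_pointwise_iff_exists _ _ _).1 hv
    change g w ∈ p
    have := add_mem (hp (mem_ImSub.2 ⟨w, rfl⟩)) hw
    simpa using this
  · exact finrank_smul_sub g p

end lin

/-! ### The setting -/

section setting

set_option linter.unusedSectionVars false

variable {K V : Type*} [Field K] [AddCommGroup V] [Module K V] [FiniteDimensional K V]

/-- An irreducible representation of corank three and large dimension. -/
structure Rep3 (c : ℕ → V ≃ₗ[K] V) (N : ℕ) : Prop extends BraidRel c N where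
  irr : ∀ p : Submodule K V, (∀ i, 1 ≤ i → i ≤ N → c i • p = p) → p = ⊥ ∨ p = ⊤
  rank3 : ∀ i, 1 ≤ i → i ≤ N → finrank K (ImSub (c i)) = 3
  big : 8 ≤ N
  dim : N + 2 ≤ finrank K V

variable {c : ℕ → V ≃ₗ[K] V} {N : ℕ}

theorem fr_congr {p q : Submodule K V} (h : p = q) : finrank K p = finrank K q := by rw [h]

theorem Indep.symm {i j : ℕ} (h : Indep N i j) : Indep N j i := by
  unfold Indep at *; omega

theorem BraidRel.smul_indep (h : BraidRel c N) {i j : ℕ} (hij : Indep N i j) :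
    c i • ImSub (c j) = ImSub (c j) := ImSub_conj (h.comm' hij)

theorem smul_self_ImSub (g : V ≃ₗ[K] V) : g • ImSub g = ImSub g := ImSub_conj rfl

theorem BraidRel.smul_step (h : BraidRel c N) {i : ℕ} (h1 : 1 ≤ i) (h2 : i + 1 ≤ N) :
    (c i * c (i + 1)) • ImSub (c i) = ImSub (c (i + 1)) :=
  ImSub_conj (by rw [h.braid i h1 h2, mul_assoc])

/-- Small invariant subspaces vanish. -/
theorem Rep3.eq_bot (h : Rep3 c N) (p : Submodule K V)
    (hp : ∀ i, 1 ≤ i → i ≤ N → c i • p = p) (hd : finrank K p ≤ N + 1) : p = ⊥ := by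
  rcases h.irr p hp with h1 | h1
  · exact h1
  · have := h.dim
    rw [h1, finrank_top] at hd
    omega

theorem BraidRel.move (h : BraidRel c N) (X : Submodule K V) (a b : ℕ) (ha : 1 ≤ a)
    (hab : a ≤ b) (hb : b ≤ N) (hX : ∀ k, a ≤ k → k ≤ b → c k • X = X) :
    finrank K (ImSub (c b) ⊔ X : Submodule K V) = finrank K (ImSub (c a) ⊔ X : Submodule K V) := by
  induction b, hab using Nat.le_induction with
  | base => rfl
  | succ b hab ih =>
    rw [← ih (by omega) (fun k h1 h2 => hX k h1 (by omega)),
      ← finrank_smul_sub (c b * c (b + 1)) (ImSub (c b) ⊔ X), Submodule.smul_sup',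
      h.smul_step (by omega) hb, mul_smul, hX (b + 1) (by omega) le_rfl, hX b hab (by omega)]

/-- `dim (U_1 + U_3)` etc. -/
theorem BraidRel.rho2_sorted (h : BraidRel c N) (i j : ℕ) (h1 : 1 ≤ i) (h2 : i + 2 ≤ j)
    (h3 : j ≤ N) : finrank K (ImSub (c i) ⊔ ImSub (c j) : Submodule K V) =
      finrank K (ImSub (c 1) ⊔ ImSub (c 3) : Submodule K V) := by
  rw [h.move (ImSub (c j)) 1 i le_rfl h1 (by omega)
      (fun k _ _ => h.smul_indep (by unfold Indep; omega)), sup_comm,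
    h.move (ImSub (c 1)) 3 j (by omega) (by omega) (by omega)
      (fun k _ _ => h.smul_indep (by unfold Indep; omega)), sup_comm]

theorem BraidRel.rho3_sorted (h : BraidRel c N) (i j k : ℕ) (h1 : 1 ≤ i) (h2 : i + 2 ≤ j)
    (h3 : j + 2 ≤ k) (h4 : k ≤ N) :
    finrank K (ImSub (c i) ⊔ (ImSub (c j) ⊔ ImSub (c k)) : Submodule K V) =
      finrank K (ImSub (c 1) ⊔ (ImSub (c 3) ⊔ ImSub (c 5)) : Submodule K V) := by
  rw [h.move (ImSub (c j) ⊔ ImSub (c k)) 1 i le_rfl h1 (by omega)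
      (fun l _ _ => by
        rw [Submodule.smul_sup', h.smul_indep (by unfold Indep; omega),
          h.smul_indep (by unfold Indep; omega)]),
    sup_left_comm,
    h.move (ImSub (c 1) ⊔ ImSub (c k)) 3 j (by omega) (by omega) (by omega)
      (fun l _ _ => by
        rw [Submodule.smul_sup', h.smul_indep (by unfold Indep; omega),
          h.smul_indep (by unfold Indep; omega)]),
    sup_left_comm, ← sup_assoc, sup_comm,
    h.move (ImSub (c 1) ⊔ ImSub (c 3)) 5 k (by omega) (by omega) (by omega)
      (fun l _ _ => by
        rw [Submodule.smul_sup', h.smul_indep (by unfold Indep; omega),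
          h.smul_indep (by unfold Indep; omega)]), sup_comm, sup_assoc]

theorem BraidRel.rho4_sorted (h : BraidRel c N) (i j k l : ℕ) (h1 : 1 ≤ i) (h2 : i + 2 ≤ j)
    (h3 : j + 2 ≤ k) (h4 : k + 2 ≤ l) (h5 : l ≤ N) :
    finrank K (ImSub (c i) ⊔ (ImSub (c j) ⊔ (ImSub (c k) ⊔ ImSub (c l))) : Submodule K V) =
      finrank K (ImSub (c 1) ⊔ (ImSub (c 3) ⊔ (ImSub (c 5) ⊔ ImSub (c 7))) :
        Submodule K V) := by
  have inv : ∀ m a b d, Indep N m a → Indep N m b → Indep N m d →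
      c m • (ImSub (c a) ⊔ (ImSub (c b) ⊔ ImSub (c d))) =
        ImSub (c a) ⊔ (ImSub (c b) ⊔ ImSub (c d)) := by
    intro m a b d h1 h2 h3
    rw [Submodule.smul_sup', Submodule.smul_sup', h.smul_indep h1, h.smul_indep h2,
      h.smul_indep h3]
  have e1 := h.move (ImSub (c j) ⊔ (ImSub (c k) ⊔ ImSub (c l))) 1 i le_rfl h1 (by omega)
    (fun m _ _ => inv m _ _ _ (by unfold Indep; omega) (by unfold Indep; omega)
      (by unfold Indep; omega))
  have e2 := h.move (ImSub (c 1) ⊔ (ImSub (c k) ⊔ ImSub (c l))) 3 j (by omega) (by omega)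
    (by omega)
    (fun m _ _ => inv m _ _ _ (by unfold Indep; omega) (by unfold Indep; omega)
      (by unfold Indep; omega))
  have e3 := h.move (ImSub (c 1) ⊔ (ImSub (c 3) ⊔ ImSub (c l))) 5 k (by omega) (by omega)
    (by omega)
    (fun m _ _ => inv m _ _ _ (by unfold Indep; omega) (by unfold Indep; omega)
      (by unfold Indep; omega))
  have e4 := h.move (ImSub (c 1) ⊔ (ImSub (c 3) ⊔ ImSub (c 5))) 7 l (by omega) (by omega)
    (by omega)
    (fun m _ _ => inv m _ _ _ (by unfold Indep; omega) (by unfold Indep; omega)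
      (by unfold Indep; omega))
  exact e1.trans ((fr_congr (by ac_rfl)).trans (e2.trans ((fr_congr (by ac_rfl)).trans
    (e3.trans ((fr_congr (by ac_rfl)).trans (e4.trans (fr_congr (by ac_rfl))))))))

theorem BraidRel.rho2 (h : BraidRel c N) {i j : ℕ} (hij : Indep N i j) :
    finrank K (ImSub (c i) ⊔ ImSub (c j) : Submodule K V) =
      finrank K (ImSub (c 1) ⊔ ImSub (c 3) : Submodule K V) := by
  obtain ⟨_, _, _, _, h5 | h5⟩ := hij
  · exact h.rho2_sorted i j (by omega) h5 (by omega)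
  · rw [sup_comm]; exact h.rho2_sorted j i (by omega) h5 (by omega)

theorem BraidRel.rho3 (h : BraidRel c N) {i j k : ℕ} (hij : Indep N i j) (hik : Indep N i k)
    (hjk : Indep N j k) :
    finrank K (ImSub (c i) ⊔ (ImSub (c j) ⊔ ImSub (c k)) : Submodule K V) =
      finrank K (ImSub (c 1) ⊔ (ImSub (c 3) ⊔ ImSub (c 5)) : Submodule K V) := by
  unfold Indep at *
  wlog h12 : j < k generalizing j k
  · rw [sup_comm (ImSub (c j))]
    exact this hik hij (by omega) (by omega)
  by_cases h1 : i < j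
  · exact h.rho3_sorted i j k (by omega) (by omega) (by omega) (by omega)
  · by_cases h2 : i < k
    · rw [sup_left_comm]
      exact h.rho3_sorted j i k (by omega) (by omega) (by omega) (by omega)
    · rw [sup_comm, sup_assoc]
      exact h.rho3_sorted j k i (by omega) (by omega) (by omega) (by omega)

theorem BraidRel.rho4 (h : BraidRel c N) {i j k l : ℕ} (hij : Indep N i j) (hik : Indep N i k)
    (hjk : Indep N j k) (hil : Indep N i l) (hjl : Indep N j l) (hkl : Indep N k l) :
    finrank K (ImSub (c i) ⊔ (ImSub (c j) ⊔ (ImSub (c k) ⊔ ImSub (c l))) : Submodule K V) =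
      finrank K (ImSub (c 1) ⊔ (ImSub (c 3) ⊔ (ImSub (c 5) ⊔ ImSub (c 7))) :
        Submodule K V) := by
  unfold Indep at *
  wlog h12 : k < l generalizing k l
  · rw [sup_comm (ImSub (c k))]
    exact this hil hjl hik hjk (by omega) (by omega)
  wlog h13 : i < j generalizing i j
  · rw [sup_left_comm]
    exact this (by omega) hjk hik hjl hil (by omega)
  by_cases h1 : k < i
  · by_cases h2 : l < i
    · rw [← h.rho4_sorted k l i j (by omega) (by omega) (by omega) (by omega) (by omega)]
      exact fr_congr (by ac_rfl)
    · by_cases h3 : l < j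
      · rw [← h.rho4_sorted k i l j (by omega) (by omega) (by omega) (by omega) (by omega)]
        exact fr_congr (by ac_rfl)
      · rw [← h.rho4_sorted k i j l (by omega) (by omega) (by omega) (by omega) (by omega)]
        exact fr_congr (by ac_rfl)
  · by_cases h2 : l < j
    · rw [← h.rho4_sorted i k l j (by omega) (by omega) (by omega) (by omega) (by omega)]
      exact fr_congr (by ac_rfl)
    · by_cases h3 : k < j
      · rw [← h.rho4_sorted i k j l (by omega) (by omega) (by omega) (by omega) (by omega)]
        exact fr_congr (by ac_rfl)
      · exact h.rho4_sorted i j k l (by omega) (by omega) (by omega) (by omega) (by omega)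

theorem Rep3.rho4_ne (h : Rep3 c N) :
    finrank K (ImSub (c 1) ⊔ (ImSub (c 3) ⊔ ImSub (c 5)) : Submodule K V) <
      finrank K (ImSub (c 1) ⊔ (ImSub (c 3) ⊔ (ImSub (c 5) ⊔ ImSub (c 7))) :
        Submodule K V) := by
  have hN := h.big
  by_contra hlt
  have key : ∀ i j k l, Indep N i j → Indep N i k → Indep N j k → Indep N i l → Indep N j l →
      Indep N k l → ImSub (c l) ≤ ImSub (c i) ⊔ (ImSub (c j) ⊔ ImSub (c k)) := by
    intro i j k l h1 h2 h3 h4 h5 h6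
    have e3 := h.rho3 h1 h2 h3
    have e4 := h.rho4 h1 h2 h3 h4 h5 h6
    have hle : ImSub (c i) ⊔ (ImSub (c j) ⊔ ImSub (c k)) ≤
        ImSub (c i) ⊔ (ImSub (c j) ⊔ (ImSub (c k) ⊔ ImSub (c l))) :=
      sup_le_sup_left (sup_le_sup_left le_sup_left _) _
    have := Submodule.eq_of_le_of_finrank_le hle (by omega)
    rw [this]
    exact le_sup_of_le_right (le_sup_of_le_right le_sup_right)
  set W := ImSub (c 1) ⊔ (ImSub (c 3) ⊔ ImSub (c 5)) with hW
  have m1 : ImSub (c 1) ≤ W := le_sup_left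
  have m3 : ImSub (c 3) ≤ W := le_sup_of_le_right le_sup_left
  have m5 : ImSub (c 5) ≤ W := le_sup_of_le_right le_sup_right
  have key' : ∀ i j k l, Indep N i j → Indep N i k → Indep N j k → Indep N i l →
      Indep N j l → Indep N k l → ImSub (c i) ≤ W → ImSub (c j) ≤ W → ImSub (c k) ≤ W →
      ImSub (c l) ≤ W := fun i j k l h1 h2 h3 h4 h5 h6 a1 a2 a3 =>
    (key i j k l h1 h2 h3 h4 h5 h6).trans (sup_le a1 (sup_le a2 a3))
  have m8 : ∀ l, 7 ≤ l → l ≤ N → ImSub (c l) ≤ W := fun l _ _ =>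
    key' 1 3 5 l (by unfold Indep; omega) (by unfold Indep; omega) (by unfold Indep; omega)
      (by unfold Indep; omega) (by unfold Indep; omega) (by unfold Indep; omega) m1 m3 m5
  have m6 : ImSub (c 6) ≤ W :=
    key' 1 3 8 6 (by unfold Indep; omega) (by unfold Indep; omega) (by unfold Indep; omega)
      (by unfold Indep; omega) (by unfold Indep; omega) (by unfold Indep; omega) m1 m3
      (m8 8 (by omega) hN)
  have m4 : ImSub (c 4) ≤ W :=
    key' 1 6 8 4 (by unfold Indep; omega) (by unfold Indep; omega) (by unfold Indep; omega)
      (by unfold Indep; omega) (by unfold Indep; omega) (by unfold Indep; omega) m1 m6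
      (m8 8 (by omega) hN)
  have m2 : ImSub (c 2) ≤ W :=
    key' 4 6 8 2 (by unfold Indep; omega) (by unfold Indep; omega) (by unfold Indep; omega)
      (by unfold Indep; omega) (by unfold Indep; omega) (by unfold Indep; omega) m4 m6
      (m8 8 (by omega) hN)
  have r1 := h.rank3 1 (by omega) (by omega)
  have r3 := h.rank3 3 (by omega) (by omega)
  have r5 := h.rank3 5 (by omega) (by omega)
  have d1 := Submodule.finrank_add_le_finrank_add_finrank (ImSub (c 3)) (ImSub (c 5))
  have d2 := Submodule.finrank_add_le_finrank_add_finrank (ImSub (c 1))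
    (ImSub (c 3) ⊔ ImSub (c 5))
  rw [← hW] at d2
  have hbot := h.eq_bot W (fun i hi hi' => smul_eq_of_ImSub_le (by
    by_cases h7 : 7 ≤ i
    · exact m8 i h7 hi'
    · interval_cases i <;> assumption)) (by omega)
  rw [hbot, le_bot_iff] at m1
  rw [m1, finrank_bot] at r1
  omega

/-- The case of equal second and third growth. -/
theorem Rep3.disj_of_23 (h : Rep3 c N)
    (he : finrank K (ImSub (c 1) ⊔ (ImSub (c 3) ⊔ ImSub (c 5)) : Submodule K V) + 3 =
      2 * finrank K (ImSub (c 1) ⊔ ImSub (c 3) : Submodule K V)) :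
    ImSub (c 1) ⊓ ImSub (c 3) = ⊥ := by
  have hN := h.big
  have key : ∀ i j k, Indep N i j → Indep N i k → Indep N j k →
      ImSub (c j) ⊓ ImSub (c k) ≤ ImSub (c i) ⊓ ImSub (c k) := by
    intro i j k h1 h2 h3
    have rk := h.rank3 k h2.2.2.1 h2.2.2.2.1
    have ri := h.rank3 i h2.1 h2.2.1
    have e2 := h.rho2 h1
    have e2' := h.rho2 h2
    have e3 := h.rho3 h1 h2 h3
    rw [← sup_assoc] at e3
    have f1 := Submodule.finrank_sup_add_finrank_inf_eq (ImSub (c i)) (ImSub (c k))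
    have f2 := Submodule.finrank_sup_add_finrank_inf_eq (ImSub (c i) ⊔ ImSub (c j))
      (ImSub (c k))
    have hle : ImSub (c i) ⊓ ImSub (c k) ≤ (ImSub (c i) ⊔ ImSub (c j)) ⊓ ImSub (c k) :=
      inf_le_inf_right _ le_sup_left
    rw [Submodule.eq_of_le_of_finrank_le hle (by omega)]
    exact inf_le_inf_right _ le_sup_right
  have key' : ∀ i j k, Indep N i j → Indep N i k → Indep N j k →
      ImSub (c j) ⊓ ImSub (c k) = ImSub (c i) ⊓ ImSub (c k) := fun i j k h1 h2 h3 =>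
    le_antisymm (key i j k h1 h2 h3) (key j i k h1.symm h3 h2)
  have e1 : ImSub (c 1) ⊓ ImSub (c 3) = ImSub (c 6) ⊓ ImSub (c 8) := by
    rw [key' 6 1 3 (by unfold Indep; omega) (by unfold Indep; omega) (by unfold Indep; omega),
      inf_comm,
      key' 8 3 6 (by unfold Indep; omega) (by unfold Indep; omega) (by unfold Indep; omega),
      inf_comm]
  have r1 := h.rank3 1 (by omega) (by omega)
  have inv : ∀ m i j, (m = i ∨ Indep N m i) → (m = j ∨ Indep N m j) →
      c m • (ImSub (c i) ⊓ ImSub (c j)) = ImSub (c i) ⊓ ImSub (c j) := by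
    intro m i j h1 h2
    rw [smul_inf_sub]
    congr 1
    · rcases h1 with rfl | h1
      · exact smul_self_ImSub _
      · exact h.smul_indep h1
    · rcases h2 with rfl | h1
      · exact smul_self_ImSub _
      · exact h.smul_indep h1
  refine h.eq_bot _ ?_ ?_
  · intro i hi hi'
    by_cases h5 : i = 1 ∨ i = 3 ∨ 5 ≤ i
    · exact inv i 1 3 (by unfold Indep; omega) (by unfold Indep; omega)
    · rw [e1]
      exact inv i 6 8 (by unfold Indep; omega) (by unfold Indep; omega)
  · have := Submodule.finrank_mono (inf_le_left : ImSub (c 1) ⊓ ImSub (c 3) ≤ ImSub (c 1))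
    omega

/-- Auxiliary subspace attached to three subspaces. -/
def triW (P Q R : Submodule K V) : Submodule K V :=
  ((Q ⊔ R) ⊓ P) ⊔ (((P ⊔ R) ⊓ Q) ⊔ ((P ⊔ Q) ⊓ R))

theorem tri_le (P Q R : Submodule K V) :
    (P ⊔ Q) ⊓ R ≤ ((Q ⊔ R) ⊓ P) ⊔ ((P ⊔ R) ⊓ Q) := by
  rintro x ⟨hx, hR⟩
  obtain ⟨p, hp, q, hq, rfl⟩ := Submodule.mem_sup.1 hx
  refine Submodule.add_mem_sup ⟨?_, hp⟩ ⟨?_, hq⟩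
  · have : p = -q + (p + q) := by abel
    rw [this]
    exact Submodule.add_mem_sup (neg_mem hq) hR
  · have : q = -p + (p + q) := by abel
    rw [this]
    exact Submodule.add_mem_sup (neg_mem hp) hR

theorem triW_eq (P Q R : Submodule K V) :
    triW P Q R = ((Q ⊔ R) ⊓ P) ⊔ ((P ⊔ R) ⊓ Q) := by
  unfold triW
  rw [← sup_assoc]
  exact sup_eq_left.2 (tri_le P Q R)

theorem triW_perm (P Q R : Submodule K V) : triW P Q R = triW Q R P := by
  unfold triW
  rw [sup_comm Q P, sup_comm R P]
  ac_rfl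

/-- The case of equal third and fourth growth. -/
theorem Rep3.disj_of_34 (h : Rep3 c N)
    (he : finrank K (ImSub (c 1) ⊔ (ImSub (c 3) ⊔ (ImSub (c 5) ⊔ ImSub (c 7))) :
        Submodule K V) + finrank K (ImSub (c 1) ⊔ ImSub (c 3) : Submodule K V) =
      2 * finrank K (ImSub (c 1) ⊔ (ImSub (c 3) ⊔ ImSub (c 5)) : Submodule K V)) :
    ImSub (c 1) ⊓ ImSub (c 3) = ⊥ := by
  have hN := h.big
  have key : ∀ x i j k, Indep N x i → Indep N x j → Indep N x k → Indep N i j → Indep N i k →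
      Indep N j k →
      (ImSub (c i) ⊔ ImSub (c j)) ⊓ ImSub (c x) ≤ (ImSub (c i) ⊔ ImSub (c k)) ⊓ ImSub (c x) := by
    intro x i j k xi xj xk ij ik jk
    have rx := h.rank3 x xi.1 xi.2.1
    have e2 := h.rho2 ik
    have e3 := h.rho3 xi xk ik
    have e3' := h.rho3 ij ik jk
    have e4 := h.rho4 xi xj ij xk ik jk
    have f1 := Submodule.finrank_sup_add_finrank_inf_eq (ImSub (c x))
      (ImSub (c i) ⊔ ImSub (c k))
    have f2 := Submodule.finrank_sup_add_finrank_inf_eq (ImSub (c x))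
      (ImSub (c i) ⊔ (ImSub (c j) ⊔ ImSub (c k)))
    have hle : ImSub (c x) ⊓ (ImSub (c i) ⊔ ImSub (c k)) ≤
        ImSub (c x) ⊓ (ImSub (c i) ⊔ (ImSub (c j) ⊔ ImSub (c k))) :=
      inf_le_inf_left _ (sup_le_sup_left le_sup_right _)
    rw [inf_comm (ImSub (c i) ⊔ ImSub (c k)), inf_comm (ImSub (c i) ⊔ ImSub (c j)),
      Submodule.eq_of_le_of_finrank_le hle (by omega)]
    exact inf_le_inf_left _ (sup_le_sup_left le_sup_left _)
  have key' : ∀ i j k l, Indep N i j → Indep N i k → Indep N i l → Indep N j k → Indep N j l →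
      Indep N k l → triW (ImSub (c i)) (ImSub (c j)) (ImSub (c k)) =
        triW (ImSub (c i)) (ImSub (c j)) (ImSub (c l)) := by
    intro i j k l ij ik il jk jl kl
    rw [triW_eq, triW_eq, le_antisymm (key i j k l ij ik il jk jl kl)
      (key i j l k ij il ik jl jk kl.symm), le_antisymm
      (key j i k l ij.symm jk jl ik il kl) (key j i l k ij.symm jl jk il ik kl.symm)]
  have e1 : triW (ImSub (c 1)) (ImSub (c 3)) (ImSub (c 5)) =
      triW (ImSub (c 1)) (ImSub (c 3)) (ImSub (c 8)) :=
    key' 1 3 5 8 (by unfold Indep; omega) (by unfold Indep; omega) (by unfold Indep; omega)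
      (by unfold Indep; omega) (by unfold Indep; omega) (by unfold Indep; omega)
  have e2 : triW (ImSub (c 1)) (ImSub (c 3)) (ImSub (c 8)) =
      triW (ImSub (c 8)) (ImSub (c 1)) (ImSub (c 6)) := by
    rw [triW_perm, triW_perm]
    exact key' 8 1 3 6 (by unfold Indep; omega) (by unfold Indep; omega)
      (by unfold Indep; omega) (by unfold Indep; omega) (by unfold Indep; omega)
      (by unfold Indep; omega)
  have e3 : triW (ImSub (c 8)) (ImSub (c 1)) (ImSub (c 6)) =
      triW (ImSub (c 6)) (ImSub (c 8)) (ImSub (c 4)) := by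
    rw [triW_perm, triW_perm]
    exact key' 6 8 1 4 (by unfold Indep; omega) (by unfold Indep; omega)
      (by unfold Indep; omega) (by unfold Indep; omega) (by unfold Indep; omega)
      (by unfold Indep; omega)
  have inv : ∀ m i j k, (m = i ∨ Indep N m i) → (m = j ∨ Indep N m j) →
      (m = k ∨ Indep N m k) → c m • triW (ImSub (c i)) (ImSub (c j)) (ImSub (c k)) =
        triW (ImSub (c i)) (ImSub (c j)) (ImSub (c k)) := by
    intro m i j k h1 h2 h3
    have aux : ∀ i, (m = i ∨ Indep N m i) → c m • ImSub (c i) = ImSub (c i) := by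
      rintro i (rfl | h1)
      · exact smul_self_ImSub _
      · exact h.smul_indep h1
    unfold triW
    simp only [Submodule.smul_sup', smul_inf_sub, aux i h1, aux j h2, aux k h3]
  have r1 := h.rank3 1 (by omega) (by omega)
  have r3 := h.rank3 3 (by omega) (by omega)
  have hb : triW (ImSub (c 1)) (ImSub (c 3)) (ImSub (c 5)) = ⊥ := by
    refine h.eq_bot _ ?_ ?_
    · intro i hi hi'
      by_cases h5 : i = 1 ∨ i = 3 ∨ i = 5 ∨ 7 ≤ i
      · exact inv i 1 3 5 (by unfold Indep; omega) (by unfold Indep; omega)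
          (by unfold Indep; omega)
      · by_cases h2 : i = 2
        · rw [e1, e2, e3]
          exact inv i 6 8 4 (by unfold Indep; omega) (by unfold Indep; omega)
            (by unfold Indep; omega)
        · rw [e1, e2]
          exact inv i 8 1 6 (by unfold Indep; omega) (by unfold Indep; omega)
            (by unfold Indep; omega)
    · rw [triW_eq]
      have := Submodule.finrank_mono (sup_le_sup inf_le_right inf_le_right :
        ((ImSub (c 3) ⊔ ImSub (c 5)) ⊓ ImSub (c 1)) ⊔ ((ImSub (c 1) ⊔ ImSub (c 5)) ⊓
          ImSub (c 3)) ≤ ImSub (c 1) ⊔ ImSub (c 3))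
      have d1 := Submodule.finrank_add_le_finrank_add_finrank (ImSub (c 1)) (ImSub (c 3))
      omega
  rw [eq_bot_iff, ← hb, triW_eq]
  refine le_sup_of_le_left ?_
  rw [inf_comm]
  exact inf_le_inf_right _ le_sup_left

theorem Rep3.disj13 (h : Rep3 c N) : ImSub (c 1) ⊓ ImSub (c 3) = ⊥ := by
  have hN := h.big
  by_contra hne
  have h4 := h.rho4_ne
  have h23 := mt h.disj_of_23 hne
  have h34 := mt h.disj_of_34 hne
  have r1 := h.rank3 1 (by omega) (by omega)
  have r3 := h.rank3 3 (by omega) (by omega)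
  have f := Submodule.finrank_sup_add_finrank_inf_eq (ImSub (c 1)) (ImSub (c 3))
  have fpos : finrank K (ImSub (c 1) ⊓ ImSub (c 3) : Submodule K V) ≠ 0 := by
    rwa [Ne, Submodule.finrank_eq_zero]
  -- submodularity
  have i13 : Indep N 1 3 := by unfold Indep; omega
  have i15 : Indep N 1 5 := by unfold Indep; omega
  have i17 : Indep N 1 7 := by unfold Indep; omega
  have i35 : Indep N 3 5 := by unfold Indep; omega
  have i37 : Indep N 3 7 := by unfold Indep; omega
  have i57 : Indep N 5 7 := by unfold Indep; omega
  have e35 := h.rho2 i35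
  have e357 := h.rho3 i35 i37 i57
  have s1 := Submodule.finrank_sup_add_finrank_inf_eq (ImSub (c 1) ⊔ ImSub (c 3))
    (ImSub (c 3) ⊔ ImSub (c 5))
  have m1 := Submodule.finrank_mono (le_inf le_sup_right le_sup_left :
    ImSub (c 3) ≤ (ImSub (c 1) ⊔ ImSub (c 3)) ⊓ (ImSub (c 3) ⊔ ImSub (c 5)))
  have t1 : (ImSub (c 1) ⊔ ImSub (c 3)) ⊔ (ImSub (c 3) ⊔ ImSub (c 5)) =
      ImSub (c 1) ⊔ (ImSub (c 3) ⊔ ImSub (c 5)) := by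
    rw [sup_assoc, ← sup_assoc (ImSub (c 3)), sup_idem]
  rw [t1] at s1
  have s2 := Submodule.finrank_sup_add_finrank_inf_eq
    (ImSub (c 1) ⊔ (ImSub (c 3) ⊔ ImSub (c 5)))
    (ImSub (c 3) ⊔ (ImSub (c 5) ⊔ ImSub (c 7)))
  have m2 := Submodule.finrank_mono (le_inf le_sup_right
    (sup_le_sup_left le_sup_left _) :
    ImSub (c 3) ⊔ ImSub (c 5) ≤ (ImSub (c 1) ⊔ (ImSub (c 3) ⊔ ImSub (c 5))) ⊓
      (ImSub (c 3) ⊔ (ImSub (c 5) ⊔ ImSub (c 7))))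
  have t2 : (ImSub (c 1) ⊔ (ImSub (c 3) ⊔ ImSub (c 5))) ⊔
      (ImSub (c 3) ⊔ (ImSub (c 5) ⊔ ImSub (c 7))) =
      ImSub (c 1) ⊔ (ImSub (c 3) ⊔ (ImSub (c 5) ⊔ ImSub (c 7))) := by
    rw [sup_assoc]
    congr 1
    exact sup_eq_right.2 (sup_le_sup_left le_sup_left _)
  rw [t2] at s2
  omega

theorem Rep3.disj (h : Rep3 c N) {i j : ℕ} (hij : Indep N i j) :
    ImSub (c i) ⊓ ImSub (c j) = ⊥ := by
  have hN := h.big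
  have e := h.rho2 hij
  have ri := h.rank3 i hij.1 hij.2.1
  have rj := h.rank3 j hij.2.2.1 hij.2.2.2.1
  have r1 := h.rank3 1 (by omega) (by omega)
  have r3 := h.rank3 3 (by omega) (by omega)
  have f := Submodule.finrank_sup_add_finrank_inf_eq (ImSub (c 1)) (ImSub (c 3))
  have f' := Submodule.finrank_sup_add_finrank_inf_eq (ImSub (c i)) (ImSub (c j))
  rw [h.disj13, finrank_bot] at f
  rw [← Submodule.finrank_eq_zero (R := K)]
  omega

/-! ### Neighbours -/

/-- Intersection of the images of neighbours. -/
def lineL (c : ℕ → V ≃ₗ[K] V) (i : ℕ) : Submodule K V := ImSub (c i) ⊓ ImSub (c (i + 1))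

theorem Rep3.fixL (h : Rep3 c N) {i k : ℕ} (hi : 1 ≤ i) (hi' : i + 1 ≤ N) (hk : 1 ≤ k)
    (hk' : k ≤ N) (h1 : k ≠ i) (h2 : k ≠ i + 1) : c k • lineL c i = lineL c i := by
  by_cases hlt : k < i
  · have hI : Indep N k (i + 1) := by unfold Indep; omega
    exact fix_of_disj (h.comm' hI) (h.disj hI) inf_le_right
  · have hI : Indep N k i := by unfold Indep; omega
    exact fix_of_disj (h.comm' hI) (h.disj hI) inf_le_left

theorem Rep3.shift_rel (h : Rep3 c N) {j : ℕ} (hj : 1 ≤ j) (hj' : j + 2 ≤ N) :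
    (c j * c (j + 1) * c (j + 2)) * c j = c (j + 1) * (c j * c (j + 1) * c (j + 2)) ∧
    (c j * c (j + 1) * c (j + 2)) * c (j + 1) = c (j + 2) * (c j * c (j + 1) * c (j + 2)) := by
  have b1 := h.braid j hj (by omega)
  have b2 := h.braid (j + 1) (by omega) (by omega)
  have cm := h.comm j (j + 2) hj (by omega) (by omega) hj' le_rfl
  rw [show j + 1 + 1 = j + 2 from rfl] at b2
  constructor
  · calc c j * c (j + 1) * c (j + 2) * c j = c j * c (j + 1) * (c j * c (j + 2)) := by
          rw [cm]; group
      _ = (c j * c (j + 1) * c j) * c (j + 2) := by group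
      _ = _ := by rw [b1]; group
  · calc c j * c (j + 1) * c (j + 2) * c (j + 1) = c j * (c (j + 1) * c (j + 2) * c (j + 1)) := by
          group
      _ = (c j * c (j + 2)) * c (j + 1) * c (j + 2) := by rw [b2]; group
      _ = _ := by rw [cm]; group

theorem Rep3.shift_rel' (h : Rep3 c N) {j : ℕ} (hj : 1 ≤ j) (hj' : j + 2 ≤ N) :
    (c (j + 2) * c (j + 1) * c j) * c (j + 1) = c j * (c (j + 2) * c (j + 1) * c j) ∧
    (c (j + 2) * c (j + 1) * c j) * c (j + 2) = c (j + 1) * (c (j + 2) * c (j + 1) * c j) := by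
  have b1 := h.braid j hj (by omega)
  have b2 := h.braid (j + 1) (by omega) (by omega)
  have cm := h.comm j (j + 2) hj (by omega) (by omega) hj' le_rfl
  rw [show j + 1 + 1 = j + 2 from rfl] at b2
  constructor
  · calc c (j + 2) * c (j + 1) * c j * c (j + 1) = c (j + 2) * (c (j + 1) * c j * c (j + 1)) := by
          group
      _ = (c (j + 2) * c j) * c (j + 1) * c j := by rw [← b1]; group
      _ = _ := by rw [← cm]; group
  · calc c (j + 2) * c (j + 1) * c j * c (j + 2) = c (j + 2) * c (j + 1) * (c j * c (j + 2)) := by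
          group
      _ = (c (j + 2) * c (j + 1) * c (j + 2)) * c j := by rw [cm]; group
      _ = _ := by rw [← b2]; group

theorem Rep3.shiftL (h : Rep3 c N) {j : ℕ} (hj : 1 ≤ j) (hj' : j + 2 ≤ N) :
    (c j * c (j + 1) * c (j + 2)) • lineL c j = lineL c (j + 1) := by
  obtain ⟨h1, h2⟩ := h.shift_rel hj hj'
  rw [lineL, smul_inf_sub, ImSub_conj h1, ImSub_conj h2, lineL]

theorem Rep3.shiftL' (h : Rep3 c N) {j : ℕ} (hj : 1 ≤ j) (hj' : j + 2 ≤ N) :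
    (c (j + 2) * c (j + 1) * c j) • lineL c (j + 1) = lineL c j := by
  obtain ⟨h1, h2⟩ := h.shift_rel' hj hj'
  rw [lineL, smul_inf_sub, ImSub_conj h1, show j + 1 + 1 = j + 2 from rfl, ImSub_conj h2, lineL]

theorem Rep3.upL (h : Rep3 c N) {j : ℕ} (hj : 1 ≤ j) (hj' : j + 2 ≤ N) :
    c (j + 1) • lineL c j = lineL c (j + 1) := by
  have e := h.shiftL hj hj'
  rw [mul_smul, mul_smul, h.fixL hj (by omega) (k := j + 2) (by omega) (by omega) (by omega)
    (by omega), ← h.fixL (i := j + 1) (k := j) (by omega) (by omega) hj (by omega) (by omega)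
    (by omega)] at e
  exact smul_left_cancel _ e

theorem Rep3.downL (h : Rep3 c N) {j : ℕ} (hj : 1 ≤ j) (hj' : j + 2 ≤ N) :
    c (j + 1) • lineL c (j + 1) = lineL c j := by
  have e := h.shiftL' hj hj'
  rw [mul_smul, mul_smul, h.fixL (i := j + 1) (k := j) (by omega) (by omega) hj (by omega)
    (by omega) (by omega), ← h.fixL (i := j) hj (by omega) (k := j + 2) (by omega) (by omega)
    (by omega) (by omega)] at e
  exact smul_left_cancel _ e

theorem Rep3.rankL (h : Rep3 c N) {i : ℕ} (hi : 1 ≤ i) (hi' : i + 1 ≤ N) :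
    finrank K (lineL c i) = finrank K (lineL c 1) := by
  induction i, hi using Nat.le_induction with
  | base => rfl
  | succ i hi ih =>
    rw [← ih (by omega), ← h.upL hi hi', finrank_smul_sub]

theorem Rep3.rankL_le (h : Rep3 c N) : finrank K (lineL c 1) ≤ 1 := by
  have hN := h.big
  have e := h.rankL (i := 2) (by omega) (by omega)
  have r2 := h.rank3 2 (by omega) (by omega)
  have d := h.disj (i := 1) (j := 3) (by unfold Indep; omega)
  have f := Submodule.finrank_sup_add_finrank_inf_eq (lineL c 1) (lineL c 2)
  have b : lineL c 1 ⊓ lineL c 2 = ⊥ := by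
    rw [eq_bot_iff, ← d]
    exact inf_le_inf inf_le_left inf_le_right
  have m := Submodule.finrank_mono (sup_le inf_le_right inf_le_left :
    lineL c 1 ⊔ lineL c 2 ≤ ImSub (c 2))
  rw [b, finrank_bot] at f
  omega

/-- The extended family of lines. -/
def extL (c : ℕ → V ≃ₗ[K] V) (N i : ℕ) : Submodule K V :=
  if i = 0 then c 1 • lineL c 1 else if i = N then c N • lineL c (N - 1) else lineL c i

theorem Rep3.sq_first (h : Rep3 c N) : c 1 • c 1 • lineL c 1 = lineL c 1 := by
  have hN := h.big
  obtain ⟨h1, -⟩ := h.shift_rel (j := 1) le_rfl (by omega)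
  have e := h.shiftL (j := 1) le_rfl (by omega)
  have s : c 2 • c 2 • lineL c 2 = lineL c 2 := by
    rw [h.downL (j := 1) le_rfl (by omega), h.upL (j := 1) le_rfl (by omega)]
  apply smul_left_cancel (c 1 * c (1 + 1) * c (1 + 2))
  rw [← mul_smul, h1, mul_smul, ← mul_smul _ (c 1) (lineL c 1), h1, mul_smul, e]
  exact s

theorem Rep3.sq_last (h : Rep3 c N) {j : ℕ} (hj : j + 2 = N) (hj1 : 1 ≤ j) :
    c (j + 2) • c (j + 2) • lineL c (j + 1) = lineL c (j + 1) := by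
  have hN := h.big
  obtain ⟨-, h1⟩ := h.shift_rel' (j := j) hj1 (by omega)
  have e := h.shiftL' (j := j) hj1 (by omega)
  have s : c (j + 1) • c (j + 1) • lineL c j = lineL c j := by
    rw [h.upL hj1 (by omega), h.downL hj1 (by omega)]
  apply smul_left_cancel (c (j + 2) * c (j + 1) * c j)
  rw [← mul_smul, h1, mul_smul, ← mul_smul _ (c (j + 2)) (lineL c (j + 1)), h1, mul_smul, e]
  exact s

theorem Rep3.perm_first (h : Rep3 c N) {k : ℕ} (hk : 2 ≤ k) (hk' : k ≤ N) :
    c k • c 1 • lineL c 1 = c 1 • lineL c 1 := by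
  have hN := h.big
  by_cases h2 : k = 2
  · subst h2
    have b := h.braid 1 le_rfl (by omega)
    have dn : c 2 • lineL c 2 = lineL c 1 := h.downL (j := 1) le_rfl (by omega)
    have f : c 1 • lineL c 2 = lineL c 2 :=
      h.fixL (i := 2) (k := 1) (by omega) (by omega) le_rfl (by omega) (by omega) (by omega)
    have b' : c 2 * c 1 * c 2 = c 1 * c 2 * c 1 := b.symm
    calc c 2 • c 1 • lineL c 1 = (c 2 * c 1 * c 2) • lineL c 2 := by
          rw [mul_smul, mul_smul, dn]
      _ = c 1 • lineL c 1 := by rw [b', mul_smul, mul_smul, f, dn]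
  · have cm := h.comm 1 k le_rfl (by omega) (by omega) hk' (by omega)
    rw [← mul_smul, ← cm, mul_smul,
      h.fixL le_rfl (by omega) (by omega) hk' (by omega) (by omega)]

theorem Rep3.perm_last (h : Rep3 c N) {j k : ℕ} (hj : j + 2 = N) (hj1 : 1 ≤ j) (hk : 1 ≤ k)
    (hk' : k ≤ j + 1) :
    c k • c (j + 2) • lineL c (j + 1) = c (j + 2) • lineL c (j + 1) := by
  have hN := h.big
  by_cases h2 : k = j + 1
  · subst h2
    have b := h.braid (j + 1) (by omega) (by omega)
    have up : c (j + 1) • lineL c j = lineL c (j + 1) := h.upL hj1 (by omega)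
    have f : c (j + 2) • lineL c j = lineL c j :=
      h.fixL hj1 (by omega) (by omega) (by omega) (by omega) (by omega)
    have b' : c (j + 1) * c (j + 2) * c (j + 1) = c (j + 2) * c (j + 1) * c (j + 2) := b
    calc c (j + 1) • c (j + 2) • lineL c (j + 1)
        = (c (j + 1) * c (j + 2) * c (j + 1)) • lineL c j := by
          rw [mul_smul, mul_smul, up]
      _ = c (j + 2) • lineL c (j + 1) := by rw [b', mul_smul, mul_smul, f, up]
  · have cm := h.comm k (j + 2) hk (by omega) (by omega) (by omega) (by omega)
    rw [← mul_smul, cm, mul_smul,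
      h.fixL (by omega) (by omega) (by omega) (by omega) (by omega) (by omega)]

/-- Every generator permutes the extended family of lines. -/
theorem Rep3.extL_perm (h : Rep3 c N) {i k : ℕ} (hi : i ≤ N) (hk : 1 ≤ k) (hk' : k ≤ N) :
    ∃ i' ≤ N, c k • extL c N i = extL c N i' := by
  have hN := h.big
  obtain ⟨j, rfl⟩ : ∃ j, N = j + 2 := ⟨N - 2, by omega⟩
  have x0 : extL c (j + 2) 0 = c 1 • lineL c 1 := by simp [extL]
  have xN : extL c (j + 2) (j + 2) = c (j + 2) • lineL c (j + 1) := by simp [extL]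
  have xi : ∀ i, 1 ≤ i → i ≤ j + 1 → extL c (j + 2) i = lineL c i := by
    intro i h1 h2
    rw [extL, if_neg (by omega), if_neg (by omega)]
  by_cases hi0 : i = 0
  · subst hi0
    by_cases hk1 : k = 1
    · subst hk1
      exact ⟨1, by omega, by rw [x0, h.sq_first, xi 1 le_rfl (by omega)]⟩
    · exact ⟨0, by omega, by rw [x0, h.perm_first (by omega) hk']⟩
  by_cases hiN : i = j + 2
  · subst hiN
    by_cases hk1 : k = j + 2
    · subst hk1
      exact ⟨j + 1, by omega, by rw [xN, h.sq_last rfl (by omega), xi _ (by omega) le_rfl]⟩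
    · exact ⟨j + 2, le_rfl, by rw [xN, h.perm_last rfl (by omega) hk (by omega)]⟩
  rw [xi i (by omega) (by omega)]
  by_cases hki : k = i
  · subst hki
    by_cases hk1 : k = 1
    · subst hk1
      exact ⟨0, by omega, x0.symm⟩
    · obtain ⟨m, rfl⟩ : ∃ m, k = m + 1 := ⟨k - 1, by omega⟩
      exact ⟨m, by omega, by rw [h.downL (by omega) (by omega), xi m (by omega) (by omega)]⟩
  by_cases hki : k = i + 1
  · subst hki
    by_cases hiL : i = j + 1
    · subst hiL
      exact ⟨j + 2, le_rfl, xN.symm⟩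
    · exact ⟨i + 1, by omega, by rw [h.upL (by omega) (by omega), xi _ (by omega) (by omega)]⟩
  exact ⟨i, hi, by
    rw [h.fixL (by omega) (by omega) hk hk' (by omega) (by omega), xi i (by omega) (by omega)]⟩

theorem Rep3.extL_rank (h : Rep3 c N) {i : ℕ} (hi : i ≤ N) : finrank K (extL c N i) ≤ 1 := by
  have hN := h.big
  have e := h.rankL_le
  by_cases h0 : i = 0
  · rw [extL, if_pos h0, finrank_smul_sub]
    exact e
  by_cases h1 : i = N
  · rw [extL, if_neg h0, if_pos h1, finrank_smul_sub, h.rankL (by omega) (by omega)]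
    exact e
  · rw [extL, if_neg h0, if_neg h1, h.rankL (by omega) (by omega)]
    exact e

theorem finrank_sup_range_le (L : ℕ → Submodule K V) (k : ℕ)
    (hL : ∀ i < k, finrank K (L i) ≤ 1) :
    finrank K ((Finset.range k).sup L : Submodule K V) ≤ k := by
  induction k with
  | zero => rw [Finset.range_zero, Finset.sup_empty, finrank_bot]
  | succ k ih =>
    rw [Finset.range_add_one, Finset.sup_insert]
    have := Submodule.finrank_add_le_finrank_add_finrank (L k) ((Finset.range k).sup L)
    have h1 := hL k (by omega)
    have h2 := ih (fun i hi => hL i (by omega))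
    omega

theorem Rep3.line_eq_bot (h : Rep3 c N) {i : ℕ} (hi : 1 ≤ i) (hi' : i + 1 ≤ N) :
    ImSub (c i) ⊓ ImSub (c (i + 1)) = ⊥ := by
  have hN := h.big
  have hM : (Finset.range (N + 1)).sup (extL c N) = ⊥ := by
    refine h.eq_bot _ ?_ ?_
    · intro k hk hk'
      apply Submodule.eq_of_le_of_finrank_eq
      · refine Submodule.map_le_iff_le_comap.2 (Finset.sup_le ?_)
        intro i hi
        refine Submodule.map_le_iff_le_comap.1 ?_
        obtain ⟨i', hi', e⟩ := h.extL_perm (i := i) (by simpa [Nat.lt_succ_iff] using hi) hk hk'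
        change c k • extL c N i ≤ _
        rw [e]
        exact Finset.le_sup (by simpa [Nat.lt_succ_iff] using hi')
      · exact finrank_smul_sub _ _
    · exact finrank_sup_range_le _ _ (fun i hi => h.extL_rank (by omega))
  have hle : extL c N i ≤ (Finset.range (N + 1)).sup (extL c N) :=
    Finset.le_sup (by simp; omega)
  rw [hM, le_bot_iff, extL, if_neg (by omega), if_neg (by omega)] at hle
  exact hle

/-- The cyclic version. -/
theorem Rep3.cyclic (h : Rep3 c N) {g : V ≃ₗ[K] V}
    (hg : braidProd c N * c N = g * braidProd c N) :
    ImSub (c N) ⊓ ImSub g = ⊥ ∧ ImSub g ⊓ ImSub (c 1) = ⊥ := by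
  have hN := h.big
  obtain ⟨m, rfl⟩ : ∃ m, N = m + 1 := ⟨N - 1, by omega⟩
  set t := braidProd c (m + 1)
  have e1 : t • ImSub (c (m + 1)) = ImSub g := ImSub_conj hg
  have e2 : t • ImSub (c m) = ImSub (c (m + 1)) :=
    ImSub_conj (h.prod_shift (m + 1) m (by omega) le_rfl le_rfl)
  have e3 : t • ImSub (c 1) = ImSub (c 2) :=
    ImSub_conj (h.prod_shift (m + 1) 1 (by omega) (by omega) le_rfl)
  have e4 : t • ImSub g = ImSub (c 1) := by
    rw [← e1, ← mul_smul]
    exact ImSub_conj (h.prod_sq (by omega))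
  constructor
  · rw [← e1, ← e2, ← smul_inf_sub, e2, h.line_eq_bot (by omega) le_rfl, Submodule.smul_bot']
  · apply smul_left_cancel t
    rw [smul_inf_sub, e4, e3, h.line_eq_bot le_rfl (by omega), Submodule.smul_bot']

end setting

/-! ### Matrices -/

/-- Invertible matrices as linear equivalences. -/
noncomputable def unitEquiv (r : ℕ) :
    (Matrix (Fin r) (Fin r) ℂ)ˣ →* ((Fin r → ℂ) ≃ₗ[ℂ] (Fin r → ℂ)) :=
  (LinearMap.GeneralLinearGroup.generalLinearEquiv ℂ (Fin r → ℂ)).toMonoidHom.comp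
    (Matrix.GeneralLinearGroup.toLin (n := Fin r) (R := ℂ)).toMonoidHom

theorem unitEquiv_apply (r : ℕ) (u : (Matrix (Fin r) (Fin r) ℂ)ˣ) (v : Fin r → ℂ) :
    unitEquiv r u v = (u : Matrix (Fin r) (Fin r) ℂ).mulVec v := rfl

theorem ImSub_unitEquiv (r : ℕ) (u : (Matrix (Fin r) (Fin r) ℂ)ˣ) :
    ImSub (unitEquiv r u) =
      LinearMap.range ((u : Matrix (Fin r) (Fin r) ℂ) - 1).mulVecLin := by
  unfold ImSub
  congr 1
  apply LinearMap.ext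
  intro v
  simp [unitEquiv_apply, Matrix.sub_mulVec]

theorem braidProd_map {G H : Type*} [Group G] [Group H] (f : G →* H) (u : ℕ → G) (k : ℕ) :
    braidProd (fun i => f (u i)) k = f (braidProd u k) := by
  induction k with
  | zero => simp [braidProd]
  | succ k ih => simp [braidProd, ih]

/-- For `n ≥ 9` and an irreducible representation of `B_n` of dimension `r ≥ n+1`,
with `A i = C i - 1` (`i ∈ ℤ_n`, `A 0 = T C_{n-1} T⁻¹ - 1`): if `rank (A i) = 3` for
all `i ∈ ℤ_n`, then `Im A_i ∩ Im A_{i+1} = {0}` for all `i ∈ ℤ_n`. -/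
theorem stmt_18 (n r : ℕ) (hn : 9 ≤ n) (hr : n + 1 ≤ r)
    (C : ℕ → Matrix (Fin r) (Fin r) ℂ)
    (hinv : ∀ i, 1 ≤ i → i ≤ n - 1 → IsUnit (C i))
    (hcomm : ∀ i j, 1 ≤ i → i ≤ n - 1 → 1 ≤ j → j ≤ n - 1 → i + 2 ≤ j →
      C i * C j = C j * C i)
    (hbraid : ∀ i, 1 ≤ i → i ≤ n - 2 →
      C i * C (i + 1) * C i = C (i + 1) * C i * C (i + 1))
    (hirr : ∀ p : Submodule ℂ (Fin r → ℂ),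
      (∀ i, 1 ≤ i → i ≤ n - 1 → ∀ v ∈ p, (C i).mulVec v ∈ p) → p = ⊥ ∨ p = ⊤)
    (T : Matrix (Fin r) (Fin r) ℂ)
    (hT : T = (List.map (fun i => C (i + 1)) (List.range (n - 1))).prod)
    (A : ZMod n → Matrix (Fin r) (Fin r) ℂ)
    (hA : ∀ i : ℕ, 1 ≤ i → i ≤ n - 1 → A (i : ZMod n) = C i - 1)
    (hA0 : A 0 = T * C (n - 1) * T⁻¹ - 1)
    (hrank : ∀ i : ZMod n, (A i).rank = 3) :
    ∀ i : ZMod n,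
      LinearMap.range (A i).mulVecLin ⊓ LinearMap.range (A (i + 1)).mulVecLin = ⊥ := by
  classical
  obtain ⟨u, hu⟩ : ∃ u : ℕ → (Matrix (Fin r) (Fin r) ℂ)ˣ,
      ∀ i, 1 ≤ i → i ≤ n - 1 → (u i : Matrix (Fin r) (Fin r) ℂ) = C i := by
    refine ⟨fun i => if h : 1 ≤ i ∧ i ≤ n - 1 then (hinv i h.1 h.2).unit else 1, ?_⟩
    intro i h1 h2
    simp [h1, h2]
  have hprod : ∀ k, k ≤ n - 1 → ((braidProd u k : (Matrix (Fin r) (Fin r) ℂ)ˣ) :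
      Matrix (Fin r) (Fin r) ℂ) = (List.map (fun i => C (i + 1)) (List.range k)).prod := by
    intro k hk
    induction k with
    | zero => simp [braidProd]
    | succ k ih =>
      rw [braidProd, Units.val_mul, ih (by omega), hu (k + 1) (by omega) hk, List.range_succ]
      simp
  rw [← hprod (n - 1) le_rfl] at hT
  have hA' : ∀ i : ℕ, 1 ≤ i → i ≤ n - 1 →
      LinearMap.range (A (i : ZMod n)).mulVecLin = ImSub (unitEquiv r (u i)) := by
    intro i h1 h2
    rw [ImSub_unitEquiv, hA i h1 h2, hu i h1 h2]
  have hA0' : LinearMap.range (A 0).mulVecLin = ImSub (unitEquiv r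
      (braidProd u (n - 1) * u (n - 1) * (braidProd u (n - 1))⁻¹)) := by
    rw [ImSub_unitEquiv, hA0, hT, Units.val_mul, Units.val_mul, hu (n - 1) (by omega) le_rfl,
      Matrix.coe_units_inv]
  have H : Rep3 (fun i => unitEquiv r (u i)) (n - 1) := by
    refine { comm := ?_, braid := ?_, irr := ?_, rank3 := ?_, big := by omega, dim := ?_ }
    · intro i j h1 h2 h3 h4 h5
      have : u i * u j = u j * u i := by
        apply Units.ext
        rw [Units.val_mul, Units.val_mul, hu i h1 h2, hu j h3 h4, hcomm i j h1 h2 h3 h4 h5]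
      change unitEquiv r (u i) * unitEquiv r (u j) = unitEquiv r (u j) * unitEquiv r (u i)
      rw [← map_mul, ← map_mul, this]
    · intro i h1 h2
      have : u i * u (i + 1) * u i = u (i + 1) * u i * u (i + 1) := by
        apply Units.ext
        simp only [Units.val_mul]
        rw [hu i h1 (by omega), hu (i + 1) (by omega) h2, hbraid i h1 (by omega)]
      simp only [← map_mul, this]
    · intro p hp
      refine hirr p ?_
      intro i h1 h2 v hv
      have := Submodule.smul_mem_pointwise_smul v (unitEquiv r (u i)) p hv
      have e : unitEquiv r (u i) • p = p := hp i h1 h2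
      rw [e] at this
      rw [← hu i h1 h2]
      exact this
    · intro i h1 h2
      change finrank ℂ (ImSub (unitEquiv r (u i))) = 3
      rw [← hA' i h1 h2]
      exact hrank i
    · rw [finrank_fin_fun]
      omega
  have hcyc := H.cyclic (g := unitEquiv r
      (braidProd u (n - 1) * u (n - 1) * (braidProd u (n - 1))⁻¹)) (by
    rw [braidProd_map, ← map_mul, ← map_mul]
    congr 1
    group)
  intro i
  have : NeZero n := ⟨by omega⟩
  have hlt : i.val < n := ZMod.val_lt i
  have hi : ((i.val : ℕ) : ZMod n) = i := ZMod.natCast_zmod_val i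
  by_cases h0 : i.val = 0
  · have hi0 : i = 0 := by rw [← hi, h0, Nat.cast_zero]
    subst hi0
    have h1 := hA' 1 le_rfl (by omega)
    rw [Nat.cast_one] at h1
    rw [zero_add, hA0', h1]
    exact hcyc.2
  by_cases h1 : i.val = n - 1
  · have hs : i + 1 = 0 := by
      rw [← hi, ← Nat.cast_succ, h1, show (n - 1).succ = n by omega, ZMod.natCast_self]
    rw [hs, hA0', ← hi, h1, hA' (n - 1) (by omega) le_rfl]
    exact hcyc.1
  · have h2 := hA' (i.val + 1) (by omega) (by omega)
    rw [Nat.cast_succ, hi] at h2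
    have h3 := hA' i.val (by omega) (by omega)
    rw [hi] at h3
    rw [h2, h3]
    exact H.line_eq_bot (by omega) (by omega)
end
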